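/- Let d ≥ 1, T > 0, let O be the open unit ball of ℝ^d, Q := [0,T) × O, ∂Q := ([0,T] × ∂O) ∪ ({T} × O), and Q̄ := [0,T] × Ō. Let g : [0,T] × Ō × ℝ × ℝ^d × S^d → ℝ and h : ∂Q → ℝ satisfy: (i) h is bounded and continuous, g is continuous, and g is uniformly continuous in (t,x) uniformly with respect to (y,z,γ); (ii) g is uniformly Lipschitz in (y,z,γ), i.e. there is L₀ ≥ 0 with |g(t,x,y,z,γ) − g(t,x,y',z',γ')| ≤ L₀(|y−y'| + |z−z'| + |γ−γ'|), and g is uniformly elliptic, i.e. there is c₀ > 0 with g(t,x,y,z,γ₁) − g(t,x,y,z,γ₂) ≥ c₀ tr(γ₁ − γ₂) whenever γ₁ − γ₂ is positive semidefinite. Assume moreover that either γ ↦ g(t,x,y,z,γ) is convex for every (t,x,y,z), or d ≤ 2. Define v̄(t,x) := inf{ w(t,x) : w is a classical supersolution of −∂_t v − g(t,x,v,Dv,D²v) = 0 on Q with w ≥ h on ∂Q } and v̲(t,x) := sup{ w(t,x) : w is a classical subsolution of this PDE on Q with w ≤ h on ∂Q }. Then v̄(t,x) = v̲(t,x) for every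 (t,x) ∈ Q̄. -/

import Mathlib

/-- The continuous linear map on Euclidean space induced by a matrix. -/
noncomputable def matCLM (d : ℕ) (γ : Matrix (Fin d) (Fin d) ℝ) :
    EuclideanSpace ℝ (Fin d) →L[ℝ] EuclideanSpace ℝ (Fin d) :=
  Matrix.toEuclideanCLM (𝕜 := ℝ) γ

/-- A norm on `d × d` matrices: the operator norm of the induced map on Euclidean space. -/
noncomputable def matNorm (d : ℕ) (γ : Matrix (Fin d) (Fin d) ℝ) : ℝ :=
  ‖matCLM d γ‖

/-- The parabolic cylinder `Q = [0,T) × O`, `O` the open unit ball. -/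
def cylQ (d : ℕ) (T : ℝ) : Set (ℝ × EuclideanSpace ℝ (Fin d)) :=
  Set.Ico 0 T ×ˢ Metric.ball 0 1

/-- The closure `Q̄ = [0,T] × Ō`. -/
def cylQbar (d : ℕ) (T : ℝ) : Set (ℝ × EuclideanSpace ℝ (Fin d)) :=
  Set.Icc 0 T ×ˢ Metric.closedBall 0 1

/-- The parabolic boundary `∂Q = ([0,T] × ∂O) ∪ ({T} × O)`. -/
def cylBdry (d : ℕ) (T : ℝ) : Set (ℝ × EuclideanSpace ℝ (Fin d)) :=
  (Set.Icc 0 T ×ˢ Metric.sphere 0 1) ∪ ({T} ×ˢ Metric.ball 0 1)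

/-- `w` is a classical supersolution of `−∂_t v − g(t,x,v,Dv,D²v) = 0` on `Q` with `w ≥ h` on
`∂Q`: `w` is continuous on `Q̄`, has continuous time derivative, spatial gradient and spatial
Hessian on `Q`, satisfies the differential inequality `≥ 0` on `Q`, and dominates `h` on `∂Q`. -/
def IsClassicalSupersol (d : ℕ) (T : ℝ)
    (g : ℝ → EuclideanSpace ℝ (Fin d) → ℝ → EuclideanSpace ℝ (Fin d) →
      Matrix (Fin d) (Fin d) ℝ → ℝ)
    (h : ℝ × EuclideanSpace ℝ (Fin d) → ℝ)
    (w : ℝ × EuclideanSpace ℝ (Fin d) → ℝ) : Prop :=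
  ∃ (wt : ℝ × EuclideanSpace ℝ (Fin d) → ℝ)
    (Dw : ℝ × EuclideanSpace ℝ (Fin d) → EuclideanSpace ℝ (Fin d))
    (D2w : ℝ × EuclideanSpace ℝ (Fin d) → Matrix (Fin d) (Fin d) ℝ),
    ContinuousOn w (cylQbar d T) ∧
    ContinuousOn wt (cylQ d T) ∧ ContinuousOn Dw (cylQ d T) ∧ ContinuousOn D2w (cylQ d T) ∧
    (∀ p ∈ cylQ d T,
      HasDerivAt (fun s => w (s, p.2)) (wt p) p.1 ∧
      HasGradientAt (fun x => w (p.1, x)) (Dw p) p.2 ∧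
      HasFDerivAt (fun x => Dw (p.1, x)) (matCLM d (D2w p)) p.2 ∧
      (D2w p).IsSymm ∧
      0 ≤ -wt p - g p.1 p.2 (w p) (Dw p) (D2w p)) ∧
    (∀ p ∈ cylBdry d T, h p ≤ w p)

/-- `w` is a classical subsolution of `−∂_t v − g(t,x,v,Dv,D²v) = 0` on `Q` with `w ≤ h`
on `∂Q`. -/
def IsClassicalSubsol (d : ℕ) (T : ℝ)
    (g : ℝ → EuclideanSpace ℝ (Fin d) → ℝ → EuclideanSpace ℝ (Fin d) →
      Matrix (Fin d) (Fin d) ℝ → ℝ)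
    (h : ℝ × EuclideanSpace ℝ (Fin d) → ℝ)
    (w : ℝ × EuclideanSpace ℝ (Fin d) → ℝ) : Prop :=
  ∃ (wt : ℝ × EuclideanSpace ℝ (Fin d) → ℝ)
    (Dw : ℝ × EuclideanSpace ℝ (Fin d) → EuclideanSpace ℝ (Fin d))
    (D2w : ℝ × EuclideanSpace ℝ (Fin d) → Matrix (Fin d) (Fin d) ℝ),
    ContinuousOn w (cylQbar d T) ∧
    ContinuousOn wt (cylQ d T) ∧ ContinuousOn Dw (cylQ d T) ∧ ContinuousOn D2w (cylQ d T) ∧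
    (∀ p ∈ cylQ d T,
      HasDerivAt (fun s => w (s, p.2)) (wt p) p.1 ∧
      HasGradientAt (fun x => w (p.1, x)) (Dw p) p.2 ∧
      HasFDerivAt (fun x => Dw (p.1, x)) (matCLM d (D2w p)) p.2 ∧
      (D2w p).IsSymm ∧
      -wt p - g p.1 p.2 (w p) (Dw p) (D2w p) ≤ 0) ∧
    (∀ p ∈ cylBdry d T, w p ≤ h p)

section Analysis

open Set Filter Topology MeasureTheory

section ConcaveEnvelope

variable {F : Type*} [NormedAddCommGroup F] [InnerProductSpace ℝ F]

/-- `D` admits at each point `x` an affine approximation with slope `G x` and quadratic error. -/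
def HasQuadraticExpansion (D : F → ℝ) (G : F → F) (C : ℝ) : Prop :=
  ∀ x h, |D (x + h) - D x - inner ℝ (G x) h| ≤ C * ‖h‖ ^ 2

/-- The affine function with slope `a.1` and constant term `a.2` dominates `k`. -/
def IsAffineMajorant (k : F → ℝ) (a : F × ℝ) : Prop :=
  ∀ y, k y ≤ inner ℝ a.1 y + a.2

lemma HasQuadraticExpansion.lipschitz {D : F → ℝ} {G : F → F} {C : ℝ} 
    (hD : HasQuadraticExpansion D G C) : LipschitzWith (Real.toNNReal (6 * C)) G := by
  have key : ∀ x h k, |inner ℝ (G (x + h) - G x) k| ≤ C * (3 * ‖k‖ ^ 2 + 3 * ‖h‖ ^ 2) := by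
    intro x h k
    have hC : 0 ≤ C * ‖k‖ ^ 2 := (abs_nonneg _).trans (hD x k)
    have h1 := abs_le.1 (hD (x + h) k)
    have h2 := abs_le.1 (hD x (h + k))
    have h3 := abs_le.1 (hD x h)
    have h4 : C * ‖h + k‖ ^ 2 ≤ C * (2 * ‖h‖ ^ 2 + 2 * ‖k‖ ^ 2) := by
      by_cases hk : k = 0
      · subst hk
        have : 0 ≤ C * ‖h‖ ^ 2 := (abs_nonneg _).trans (hD x h)
        simp; linarith
      · have : 0 ≤ C := by
          by_contra hneg
          have : 0 < ‖k‖ ^ 2 := by positivity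
          nlinarith
        apply mul_le_mul_of_nonneg_left _ this
        have := parallelogram_law_with_norm ℝ h k
        nlinarith [mul_self_nonneg ‖h - k‖]
    rw [← add_assoc] at h2
    rw [inner_add_right] at h2
    rw [inner_sub_left, abs_le]
    constructor <;> linarith [h1.1, h1.2, h2.1, h2.2, h3.1, h3.2]
  apply LipschitzWith.of_dist_le_mul
  intro y x
  rw [dist_eq_norm, dist_eq_norm]
  set v := G y - G x with hv
  by_cases h0 : y = x
  · simp [hv, h0]
  have hn : 0 < ‖y - x‖ := norm_pos_iff.2 (sub_ne_zero.2 h0)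
  have hC : 0 ≤ C := by
    have := (abs_nonneg _).trans (hD x (y - x))
    by_contra hneg
    have : 0 < ‖y - x‖ ^ 2 := by positivity
    nlinarith
  rw [Real.coe_toNNReal _ (by positivity)]
  by_cases hv0 : ‖v‖ = 0
  · rw [hv0]; positivity
  have hvp : 0 < ‖v‖ := lt_of_le_of_ne (norm_nonneg _) (Ne.symm hv0)
  have := key x (y - x) ((‖y - x‖ / ‖v‖) • v)
  rw [add_sub_cancel, ← hv, inner_smul_right, real_inner_self_eq_norm_sq, norm_smul,
    Real.norm_of_nonneg (by positivity), div_mul_cancel₀ _ hv0] at this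
  have h2 := (le_abs_self _).trans this
  have h3 : ‖y - x‖ / ‖v‖ * ‖v‖ ^ 2 = ‖y - x‖ * ‖v‖ := by field_simp
  rw [h3] at h2
  nlinarith

lemma HasQuadraticExpansion.slope_eq {D : F → ℝ} {G : F → F} {C : ℝ}
    (hD : HasQuadraticExpansion D G C) {x p : F}
    (hp : ∀ h, D (x + h) ≤ D x + inner ℝ p h) : G x = p := by
  have key : ∀ h, inner ℝ (G x - p) h ≤ C * ‖h‖ ^ 2 := by
    intro h
    have := (abs_le.1 (hD x h)).1
    rw [inner_sub_left]
    linarith [hp h]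
  by_contra hne
  have hn : 0 < ‖G x - p‖ := norm_pos_iff.2 (sub_ne_zero.2 hne)
  set v := G x - p
  have hC : 0 < |C| + 1 := by positivity
  have := key ((1 / (|C| + 1)) • v)
  rw [inner_smul_right, real_inner_self_eq_norm_sq, norm_smul,
    Real.norm_of_nonneg (by positivity)] at this
  have h2 : C * (1 / (|C| + 1) * ‖v‖) ^ 2 = (C / (|C| + 1)) * (1 / (|C| + 1) * ‖v‖ ^ 2) := by
    field_simp
  rw [h2] at this
  have h3 : C / (|C| + 1) < 1 := by
    rw [div_lt_one hC]; linarith [le_abs_self C]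
  have h4 : 0 < 1 / (|C| + 1) * ‖v‖ ^ 2 := by positivity
  nlinarith

lemma HasQuadraticExpansion.hasFDerivAt {D : F → ℝ} {G : F → F} {C : ℝ}
    (hD : HasQuadraticExpansion D G C) (x : F) : HasFDerivAt D (innerSL ℝ (G x)) x := by
  rw [hasFDerivAt_iff_isLittleO_nhds_zero]
  have h1 : (fun h : F => D (x + h) - D x - innerSL ℝ (G x) h) =O[𝓝 0] fun h => ‖h‖ ^ 2 := by
    apply Asymptotics.IsBigO.of_bound C
    filter_upwards with h
    simpa using hD x h
  apply h1.trans_isLittleO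
  have := Asymptotics.isLittleO_norm_pow_id (E' := F) (n := 2) (by norm_num)
  simpa using this

/-- A function with Lipschitz gradient has a second order Taylor expansion at every point of
differentiability of its gradient. -/
lemma HasQuadraticExpansion.taylor_two {D : F → ℝ} {G : F → F} {C : ℝ}
    (hD : HasQuadraticExpansion D G C) {x : F} {H : F →L[ℝ] F} (hH : HasFDerivAt G H x)
    {η : ℝ} (hη : 0 < η) :
    ∀ᶠ h in 𝓝 (0 : F),
      |D (x + h) - D x - inner ℝ (G x) h - inner ℝ (H h) h / 2| ≤ η * ‖h‖ ^ 2 := by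
  rw [hasFDerivAt_iff_isLittleO_nhds_zero] at hH
  have h1 := hH.bound hη
  obtain ⟨r, hr, hball⟩ := Metric.eventually_nhds_iff_ball.1 h1
  filter_upwards [Metric.ball_mem_nhds (0 : F) hr] with h hh
  let φ : ℝ → ℝ := fun s => D (x + s • h) - s * inner ℝ (G x) h - s ^ 2 * (inner ℝ (H h) h / 2)
  have hφ : ∀ s, HasDerivAt φ (inner ℝ (G (x + s • h)) h - inner ℝ (G x) h
      - (2 * s) * (inner ℝ (H h) h / 2)) s := by
    intro s
    have a1 : HasDerivAt (fun s : ℝ => x + s • h) h s := by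
      simpa using ((hasDerivAt_id s).smul_const h).const_add x
    have a2 := (hD.hasFDerivAt (x + s • h)).comp_hasDerivAt s a1
    have a3 : HasDerivAt (fun s : ℝ => s * inner ℝ (G x) h) (inner ℝ (G x) h) s := by
      simpa using (hasDerivAt_id s).mul_const (inner ℝ (G x) h)
    have a4 : HasDerivAt (fun s : ℝ => s ^ 2 * (inner ℝ (H h) h / 2))
        ((2 * s) * (inner ℝ (H h) h / 2)) s := by
      simpa using (hasDerivAt_pow 2 s).mul_const (inner ℝ (H h) h / 2)
    exact (a2.sub a3).sub a4
  have hb : ∀ s ∈ Icc (0:ℝ) 1, ‖inner ℝ (G (x + s • h)) h - inner ℝ (G x) h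
      - (2 * s) * (inner ℝ (H h) h / 2)‖ ≤ η * ‖h‖ ^ 2 := by
    intro s hs
    have e : inner ℝ (G (x + s • h)) h - inner ℝ (G x) h - (2 * s) * (inner ℝ (H h) h / 2)
        = inner ℝ (G (x + s • h) - G x - H (s • h)) h := by
      rw [inner_sub_left, inner_sub_left, map_smul, real_inner_smul_left]; ring
    rw [e]
    refine (norm_inner_le_norm _ _).trans ?_
    have hsm : ‖s • h‖ ≤ ‖h‖ := by
      rw [norm_smul, Real.norm_of_nonneg hs.1]
      exact mul_le_of_le_one_left (norm_nonneg _) hs.2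
    have : s • h ∈ Metric.ball (0 : F) r := by
      rw [mem_ball_zero_iff] at hh ⊢
      exact hsm.trans_lt hh
    have := hball _ this
    calc _ ≤ (η * ‖s • h‖) * ‖h‖ := by gcongr
      _ ≤ (η * ‖h‖) * ‖h‖ := by gcongr
      _ = _ := by ring
  have := (convex_Icc (0:ℝ) 1).norm_image_sub_le_of_norm_hasDerivWithin_le
    (fun s _ => (hφ s).hasDerivWithinAt) hb (left_mem_Icc.2 zero_le_one)
    (right_mem_Icc.2 zero_le_one)
  simp [φ] at this
  convert this using 2
  ring

variable [FiniteDimensional ℝ F]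

lemma exists_concaveEnvelope {k : F → ℝ} {c : ℝ}
    (hk : ∀ y h, k y ≤ (k (y + h) + k (y - h)) / 2 + c * ‖h‖ ^ 2) 
    (hm : ∃ a, IsAffineMajorant k a) :
    ∃ (D : F → ℝ) (G : F → F), HasQuadraticExpansion D G (2 * |c|) ∧ (∀ y, k y ≤ D y) ∧
      ∀ a, IsAffineMajorant k a → ∀ y, D y ≤ inner ℝ a.1 y + a.2 := by
  let S : F → Set ℝ := fun x => {r | ∃ a, IsAffineMajorant k a ∧ r = inner ℝ a.1 x + a.2}
  let D : F → ℝ := fun x => sInf (S x)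
  have hbdd : ∀ x, BddBelow (S x) := by
    intro x
    refine ⟨k x, ?_⟩
    rintro r ⟨a, ha, rfl⟩
    exact ha x
  have hne : ∀ x, (S x).Nonempty := fun x => by
    obtain ⟨a, ha⟩ := hm
    exact ⟨_, a, ha, rfl⟩
  have hDle : ∀ a, IsAffineMajorant k a → ∀ y, D y ≤ inner ℝ a.1 y + a.2 :=
    fun a ha y => csInf_le (hbdd y) ⟨a, ha, rfl⟩
  have hkD : ∀ y, k y ≤ D y := fun y => by
    apply le_csInf (hne y)
    rintro r ⟨a, ha, rfl⟩
    exact ha y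
  have happ : ∀ x, ∀ η > 0, ∃ a, IsAffineMajorant k a ∧ inner ℝ a.1 x + a.2 < D x + η := by
    intro x η hη
    obtain ⟨r, ⟨a, ha, rfl⟩, h⟩ := exists_lt_of_csInf_lt (hne x) (lt_add_of_pos_right (D x) hη)
    exact ⟨a, ha, h⟩
  have hsemi : ∀ x h, 2 * D x ≤ D (x + h) + D (x - h) + 2 * c * ‖h‖ ^ 2 := by
    intro x h
    apply le_of_forall_pos_lt_add
    intro η hη
    obtain ⟨a, ha, ha'⟩ := happ (x + h) (η / 2) (by positivity)
    obtain ⟨b, hb, hb'⟩ := happ (x - h) (η / 2) (by positivity)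
    have hmaj : IsAffineMajorant k ((1 / 2 : ℝ) • (a.1 + b.1),
        (inner ℝ a.1 h + a.2 - inner ℝ b.1 h + b.2) / 2 + c * ‖h‖ ^ 2) := by
      intro y
      have h1 := ha (y + h)
      have h2 := hb (y - h)
      have h3 := hk y h
      simp only [real_inner_smul_left, inner_add_left, inner_add_right, inner_sub_right] at *
      linarith
    have h1 := hDle _ hmaj x
    simp only [real_inner_smul_left, inner_add_left, inner_add_right, inner_sub_right] at *
    linarith
  have hsup : ∀ x, ∃ p : F, ∀ h, D (x + h) ≤ D x + inner ℝ p h := by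
    intro x
    choose a ha ha' using fun n : ℕ => happ x (1 / ((n : ℝ) + 1)) (by positivity)
    -- slopes of nearly optimal majorants are bounded
    have hinc : ∀ n h, D (x + h) ≤ D x + inner ℝ (a n).1 h + 1 / ((n : ℝ) + 1) := by
      intro n h
      have := hDle _ (ha n) (x + h)
      rw [inner_add_right] at this
      linarith [ha' n]
    obtain ⟨a₀, ha₀⟩ := hm
    have hlow : ∃ M : ℝ, ∀ h, ‖h‖ ≤ 1 → -M ≤ D (x + h) := by
      refine ⟨-(2 * D x - (inner ℝ a₀.1 x + a₀.2 + ‖a₀.1‖) - 2 * |c|), fun h hh => ?_⟩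
      have h1 := hsemi x h
      have h2 := hDle _ ha₀ (x - h)
      rw [inner_sub_right] at h2
      have h3 : |inner ℝ a₀.1 h| ≤ ‖a₀.1‖ := (abs_real_inner_le_norm _ _).trans
        (mul_le_of_le_one_right (norm_nonneg _) hh)
      have h4 : 2 * c * ‖h‖ ^ 2 ≤ 2 * |c| := by
        have : ‖h‖ ^ 2 ≤ 1 := pow_le_one₀ (norm_nonneg _) hh
        nlinarith [le_abs_self c, abs_nonneg c, sq_nonneg ‖h‖]
      linarith [neg_abs_le (inner ℝ a₀.1 h)]
    obtain ⟨M, hM⟩ := hlow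
    have hbd : ∀ n, (a n).1 ∈ Metric.closedBall (0 : F) (|D x| + 1 + |M|) := by
      intro n
      rw [mem_closedBall_zero_iff]
      by_cases h0 : ‖(a n).1‖ = 0
      · rw [h0]; positivity
      have := hinc n (-(1 / ‖(a n).1‖) • (a n).1)
      have hl := hM (-(1 / ‖(a n).1‖) • (a n).1) (by
        rw [norm_smul, norm_neg, Real.norm_of_nonneg (by positivity), one_div,
          inv_mul_cancel₀ h0])
      rw [inner_smul_right, real_inner_self_eq_norm_sq] at this
      have e : -(1 / ‖(a n).1‖) * ‖(a n).1‖ ^ 2 = -‖(a n).1‖ := by field_simp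
      rw [e] at this
      have h1 : 1 / ((n : ℝ) + 1) ≤ 1 := by
        rw [div_le_one (by positivity)]; linarith [n.cast_nonneg (α := ℝ)]
      linarith [le_abs_self (D x), le_abs_self M]
    obtain ⟨p, -, φ, hφ, hlim⟩ := (isCompact_closedBall (0 : F) _).tendsto_subseq hbd
    refine ⟨p, fun h => ?_⟩
    have l1 : Tendsto (fun n : ℕ => D x + inner ℝ (a (φ n)).1 h + 1 / (((φ n : ℕ) : ℝ) + 1)) atTop
        (𝓝 (D x + inner ℝ p h + 0)) := by
      refine (Tendsto.const_add _ (hlim.inner tendsto_const_nhds)).add ?_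
      exact tendsto_one_div_add_atTop_nhds_zero_nat.comp hφ.tendsto_atTop
    rw [add_zero] at l1
    exact ge_of_tendsto' l1 (fun n => hinc (φ n) h)
  choose G hG using hsup
  refine ⟨D, G, ?_, hkD, hDle⟩
  intro x h
  have h1 := hG x h
  have h2 := hG x (-h)
  have h3 := hsemi x h
  rw [inner_neg_right, ← sub_eq_add_neg] at h2
  have : 2 * c * ‖h‖ ^ 2 ≤ 2 * |c| * ‖h‖ ^ 2 := by gcongr; exact le_abs_self c
  rw [abs_le]
  constructor
  · linarith
  · have : 0 ≤ 2 * |c| * ‖h‖ ^ 2 := by positivity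
    linarith

end ConcaveEnvelope

section Jensen

variable {F : Type*} [NormedAddCommGroup F]

/-- The sup-convolution of `A` over `K` with the quadratic kernel `N ‖·‖²`. -/
noncomputable def supConv (A : F → ℝ) (K : Set F) (N : ℝ) (x : F) : ℝ :=
  sSup ((fun y => A y - N * ‖x - y‖ ^ 2) '' K)

lemma exists_supConv_eq {A : F → ℝ} {K : Set F} (hK : IsCompact K) (hne : K.Nonempty)
    (hA : UpperSemicontinuousOn A K) (N : ℝ) (x : F) :
    ∃ y ∈ K, supConv A K N x = A y - N * ‖x - y‖ ^ 2 ∧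
      ∀ z ∈ K, A z - N * ‖x - z‖ ^ 2 ≤ supConv A K N x := by
  have hc : UpperSemicontinuousOn (fun y => -(N * ‖x - y‖ ^ 2)) K :=
    (Continuous.continuousOn (by fun_prop)).upperSemicontinuousOn
  obtain ⟨y, hy, hmax⟩ := UpperSemicontinuousOn.exists_isMaxOn hne hK (hA.add hc)
  have hg : IsGreatest ((fun y => A y - N * ‖x - y‖ ^ 2) '' K) (A y - N * ‖x - y‖ ^ 2) := by
    refine ⟨⟨y, hy, rfl⟩, ?_⟩
    rintro _ ⟨z, hz, rfl⟩
    simpa [sub_eq_add_neg] using hmax hz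
  refine ⟨y, hy, hg.csSup_eq, fun z hz => ?_⟩
  rw [supConv, hg.csSup_eq]
  exact hg.2 ⟨z, hz, rfl⟩

lemma le_supConv {A : F → ℝ} {K : Set F} (hK : IsCompact K)
    (hA : UpperSemicontinuousOn A K) (N : ℝ) (x : F) {z : F} (hz : z ∈ K) :
    A z - N * ‖x - z‖ ^ 2 ≤ supConv A K N x :=
  let ⟨_, _, _, h⟩ := exists_supConv_eq hK ⟨z, hz⟩ hA N x
  h z hz

lemma supConv_le {A : F → ℝ} {K : Set F} (hK : IsCompact K) (hne : K.Nonempty)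
    (hA : UpperSemicontinuousOn A K) {N : ℝ} (hN : 0 ≤ N) : ∃ M, ∀ x, supConv A K N x ≤ M := by
  obtain ⟨M, hM⟩ := hA.bddAbove_of_isCompact hK
  refine ⟨M, fun x => ?_⟩
  obtain ⟨y, hy, hyx, -⟩ := exists_supConv_eq hK hne hA N x
  have := hM ⟨y, hy, rfl⟩
  have : 0 ≤ N * ‖x - y‖ ^ 2 := by positivity
  linarith

variable [InnerProductSpace ℝ F]

lemma supConv_semiconvex {A : F → ℝ} {K : Set F} (hK : IsCompact K) (hne : K.Nonempty)
    (hA : UpperSemicontinuousOn A K) (N : ℝ) (x h : F) :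
    supConv A K N x ≤ (supConv A K N (x + h) + supConv A K N (x - h)) / 2 + N * ‖h‖ ^ 2 := by
  obtain ⟨y, hy, hyx, -⟩ := exists_supConv_eq hK hne hA N x
  have h1 := le_supConv hK hA N (x + h) hy
  have h2 := le_supConv hK hA N (x - h) hy
  have h3 := parallelogram_law_with_norm ℝ (x - y) h
  have e1 : x + h - y = x - y + h := by abel
  have e2 : x - h - y = x - y - h := by abel
  rw [e1] at h1
  rw [e2] at h2
  have : N * ‖x - y + h‖ ^ 2 + N * ‖x - y - h‖ ^ 2 = 2 * (N * ‖x - y‖ ^ 2) + 2 * (N * ‖h‖ ^ 2) := by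
    linear_combination N * h3
  linarith

/-- The doubled functional maximized in the comparison argument, perturbed by the linear form
`p`. -/
noncomputable def doubled (A B : F → ℝ) (N : ℝ) (p x y z : F) : ℝ :=
  A y + B z - N * ‖x - y‖ ^ 2 - N * ‖x - z‖ ^ 2 - inner ℝ p x

/-- `(x, y, z)` maximizes the doubled functional over `F × K × K`. -/
def IsDoubledMax (A B : F → ℝ) (K : Set F) (N : ℝ) (p x y z : F) : Prop :=
  y ∈ K ∧ z ∈ K ∧ ∀ x' y' z', y' ∈ K → z' ∈ K →
    doubled A B N p x' y' z' ≤ doubled A B N p x y z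

lemma exists_isDoubledMax {A B : F → ℝ} {K : Set F} (hK : IsCompact K) (hne : K.Nonempty)
    (hA : UpperSemicontinuousOn A K) (hB : UpperSemicontinuousOn B K) {N : ℝ} (hN : 0 < N)
    (p : F) : ∃ x y z, IsDoubledMax A B K N p x y z := by
  let c : F × F → ℝ := fun w =>
    -(N / 2 * ‖w.1 - w.2‖ ^ 2) - inner ℝ p ((1 / 2 : ℝ) • (w.1 + w.2)) + ‖p‖ ^ 2 / (8 * N)
  have hc : UpperSemicontinuousOn c (K ×ˢ K) :=
    (Continuous.continuousOn (by fun_prop)).upperSemicontinuousOn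
  have hA' : UpperSemicontinuousOn (fun w : F × F => A w.1) (K ×ˢ K) :=
    hA.comp continuous_fst.continuousOn (fun w hw => hw.1)
  have hB' : UpperSemicontinuousOn (fun w : F × F => B w.2) (K ×ˢ K) :=
    hB.comp continuous_snd.continuousOn (fun w hw => hw.2)
  obtain ⟨⟨y, z⟩, ⟨hy, hz⟩, hmax⟩ := UpperSemicontinuousOn.exists_isMaxOn (hne.prod hne)
    (hK.prod hK) ((hA'.add hB').add hc)
  have key : ∀ x y z, doubled A B N p x y z = A y + B z + c (y, z)
      - 2 * N * ‖x - ((1 / 2 : ℝ) • (y + z) - (1 / (4 * N)) • p)‖ ^ 2 := by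
    intro x y z
    simp only [doubled, c, ← real_inner_self_eq_norm_sq, inner_sub_left, inner_sub_right,
      inner_add_left, inner_add_right, real_inner_smul_left, real_inner_smul_right]
    rw [real_inner_comm y x, real_inner_comm z x, real_inner_comm z y, real_inner_comm p x,
      real_inner_comm p y, real_inner_comm p z]
    field_simp
    ring
  refine ⟨(1 / 2 : ℝ) • (y + z) - (1 / (4 * N)) • p, y, z, hy, hz, fun x' y' z' hy' hz' => ?_⟩
  rw [key, key, sub_self]
  have h1 := hmax (mk_mem_prod hy' hz')
  simp only [mem_ofPred_eq] at h1
  have : 0 ≤ 2 * N * ‖x' - ((1 / 2 : ℝ) • (y' + z') - (1 / (4 * N)) • p)‖ ^ 2 := by positivity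
  rw [norm_zero]
  linarith

lemma LipschitzWith.hausdorff_image_null [FiniteDimensional ℝ F] [MeasurableSpace F]
    [BorelSpace F] {G : F → F} {C : NNReal} (hG : LipschitzWith C G) {s : Set F}
    (hs : μH[Module.finrank ℝ F] s = 0) : μH[Module.finrank ℝ F] (G '' s) = 0 := by
  have := hG.hausdorffMeasure_image_le (d := Module.finrank ℝ F) (by positivity) s
  rw [hs, mul_zero] at this
  exact le_antisymm this zero_le

/-- A form of the Jensen–Ishii lemma: after an arbitrarily small linear perturbation, the doubled
functional has a maximum point at which both functions are touched by a common quadratic. -/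
theorem exists_doubledMax_jets [FiniteDimensional ℝ F]
    {A B : F → ℝ} {K : Set F} (hK : IsCompact K) (hne : K.Nonempty)
    (hA : UpperSemicontinuousOn A K) (hB : UpperSemicontinuousOn B K) {N δ : ℝ} (hN : 0 < N)
    (hδ : 0 < δ) :
    ∃ (p x y z b : F) (H : F →L[ℝ] F), ‖p‖ < δ ∧ IsDoubledMax A B K N p x y z ∧
      ∀ η > 0, ∀ᶠ h in 𝓝 (0 : F),
        (y + h ∈ K → A (y + h) ≤ A y + inner ℝ b h + inner ℝ (H h) h / 2 + η * ‖h‖ ^ 2) ∧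
        (z + h ∈ K → B (z + h) ≤ B z - inner ℝ (b - p) h - inner ℝ (H h) h / 2
          + η * ‖h‖ ^ 2) := by
  let _ : MeasurableSpace F := borel F
  have _ : BorelSpace F := ⟨rfl⟩
  set U := supConv A K N
  set V := supConv B K N
  obtain ⟨MU, hMU⟩ := supConv_le hK hne hA hN.le
  obtain ⟨MV, hMV⟩ := supConv_le hK hne hB hN.le
  -- concave envelope of `U - N ‖·‖²`
  obtain ⟨D, G, hD, hkD, hDmaj⟩ := exists_concaveEnvelope (k := fun x => U x - N * ‖x‖ ^ 2)
    (c := 2 * N) (by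
      intro y h
      have h1 := supConv_semiconvex hK hne hA N y h
      have h2 := parallelogram_law_with_norm ℝ y h
      have : N * ‖y + h‖ ^ 2 + N * ‖y - h‖ ^ 2 = 2 * (N * ‖y‖ ^ 2) + 2 * (N * ‖h‖ ^ 2) := by
        linear_combination N * h2
      simp only [U]
      linarith) ⟨(0, MU), fun y => by
        have := hMU y
        have h0 : 0 ≤ N * ‖y‖ ^ 2 := by positivity
        simp only [inner_zero_left, U]
        linarith⟩
  -- concave envelope of `U + V`
  obtain ⟨D', G', hD', hkD', hDmaj'⟩ := exists_concaveEnvelope (k := fun x => U x + V x)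
    (c := 2 * N) (by
      intro y h
      have h1 := supConv_semiconvex hK hne hA N y h
      have h2 := supConv_semiconvex hK hne hB N y h
      simp only [U, V]
      linarith) ⟨(0, MU + MV), fun y => by
        have := hMU y
        have := hMV y
        simp only [inner_zero_left, U, V]
        linarith⟩
  -- consequences of being a maximum
  have hmaxU : ∀ {p x y z}, IsDoubledMax A B K N p x y z → U x = A y - N * ‖x - y‖ ^ 2 := by
    intro p x y z h
    obtain ⟨y', hy', h1, h2⟩ := exists_supConv_eq hK hne hA N x
    have := h.2.2 x y' z hy' h.2.1
    have := h2 y h.1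
    simp only [doubled] at *
    linarith
  have hmaxV : ∀ {p x y z}, IsDoubledMax A B K N p x y z → V x = B z - N * ‖x - z‖ ^ 2 := by
    intro p x y z h
    obtain ⟨y', hy', h1, h2⟩ := exists_supConv_eq hK hne hB N x
    have := h.2.2 x y y' h.1 hy'
    have := h2 z h.2.1
    simp only [doubled] at *
    linarith
  have hmaxW : ∀ {p x y z}, IsDoubledMax A B K N p x y z → ∀ x',
      U x' + V x' ≤ U x + V x + inner ℝ p (x' - x) := by
    intro p x y z h x'
    obtain ⟨y', hy', h1, -⟩ := exists_supConv_eq hK hne hA N x'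
    obtain ⟨z', hz', h2, -⟩ := exists_supConv_eq hK hne hB N x'
    have h3 := h.2.2 x' y' z' hy' hz'
    rw [hmaxU h, hmaxV h, inner_sub_right]
    simp only [doubled] at h3
    linarith
  -- the contact set is not negligible
  let S : Set F := {x | ∃ p y z, ‖p‖ < δ ∧ IsDoubledMax A B K N p x y z}
  have hS : Metric.ball (0 : F) δ ⊆ G' '' S := by
    intro p hp
    rw [mem_ball_zero_iff] at hp
    obtain ⟨x, y, z, hmax⟩ := exists_isDoubledMax hK hne hA hB hN p
    refine ⟨x, ⟨p, y, z, hp, hmax⟩, hD'.slope_eq fun h => ?_⟩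
    have hm : IsAffineMajorant (fun x => U x + V x) (p, U x + V x - inner ℝ p x) := by
      intro x'
      have := hmaxW hmax x'
      rw [inner_sub_right] at this
      simp only
      linarith
    have h1 := hDmaj' _ hm (x + h)
    have h2 := hkD' x
    simp only [inner_add_right] at h1 h2
    linarith
  have hex : ∃ x ∈ S, DifferentiableAt ℝ G x := by
    by_contra hcon
    push Not at hcon
    have h1 : μH[Module.finrank ℝ F] S = 0 := by
      have hae := hD.lipschitz.ae_differentiableAt (μ := (μH[Module.finrank ℝ F] : Measure F))
      exact measure_mono_null hcon hae
    have h2 := measure_mono_null hS (hD'.lipschitz.hausdorff_image_null h1)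
    exact (Metric.measure_ball_pos (μH[Module.finrank ℝ F] : Measure F) (0 : F) hδ).ne' h2
  obtain ⟨x, ⟨p, y, z, hp, hmax⟩, H, hH⟩ := hex
  have hUx := hmaxU hmax
  have hVx := hmaxV hmax
  have hW := hmaxW hmax
  have hzmaj : ∀ z' ∈ K, ∀ x', N * ‖x'‖ ^ 2 + D x' ≤
      N * ‖x' - z'‖ ^ 2 - B z' + (U x + V x) + inner ℝ p (x' - x) := by
    intro z' hz' x'
    have hm : IsAffineMajorant (fun x => U x - N * ‖x‖ ^ 2)
        (p - (2 * N) • z', N * ‖z'‖ ^ 2 - B z' + (U x + V x) - inner ℝ p x) := by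
      intro w
      have h1 := hW w
      have h2 := le_supConv hK hB N w hz'
      rw [norm_sub_sq_real] at h2
      simp only [inner_sub_right, inner_sub_left, real_inner_smul_left] at *
      rw [real_inner_comm w z']
      simp only [V] at *
      linarith
    have := hDmaj _ hm x'
    rw [norm_sub_sq_real]
    simp only [inner_sub_right, inner_sub_left, real_inner_smul_left] at *
    rw [real_inner_comm x' z'] at this
    linarith
  have hΘx : N * ‖x‖ ^ 2 + D x = U x := by
    have h1 := hzmaj z hmax.2.1 x
    have h2 := hkD x
    simp only [sub_self, inner_zero_right] at h1 h2
    linarith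
  refine ⟨p, x, y, z, G x + (2 * N) • x, H + (2 * N) • ContinuousLinearMap.id ℝ F, hp, hmax,
    fun η hη => ?_⟩
  filter_upwards [hD.taylor_two hH hη] with h hh
  rw [abs_le] at hh
  have hexp : N * ‖x + h‖ ^ 2 + D (x + h) - U x - (inner ℝ (G x + (2 * N) • x) h
      + inner ℝ ((H + (2 * N) • ContinuousLinearMap.id ℝ F) h) h / 2)
      = D (x + h) - D x - inner ℝ (G x) h - inner ℝ (H h) h / 2 := by
    rw [← hΘx, norm_add_sq_real]
    simp only [add_apply, smul_apply,
      ContinuousLinearMap.id_apply, inner_add_left, real_inner_smul_left,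
      real_inner_self_eq_norm_sq]
    ring
  constructor
  · intro hy
    have h1 := le_supConv hK hA N (x + h) hy
    have h2 := hkD (x + h)
    rw [add_sub_add_right_eq_sub] at h1
    simp only [U] at *
    linarith
  · intro hz
    have h1 := hzmaj _ hz (x + h)
    rw [add_sub_add_right_eq_sub, add_sub_cancel_left] at h1
    rw [inner_sub_left]
    linarith

end Jensen

section DoublingLimit

variable {F : Type*} [NormedAddCommGroup F] [InnerProductSpace ℝ F]

lemma IsDoubledMax.norm_sq_le {A B : F → ℝ} {K : Set F} {N : ℝ} {p x y z : F}
    (hmax : IsDoubledMax A B K N p x y z) (hp : ‖p‖ ≤ 1) {a b D : ℝ}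
    (ha : ∀ y ∈ K, A y ≤ a) (hb : ∀ y ∈ K, B y ≤ b) {q : F} (hq : q ∈ K)
    (hD : ∀ y ∈ K, ‖y - q‖ ≤ D) :
    (N - 1) * (‖x - y‖ ^ 2 + ‖x - z‖ ^ 2) ≤ a + b - (A q + B q) + D + 1 ∧
      (1 ≤ N → A q + B q - ‖p‖ * (1 + D) ≤ A y + B z) := by
  obtain ⟨hy, hz, hle⟩ := hmax
  have h1 := hle q q q hq hq
  simp only [doubled, sub_self, norm_zero] at h1
  have h2 : inner ℝ p q - inner ℝ p x ≤ ‖p‖ * ‖x - q‖ := by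
    rw [← inner_sub_right, norm_sub_rev]
    exact real_inner_le_norm p (q - x)
  have h3 : ‖x - q‖ ≤ ‖x - y‖ ^ 2 + 1 + D := by
    have h4 : ‖x - q‖ ≤ ‖x - y‖ + ‖y - q‖ := norm_sub_le_norm_sub_add_norm_sub x y q
    nlinarith [hD y hy, sq_nonneg (‖x - y‖ - 1)]
  have hp0 := norm_nonneg p
  have h5 := mul_le_mul_of_nonneg_left h3 hp0
  have h6 := ha y hy
  have h7 := hb z hz
  have h8 : 0 ≤ D := (norm_nonneg _).trans (hD y hy)
  have h9 := sq_nonneg ‖x - z‖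
  have h10 := sq_nonneg ‖x - y‖
  constructor
  · nlinarith
  · intro hN
    nlinarith

/-- The maximum points of the doubled functional concentrate at a maximum point of `A + B`. -/
theorem exists_limit_doubledMax [FiniteDimensional ℝ F] {A B : F → ℝ} {K : Set F}
    (hK : IsCompact K) (hA : UpperSemicontinuousOn A K) (hB : UpperSemicontinuousOn B K)
    {q : F} (hq : q ∈ K) :
    ∃ s ∈ K, A q + B q ≤ A s + B s ∧ ∀ ε > 0, ∃ (p y z b : F) (H : F →L[ℝ] F),
      ‖p‖ < ε ∧ y ∈ K ∧ z ∈ K ∧ ‖y - s‖ < ε ∧ ‖z - s‖ < ε ∧ A q + B q - ε < A y + B z ∧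
      A y < A s + ε ∧ B z < B s + ε ∧
      ∀ η > 0, ∀ᶠ h in 𝓝 (0 : F),
        (y + h ∈ K → A (y + h) ≤ A y + inner ℝ b h + inner ℝ (H h) h / 2 + η * ‖h‖ ^ 2) ∧
        (z + h ∈ K → B (z + h) ≤ B z - inner ℝ (b - p) h - inner ℝ (H h) h / 2
          + η * ‖h‖ ^ 2) := by
  have hex : ∀ n : ℕ, ∃ (p x y z b : F) (H : F →L[ℝ] F), _ := fun n =>
    exists_doubledMax_jets hK ⟨q, hq⟩ hA hB (N := n + 2) (δ := 1 / ((n : ℝ) + 1))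
      (by positivity) (by positivity)
  choose p x y z b H hp hmax hjet using hex
  obtain ⟨a, ha⟩ := UpperSemicontinuousOn.bddAbove_of_isCompact hK hA
  obtain ⟨c, hc⟩ := UpperSemicontinuousOn.bddAbove_of_isCompact hK hB
  have ha' : ∀ y ∈ K, A y ≤ a := fun y hy => ha (mem_image_of_mem _ hy)
  have hc' : ∀ y ∈ K, B y ≤ c := fun y hy => hc (mem_image_of_mem _ hy)
  obtain ⟨D, hD⟩ := hK.exists_bound_of_continuousOn (f := fun y => y - q) (by fun_prop)
  have hD0 : 0 ≤ D := (norm_nonneg _).trans (hD q hq)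
  have hn1 : ∀ n : ℕ, (1 : ℝ) / ((n : ℝ) + 1) ≤ 1 := fun n => by
    rw [div_le_one (by positivity)]
    linarith [(Nat.cast_nonneg n : (0 : ℝ) ≤ n)]
  have hest := fun n => (hmax n).norm_sq_le ((hp n).le.trans (hn1 n)) ha' hc' hq hD
  set C := a + c - (A q + B q) + D + 1 with hC
  have hlim0 : Tendsto (fun n : ℕ => (1 : ℝ) / ((n : ℝ) + 1)) atTop (𝓝 0) :=
    tendsto_one_div_add_atTop_nhds_zero_nat
  have hyz : Tendsto (fun n => y n - z n) atTop (𝓝 0) := by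
    rw [tendsto_zero_iff_norm_tendsto_zero]
    have h1 : Tendsto (fun n : ℕ => √(2 * C * (1 / ((n : ℝ) + 1)))) atTop (𝓝 0) := by
      have := (hlim0.const_mul (2 * C)).sqrt
      simpa using this
    refine squeeze_zero (fun n => norm_nonneg _) (fun n => ?_) h1
    refine Real.le_sqrt_of_sq_le ?_
    have h2 : ‖y n - z n‖ ≤ ‖x n - y n‖ + ‖x n - z n‖ := by
      rw [norm_sub_rev (x n) (y n)]
      exact norm_sub_le_norm_sub_add_norm_sub _ _ _
    have h3 := (hest n).1
    have h4 : ‖y n - z n‖ ^ 2 ≤ 2 * (‖x n - y n‖ ^ 2 + ‖x n - z n‖ ^ 2) := by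
      nlinarith [sq_nonneg (‖x n - y n‖ - ‖x n - z n‖), norm_nonneg (y n - z n)]
    refine h4.trans ?_
    rw [mul_one_div, le_div_iff₀ (by positivity)]
    linarith
  obtain ⟨s, hs, φ, hφ, hys⟩ := hK.tendsto_subseq fun n => (hmax n).1
  have hzs : Tendsto (z ∘ φ) atTop (𝓝 s) := by
    have := hys.sub (hyz.comp hφ.tendsto_atTop)
    simpa [Function.comp_def] using this
  have hlimφ : Tendsto (fun n => (1 : ℝ) / ((φ n : ℝ) + 1)) atTop (𝓝 0) :=
    hlim0.comp hφ.tendsto_atTop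
  have hyK : Tendsto (y ∘ φ) atTop (𝓝[K] s) :=
    tendsto_nhdsWithin_iff.2 ⟨hys, Eventually.of_forall fun n => (hmax _).1⟩
  have hzK : Tendsto (z ∘ φ) atTop (𝓝[K] s) :=
    tendsto_nhdsWithin_iff.2 ⟨hzs, Eventually.of_forall fun n => (hmax _).2.1⟩
  have hev : ∀ ε > 0, ∀ᶠ n in atTop, (1 : ℝ) / ((φ n : ℝ) + 1) < ε ∧
      ‖y (φ n) - s‖ < ε ∧ ‖z (φ n) - s‖ < ε ∧ A q + B q - ε < A (y (φ n)) + B (z (φ n)) ∧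
      A (y (φ n)) < A s + ε ∧ B (z (φ n)) < B s + ε := by
    intro ε hε
    have e1 := hlimφ.eventually (gt_mem_nhds (show 0 < ε / (1 + D) by positivity))
    have e2 := hlimφ.eventually (gt_mem_nhds hε)
    have e3 := hys.eventually (Metric.ball_mem_nhds s hε)
    have e4 := hzs.eventually (Metric.ball_mem_nhds s hε)
    have e5 := hyK.eventually (hA s hs (A s + ε) (by linarith))
    have e6 := hzK.eventually (hB s hs (B s + ε) (by linarith))
    filter_upwards [e1, e2, e3, e4, e5, e6] with n k1 k2 k3 k4 k5 k6
    refine ⟨k2, by simpa [dist_eq_norm] using k3, by simpa [dist_eq_norm] using k4, ?_, k5, k6⟩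
    have h1 := (hest (φ n)).2 (by linarith [(Nat.cast_nonneg (φ n) : (0 : ℝ) ≤ φ n)])
    have h2 : ‖p (φ n)‖ * (1 + D) < ε :=
      (lt_div_iff₀ (by positivity)).1 ((hp (φ n)).trans k1)
    linarith
  refine ⟨s, hs, ?_, fun ε hε => ?_⟩
  · refine le_of_forall_pos_le_add fun ε hε => ?_
    obtain ⟨n, -, -, -, k1, k2, k3⟩ := (hev (ε / 3) (by positivity)).exists
    linarith
  · obtain ⟨n, k1, k2, k3, k4, k5, k6⟩ := (hev ε hε).exists
    exact ⟨p (φ n), y (φ n), z (φ n), b (φ n), H (φ n), (hp _).trans k1, (hmax _).1, (hmax _).2.1,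
      k2, k3, k4, k5, k6, hjet (φ n)⟩

end DoublingLimit

end Analysis

section Parabolic

open Set Filter Topology
open scoped ContDiff

/-- The point of spacetime, consisting of a time and a position. -/
abbrev Spacetime (d : ℕ) := ℝ × EuclideanSpace ℝ (Fin d)

/-- The type of the nonlinearities `g(t,x,y,z,γ)`. -/
abbrev Nonlinearity (d : ℕ) := ℝ → EuclideanSpace ℝ (Fin d) → ℝ → EuclideanSpace ℝ (Fin d) →
  Matrix (Fin d) (Fin d) ℝ → ℝ

section DirectionalDerivative

variable {V : Type*} [NormedAddCommGroup V] [NormedSpace ℝ V]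

/-- The derivative of `w` in the direction `v`. -/
noncomputable def dirDeriv (v : V) (w : V → ℝ) (p : V) : ℝ := fderiv ℝ w p v

lemma ContDiff.dirDeriv {w : V → ℝ} (hw : ContDiff ℝ ∞ w) (v : V) :
    ContDiff ℝ ∞ (dirDeriv v w) :=
  (hw.fderiv_right (m := ∞) (by simp)).clm_apply contDiff_const

lemma ContDiff.differentiable_infty {w : V → ℝ} (hw : ContDiff ℝ ∞ w) : Differentiable ℝ w :=
  hw.differentiable (by simp)

lemma dirDeriv_add {f w : V → ℝ} (hf : ContDiff ℝ ∞ f) (hw : ContDiff ℝ ∞ w) (v : V) :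
    dirDeriv v (fun p => f p + w p) = fun p => dirDeriv v f p + dirDeriv v w p := by
  ext p
  simp only [dirDeriv]
  rw [fderiv_fun_add (hf.differentiable_infty p) (hw.differentiable_infty p), add_apply]

lemma dirDeriv_const_mul {w : V → ℝ} (hw : ContDiff ℝ ∞ w) (c : ℝ) (v : V) :
    dirDeriv v (fun p => c * w p) = fun p => c * dirDeriv v w p := by
  ext p
  simp only [dirDeriv]
  rw [fderiv_const_mul (hw.differentiable_infty p), smul_apply, smul_eq_mul]

lemma dirDeriv_sub {f w : V → ℝ} (hf : ContDiff ℝ ∞ f) (hw : ContDiff ℝ ∞ w) (v : V) :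
    dirDeriv v (fun p => f p - w p) = fun p => dirDeriv v f p - dirDeriv v w p := by
  ext p
  simp only [dirDeriv]
  rw [fderiv_fun_sub (hf.differentiable_infty p) (hw.differentiable_infty p), sub_apply]

lemma dirDeriv_sum {ι : Type*} {s : Finset ι} {f : ι → V → ℝ} (hf : ∀ i, ContDiff ℝ ∞ (f i))
    (v : V) : dirDeriv v (fun p => ∑ i ∈ s, f i p) = fun p => ∑ i ∈ s, dirDeriv v (f i) p := by
  ext p
  simp only [dirDeriv]
  rw [fderiv_fun_sum fun i _ => (hf i).differentiable_infty p]
  simp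

lemma dirDeriv_mul {f w : V → ℝ} (hf : ContDiff ℝ ∞ f) (hw : ContDiff ℝ ∞ w) (v : V) :
    dirDeriv v (fun p => f p * w p) = fun p => f p * dirDeriv v w p + dirDeriv v f p * w p := by
  ext p
  simp only [dirDeriv]
  rw [fderiv_fun_mul (hf.differentiable_infty p) (hw.differentiable_infty p)]
  simp [mul_comm]

lemma dirDeriv_const (c : ℝ) (v : V) : dirDeriv v (fun _ => c) = fun _ => (0 : ℝ) := by
  ext p
  simp [dirDeriv]

lemma dirDeriv_clm (A : V →L[ℝ] ℝ) (v : V) : dirDeriv v (fun p => A p) = fun _ => A v := by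
  ext p
  simp [dirDeriv]

lemma dirDeriv_comp {G G' : ℝ → ℝ} (hG : ∀ s, HasDerivAt G (G' s) s) {w : V → ℝ}
    (hw : ContDiff ℝ ∞ w) (v : V) :
    dirDeriv v (fun p => G (w p)) = fun p => G' (w p) * dirDeriv v w p := by
  ext p
  have := (hG (w p)).comp_hasFDerivAt p (hw.differentiable_infty p).hasFDerivAt
  simp only [dirDeriv]
  rw [show (fun p => G (w p)) = G ∘ w from rfl, this.fderiv]
  simp

lemma two_le_infty : (2 : WithTop ℕ∞) ≤ ∞ :=
  WithTop.coe_le_coe.2 (le_top : (2 : ℕ∞) ≤ ⊤)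

lemma dirDeriv_comm {w : V → ℝ} (hw : ContDiff ℝ ∞ w) (u v : V) :
    dirDeriv u (dirDeriv v w) = dirDeriv v (dirDeriv u w) := by
  have h2 : ∀ u v p, dirDeriv u (dirDeriv v w) p = fderiv ℝ (fderiv ℝ w) p u v := by
    intro u v p
    have hd : DifferentiableAt ℝ (fderiv ℝ w) p :=
      (hw.fderiv_right (m := ∞) (by simp)).differentiable (by simp) p
    change fderiv ℝ (fun q => fderiv ℝ w q v) p u = _
    rw [fderiv_clm_apply hd (differentiableAt_const v)]
    simp
  ext p
  rw [h2, h2]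
  exact (hw.contDiffAt.isSymmSndFDerivAt (n := ∞) (by simpa using two_le_infty)) u v

end DirectionalDerivative

variable {d : ℕ}

/-- The unit vector in the time direction. -/
def timeDir (d : ℕ) : Spacetime d := (1, 0)

/-- The unit vector in the `i`-th space direction. -/
noncomputable def spaceDir (i : Fin d) : Spacetime d := (0, EuclideanSpace.single i 1)

/-- The spatial gradient. -/
noncomputable def spGrad (w : Spacetime d → ℝ) (p : Spacetime d) : EuclideanSpace ℝ (Fin d) :=
  WithLp.toLp 2 fun i => dirDeriv (spaceDir i) w p

/-- The spatial Hessian. -/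
noncomputable def spHess (w : Spacetime d → ℝ) (p : Spacetime d) : Matrix (Fin d) (Fin d) ℝ :=
  Matrix.of fun i j => dirDeriv (spaceDir i) (dirDeriv (spaceDir j) w) p

/-- The parabolic operator `∂_t w + g(t,x,w,Dw,D²w)`. -/
noncomputable def parabOp (g : Nonlinearity d) (w : Spacetime d → ℝ) (p : Spacetime d) : ℝ :=
  dirDeriv (timeDir d) w p + g p.1 p.2 (w p) (spGrad w p) (spHess w p)

lemma spHess_isSymm {w : Spacetime d → ℝ} (hw : ContDiff ℝ ∞ w) (p : Spacetime d) :
    (spHess w p).IsSymm := by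
  ext i j
  simp only [spHess, Matrix.transpose_apply, Matrix.of_apply]
  rw [dirDeriv_comm hw]

lemma continuous_spGrad {w : Spacetime d → ℝ} (hw : ContDiff ℝ ∞ w) : Continuous (spGrad w) := by
  unfold spGrad
  have : ∀ i, Continuous (dirDeriv (spaceDir i) w) := fun i => (hw.dirDeriv _).continuous
  fun_prop

lemma continuous_spHess {w : Spacetime d → ℝ} (hw : ContDiff ℝ ∞ w) : Continuous (spHess w) := by
  refine continuous_matrix fun i j => ?_
  exact ((hw.dirDeriv _).dirDeriv _).continuous

lemma sum_smul_spaceDir (v : EuclideanSpace ℝ (Fin d)) :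
    ∑ i, v i • spaceDir i = ((0, v) : Spacetime d) := by
  refine Prod.ext ?_ ?_
  · simp [spaceDir, Prod.fst_sum]
  · ext j
    simp [spaceDir, Prod.snd_sum, Finset.sum_apply, Pi.single_apply]

lemma fderiv_space (w : Spacetime d → ℝ) (p : Spacetime d) (v : EuclideanSpace ℝ (Fin d)) :
    fderiv ℝ w p (0, v) = ∑ i, v i * dirDeriv (spaceDir i) w p := by
  rw [← sum_smul_spaceDir, map_sum]
  simp [dirDeriv]

lemma hasDerivAt_time {w : Spacetime d → ℝ} (hw : ContDiff ℝ ∞ w) (p : Spacetime d) :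
    HasDerivAt (fun s => w (s, p.2)) (dirDeriv (timeDir d) w p) p.1 := by
  have h1 : HasFDerivAt w (fderiv ℝ w p) (p.1, p.2) := (hw.differentiable_infty p).hasFDerivAt
  have h2 : HasDerivAt (fun s : ℝ => (s, p.2)) (timeDir d) p.1 :=
    (hasDerivAt_id p.1).prodMk (hasDerivAt_const p.1 p.2)
  exact h1.comp_hasDerivAt p.1 h2

lemma hasFDerivAt_space {w : Spacetime d → ℝ} (hw : ContDiff ℝ ∞ w) (p : Spacetime d) :
    HasFDerivAt (fun x => w (p.1, x))
      ((fderiv ℝ w p).comp (ContinuousLinearMap.inr ℝ ℝ (EuclideanSpace ℝ (Fin d)))) p.2 := by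
  have h1 : HasFDerivAt w (fderiv ℝ w p) (p.1, p.2) := (hw.differentiable_infty p).hasFDerivAt
  exact h1.comp p.2 (hasFDerivAt_prodMk_right p.1 p.2)

lemma hasGradientAt_space {w : Spacetime d → ℝ} (hw : ContDiff ℝ ∞ w) (p : Spacetime d) :
    HasGradientAt (fun x => w (p.1, x)) (spGrad w p) p.2 := by
  rw [hasGradientAt_iff_hasFDerivAt]
  refine (hasFDerivAt_space hw p).congr_fderiv ?_
  ext v
  simp only [InnerProductSpace.toDual_apply_apply, ContinuousLinearMap.comp_apply,
    ContinuousLinearMap.inr_apply, fderiv_space, PiLp.inner_apply, spGrad]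
  simp

lemma hasFDerivAt_spGrad {w : Spacetime d → ℝ} (hw : ContDiff ℝ ∞ w) (p : Spacetime d) :
    HasFDerivAt (fun x => spGrad w (p.1, x)) (matCLM d (spHess w p)) p.2 := by
  rw [← hasFDerivWithinAt_univ, hasFDerivWithinAt_euclidean]
  intro i
  rw [hasFDerivWithinAt_univ]
  refine (hasFDerivAt_space (hw.dirDeriv (spaceDir i)) p).congr_fderiv ?_
  ext v
  simp only [ContinuousLinearMap.comp_apply, ContinuousLinearMap.inr_apply, fderiv_space]
  simp only [matCLM, PiLp.proj_apply, Matrix.ofLp_toEuclideanCLM, Matrix.mulVec, dotProduct,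
    spHess, Matrix.of_apply]
  refine Finset.sum_congr rfl fun j _ => ?_
  rw [dirDeriv_comm hw, mul_comm]

/-- The structural assumptions on the terminal-boundary value problem. -/
structure ParabolicData (d : ℕ) (T : ℝ) (g : Nonlinearity d) (h : Spacetime d → ℝ)
    (L c : ℝ) : Prop where
  T_pos : 0 < T
  bdd : ∃ M, ∀ p ∈ cylBdry d T, |h p| ≤ M
  cont_h : ContinuousOn h (cylBdry d T)
  cont_g : ContinuousOn
      (fun q : ℝ × EuclideanSpace ℝ (Fin d) × ℝ × EuclideanSpace ℝ (Fin d) ×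
        Matrix (Fin d) (Fin d) ℝ => g q.1 q.2.1 q.2.2.1 q.2.2.2.1 q.2.2.2.2)
      (Icc 0 T ×ˢ Metric.closedBall 0 1 ×ˢ univ ×ˢ univ ×ˢ
        {γ : Matrix (Fin d) (Fin d) ℝ | γ.IsSymm})
  unif : ∀ η > 0, ∃ δ > 0, ∀ p ∈ cylQbar d T, ∀ q ∈ cylQbar d T,
    |p.1 - q.1| + ‖p.2 - q.2‖ ≤ δ →
      ∀ (y : ℝ) (z : EuclideanSpace ℝ (Fin d)) (γ : Matrix (Fin d) (Fin d) ℝ), γ.IsSymm →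
        |g p.1 p.2 y z γ - g q.1 q.2 y z γ| ≤ η
  L_nonneg : 0 ≤ L
  lip : ∀ p ∈ cylQbar d T,
    ∀ (y y' : ℝ) (z z' : EuclideanSpace ℝ (Fin d)) (γ γ' : Matrix (Fin d) (Fin d) ℝ),
      γ.IsSymm → γ'.IsSymm →
      |g p.1 p.2 y z γ - g p.1 p.2 y' z' γ'| ≤
        L * (|y - y'| + ∑ i, |z i - z' i| + ∑ i, ∑ j, |γ i j - γ' i j|)
  c_pos : 0 < c
  ell : ∀ p ∈ cylQbar d T, ∀ (y : ℝ) (z : EuclideanSpace ℝ (Fin d))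
      (γ₁ γ₂ : Matrix (Fin d) (Fin d) ℝ), γ₁.IsSymm → γ₂.IsSymm → (γ₁ - γ₂).PosSemidef →
        c * (γ₁ - γ₂).trace ≤ g p.1 p.2 y z γ₁ - g p.1 p.2 y z γ₂

/-- The nonlinearity of the equation satisfied by `-v` when `v` solves that of `g`. -/
def reflected (g : Nonlinearity d) : Nonlinearity d := fun t x y z γ => -g t x (-y) (-z) (-γ)

lemma ParabolicData.reflect {T : ℝ} {g : Nonlinearity d} {h : Spacetime d → ℝ} {L c : ℝ}
    (H : ParabolicData d T g h L c) :
    ParabolicData d T (reflected g) (fun p => -h p) L c where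
  T_pos := H.T_pos
  bdd := by simpa using H.bdd
  cont_h := H.cont_h.neg
  cont_g := by
    have hm : Continuous (fun q : ℝ × EuclideanSpace ℝ (Fin d) × ℝ × EuclideanSpace ℝ (Fin d) ×
        Matrix (Fin d) (Fin d) ℝ => (q.1, q.2.1, -q.2.2.1, -q.2.2.2.1, -q.2.2.2.2)) := by
      fun_prop
    refine (H.cont_g.comp hm.continuousOn ?_).neg
    rintro ⟨t, x, y, z, γ⟩ ⟨ht, hx, -, -, hγ⟩
    exact ⟨ht, hx, mem_univ _, mem_univ _, Matrix.IsSymm.neg hγ⟩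
  unif := by
    intro η hη
    obtain ⟨δ, hδ, hh⟩ := H.unif η hη
    refine ⟨δ, hδ, fun p hp q hq hpq y z γ hγ => ?_⟩
    have := hh p hp q hq hpq (-y) (-z) (-γ) hγ.neg
    simp only [reflected]
    rwa [neg_sub_neg, abs_sub_comm]
  L_nonneg := H.L_nonneg
  lip := by
    intro p hp y y' z z' γ γ' hγ hγ'
    have := H.lip p hp (-y') (-y) (-z') (-z) (-γ') (-γ) hγ'.neg hγ.neg
    simpa [reflected, neg_sub_neg, sub_eq_add_neg, add_comm] using this
  c_pos := H.c_pos
  ell := by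
    intro p hp y z γ₁ γ₂ h1 h2 h12
    have := H.ell p hp (-y) (-z) (-γ₂) (-γ₁) h2.neg h1.neg (by simpa [sub_eq_add_neg, add_comm] using h12)
    simp only [neg_sub_neg] at this
    simpa only [reflected, neg_sub_neg] using this

/-- Smooth strict subsolutions lying strictly below the boundary data. -/
structure IsStrictSubsol (T : ℝ) (g : Nonlinearity d) (h w : Spacetime d → ℝ) : Prop where
  smooth : ContDiff ℝ ∞ w
  pos : ∀ p ∈ cylQbar d T, 0 < parabOp g w p
  lt : ∀ p ∈ cylBdry d T, w p < h p

lemma cylQ_subset_cylQbar (d : ℕ) (T : ℝ) : cylQ d T ⊆ cylQbar d T :=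
  prod_mono Ico_subset_Icc_self Metric.ball_subset_closedBall

lemma cylBdry_subset_cylQbar {T : ℝ} (hT : 0 < T) : cylBdry d T ⊆ cylQbar d T :=
  union_subset (prod_mono subset_rfl Metric.sphere_subset_closedBall)
    (prod_mono (by simp [hT.le]) Metric.ball_subset_closedBall)

lemma isCompact_cylQbar (d : ℕ) (T : ℝ) : IsCompact (cylQbar d T) :=
  isCompact_Icc.prod (isCompact_closedBall 0 1)

lemma mem_cylQ_or_cylBdry {T : ℝ} {p : Spacetime d} (hp : p ∈ cylQbar d T) :
    p ∈ cylQ d T ∨ p ∈ cylBdry d T := by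
  obtain ⟨⟨h0, hT⟩, hx⟩ := hp
  have hx' : ‖p.2‖ ≤ 1 := by simpa using hx
  rcases hx'.lt_or_eq with h1 | h1
  · rcases hT.lt_or_eq with h2 | h2
    · exact Or.inl ⟨⟨h0, h2⟩, by simpa using h1⟩
    · exact Or.inr (Or.inr ⟨by simpa using h2, by simpa using h1⟩)
  · exact Or.inr (Or.inl ⟨⟨h0, hT⟩, by simpa using h1⟩)

lemma isCompact_cylBdry {T : ℝ} (hT : 0 < T) : IsCompact (cylBdry d T) := by
  have : cylBdry d T = Icc 0 T ×ˢ Metric.sphere 0 1 ∪ {T} ×ˢ Metric.closedBall 0 1 := by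
    apply Subset.antisymm
    · exact union_subset_union_right _ (prod_mono subset_rfl Metric.ball_subset_closedBall)
    · rintro p (hp | ⟨h1, h2⟩)
      · exact Or.inl hp
      · rw [mem_singleton_iff] at h1
        have hp : p ∈ cylQbar d T := ⟨by rw [h1]; exact ⟨hT.le, le_rfl⟩, h2⟩
        rcases mem_cylQ_or_cylBdry hp with h3 | h3
        · exact absurd h3.1.2 (by simp [h1])
        · exact h3
  rw [this]
  exact (isCompact_Icc.prod (isCompact_sphere 0 1)).union
    (isCompact_singleton.prod (isCompact_closedBall 0 1))

lemma ParabolicData.continuousOn_parabOp {T : ℝ} {g : Nonlinearity d} {h : Spacetime d → ℝ}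
    {L c : ℝ} (H : ParabolicData d T g h L c) {w : Spacetime d → ℝ} (hw : ContDiff ℝ ∞ w) :
    ContinuousOn (parabOp g w) (cylQbar d T) := by
  refine ((hw.dirDeriv _).continuous.continuousOn).add ?_
  have hm : Continuous fun p : Spacetime d => (p.1, p.2, w p, spGrad w p, spHess w p) := by
    have := hw.continuous
    have := continuous_spGrad hw
    have := continuous_spHess hw
    fun_prop
  refine H.cont_g.comp hm.continuousOn ?_
  rintro p ⟨h1, h2⟩
  exact ⟨h1, h2, mem_univ _, mem_univ _, spHess_isSymm hw p⟩

lemma IsStrictSubsol.isClassicalSubsol {T : ℝ} {g : Nonlinearity d} {h w : Spacetime d → ℝ}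
    (hw : IsStrictSubsol T g h w) : IsClassicalSubsol d T g h w := by
  refine ⟨dirDeriv (timeDir d) w, spGrad w, spHess w, hw.smooth.continuous.continuousOn,
    (hw.smooth.dirDeriv _).continuous.continuousOn, (continuous_spGrad hw.smooth).continuousOn,
    (continuous_spHess hw.smooth).continuousOn, fun p hp => ⟨hasDerivAt_time hw.smooth p,
      hasGradientAt_space hw.smooth p, hasFDerivAt_spGrad hw.smooth p, spHess_isSymm hw.smooth p,
      ?_⟩, fun p hp => (hw.lt p hp).le⟩
  have := hw.pos p (cylQ_subset_cylQbar d T hp)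
  rw [parabOp] at this
  linarith

lemma IsClassicalSubsol.neg_of_reflected {T : ℝ} {g : Nonlinearity d} {h w : Spacetime d → ℝ}
    (hw : IsClassicalSubsol d T (reflected g) (fun p => -h p) w) :
    IsClassicalSupersol d T g h (fun p => -w p) := by
  obtain ⟨wt, Dw, D2w, h0, h1, h2, h3, h4, h5⟩ := hw
  refine ⟨fun p => -wt p, fun p => -Dw p, fun p => -D2w p, h0.neg, h1.neg, h2.neg, h3.neg,
    fun p hp => ?_, fun p hp => by linarith [h5 p hp]⟩
  obtain ⟨k1, k2, k3, k4, k5⟩ := h4 p hp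
  refine ⟨k1.neg, ?_, ?_, k4.neg, ?_⟩
  · rw [hasGradientAt_iff_hasFDerivAt] at k2 ⊢
    rw [map_neg]
    exact k2.neg
  · have : matCLM d (-D2w p) = -matCLM d (D2w p) := by simp [matCLM]
    rw [this]
    exact k3.neg
  · simp only [reflected] at k5
    linarith

/-- A smooth convex regularization of the absolute value. -/
noncomputable def softAbs (r s : ℝ) : ℝ := Real.sqrt (r ^ 2 + s ^ 2)

lemma softAbs_sq (r s : ℝ) : softAbs r s ^ 2 = r ^ 2 + s ^ 2 := Real.sq_sqrt (by positivity)

lemma softAbs_pos {r : ℝ} (hr : 0 < r) (s : ℝ) : 0 < softAbs r s :=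
  Real.sqrt_pos.2 (by positivity)

lemma abs_le_softAbs (r s : ℝ) : |s| ≤ softAbs r s := by
  rw [← Real.sqrt_sq_eq_abs]
  exact Real.sqrt_le_sqrt (by nlinarith [sq_nonneg r])

lemma softAbs_le {r : ℝ} (hr : 0 < r) (s : ℝ) : softAbs r s ≤ r + |s| := by
  apply Real.sqrt_le_iff.2 ⟨by positivity, ?_⟩
  nlinarith [sq_abs s, abs_nonneg s]

lemma abs_div_softAbs_le {r : ℝ} (hr : 0 < r) (s : ℝ) : |s / softAbs r s| ≤ 1 := by
  rw [abs_div, abs_of_pos (softAbs_pos hr s), div_le_one (softAbs_pos hr s)]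
  exact abs_le_softAbs r s

lemma hasDerivAt_softAbs {r : ℝ} (hr : 0 < r) (s : ℝ) :
    HasDerivAt (softAbs r) (s / softAbs r s) s := by
  have h1 : HasDerivAt (fun s : ℝ => r ^ 2 + s ^ 2) (2 * s) s := by
    simpa using (hasDerivAt_pow 2 s).const_add (r ^ 2)
  have h2 := h1.sqrt (by positivity)
  rw [mul_div_mul_left _ _ two_ne_zero] at h2
  exact h2

lemma hasDerivAt_div_softAbs {r : ℝ} (hr : 0 < r) (s : ℝ) :
    HasDerivAt (fun s => s / softAbs r s) (r ^ 2 / softAbs r s ^ 3) s := by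
  have hp := softAbs_pos hr s
  have := (hasDerivAt_id s).div (hasDerivAt_softAbs hr s) hp.ne'
  refine this.congr_deriv ?_
  have h2 := softAbs_sq r s
  simp only [id]
  field_simp
  rw [h2]; ring

lemma contDiff_softAbs {r : ℝ} (hr : 0 < r) {n : WithTop ℕ∞} : ContDiff ℝ n (softAbs r) := by
  unfold softAbs
  exact ContDiff.sqrt (by fun_prop) (fun s => by positivity)

set_option maxHeartbeats 2000000 in
/-- Choice of the parameters of the regularized maximum. -/
lemma exists_smoothing_parameters (d : ℕ) {κ₀ δ C L c : ℝ} (hκ₀ : 0 < κ₀) (hδ : 0 < δ)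
    (hC : 0 ≤ C) (hL : 0 ≤ L) (hc : 0 < c) :
    ∃ κ > 0, ∃ σ > 0, ∃ ε > 0, σ ≤ 1 ∧ (1 + L) * (ε + κ * C) < κ₀ ∧
      ∀ (s Rv Rφ : ℝ) (a : Fin d → ℝ) (b : Fin d → Fin d → ℝ),
        |s| ≤ C → (∀ i, |a i| ≤ C) → (∀ i j, |b i j| ≤ C) → κ₀ ≤ Rv → -C ≤ Rφ →
        (-δ ≤ s → κ₀ ≤ Rφ) →
        (1 + L) * (ε + κ * C) <
          (1 - (1 + s / softAbs ε s) / 2) * Rv + (1 + s / softAbs ε s) / 2 * Rφ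
          - 2 * ((1 + s / softAbs ε s) / 2) * (1 - (1 + s / softAbs ε s) / 2) * L *
            (|s| + ∑ i, |a i| + ∑ i, ∑ j, |b i j|)
          + c * (ε ^ 2 / softAbs ε s ^ 3 / 2 * ∑ i, a i ^ 2
            + κ * ∑ i, σ ^ 2 / softAbs σ (a i) ^ 3 * ∑ j, b i j ^ 2) := by
  -- the bounds on the first order quantities
  have small : ∀ K η : ℝ, 0 ≤ K → 0 < η → ∃ x > 0, x ≤ 1 ∧ K * x ≤ η := by
    intro K η hK hη
    refine ⟨min 1 (η / (K + 1)), by positivity, min_le_left _ _, ?_⟩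
    calc K * min 1 (η / (K + 1)) ≤ (K + 1) * (η / (K + 1)) :=
          mul_le_mul (by linarith) (min_le_right _ _) (by positivity) (by positivity)
      _ = η := by field_simp
  set C3 := C * (1 + d + d ^ 2) with hC3
  have hC3' : 0 ≤ C3 := by positivity
  obtain ⟨κ, hκ, -, hκ'⟩ := small ((1 + L) * C) (κ₀ / 8) (by positivity) (by positivity)
  obtain ⟨σ, hσ, hσ1, hσ'⟩ := small (L * d / 2 + d ^ 2 * (3 * L ^ 2 / (16 * c * κ))) (κ₀ / 8)
    (by positivity) (by positivity)
  obtain ⟨e, he, he1, he'⟩ := small ((κ₀ + C) + L * C3 + (1 + L) + L + κ₀ / δ +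
    κ₀ * (L * C3 / (c * σ ^ 2))) (κ₀ / 8) (by positivity) (by positivity)
  have q1 : 0 ≤ (κ₀ + C) * e := by positivity
  have q2 : 0 ≤ L * C3 * e := by positivity
  have q3 : 0 ≤ (1 + L) * e := by positivity
  have q4 : 0 ≤ L * e := by positivity
  have q5 : 0 ≤ κ₀ / δ * e := by positivity
  have q6 : 0 ≤ κ₀ * (L * C3 / (c * σ ^ 2)) * e := by positivity
  have r5 : e ≤ δ := by
    have : κ₀ / δ * e ≤ κ₀ / δ * δ := by
      rw [div_mul_cancel₀ _ hδ.ne']; linarith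
    exact le_of_mul_le_mul_left this (by positivity)
  have r6 : L * C3 * e ≤ c * σ ^ 2 := by
    have h1 : κ₀ * (L * C3 / (c * σ ^ 2) * e) ≤ κ₀ * 1 := by linarith
    have h2 := le_of_mul_le_mul_left h1 hκ₀
    rwa [div_mul_eq_mul_div, div_le_one (by positivity)] at h2
  have hee : e ^ 2 ≤ e := by nlinarith
  have herr : (1 + L) * (e ^ 2 + κ * C) ≤ κ₀ / 4 := by
    have h1 : (1 + L) * e ^ 2 ≤ (1 + L) * e := by gcongr
    have h2 : (1 + L) * (e ^ 2 + κ * C) = (1 + L) * e ^ 2 + (1 + L) * C * κ := by ring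
    linarith only [h1, h2, hκ', he', q1, q2, q3, q4, q5, q6]
  refine ⟨κ, hκ, σ, hσ, e ^ 2, by positivity, hσ1, by linarith, ?_⟩
  intro s Rv Rφ a b hs ha hb hRv hRφ hRφ'
  have hε : 0 < e ^ 2 := by positivity
  set f := softAbs (e ^ 2) s with hf
  have hfp : 0 < f := softAbs_pos hε s
  have hf2 : f ^ 2 = (e ^ 2) ^ 2 + s ^ 2 := softAbs_sq _ _
  have hsf := abs_le.1 (abs_div_softAbs_le hε s)
  rw [← hf] at hsf
  set θ := (1 + s / f) / 2 with hθ
  have hθ0 : 0 ≤ θ := by linarith [hsf.1]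
  have hθ1 : θ ≤ 1 := by linarith [hsf.2]
  set q := (e ^ 2) ^ 2 / f ^ 2 with hq
  have hq0 : 0 ≤ q := by positivity
  have hq1 : q ≤ 1 := by rw [hq, div_le_one (by positivity)]; nlinarith
  have hθq : 2 * θ * (1 - θ) = q / 2 := by
    rw [hθ, hq]
    field_simp
    linear_combination hf2
  have hsum_a : ∑ i, |a i| ≤ d * C := by
    simpa using Finset.sum_le_card_nsmul Finset.univ (fun i => |a i|) C (fun i _ => ha i)
  have hsum_b : ∑ i, ∑ j, |b i j| ≤ d ^ 2 * C := by
    have h1 : ∀ i, ∑ j, |b i j| ≤ d * C := fun i => by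
      simpa using Finset.sum_le_card_nsmul Finset.univ (fun j => |b i j|) C (fun j _ => hb i j)
    have := Finset.sum_le_card_nsmul Finset.univ (fun i => ∑ j, |b i j|) (d * C) (fun i _ => h1 i)
    simp only [Finset.card_univ, Fintype.card_fin, nsmul_eq_mul] at this
    linarith only [this]
  have hS0 : |s| + ∑ i, |a i| + ∑ i, ∑ j, |b i j| ≤ C3 := by
    rw [hC3]; linarith only [hs, hsum_a, hsum_b]
  have hSnn : 0 ≤ |s| + ∑ i, |a i| + ∑ i, ∑ j, |b i j| := by positivity
  have hP1 : 0 ≤ (e ^ 2) ^ 2 / f ^ 3 / 2 * ∑ i, a i ^ 2 := by positivity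
  have hP2 : 0 ≤ κ * ∑ i, σ ^ 2 / softAbs σ (a i) ^ 3 * ∑ j, b i j ^ 2 := by
    have : ∀ i, 0 < softAbs σ (a i) := fun i => softAbs_pos hσ _
    apply mul_nonneg hκ.le
    apply Finset.sum_nonneg
    intro i _
    have := this i
    positivity
  rw [hθq]
  by_cases hcase : e ≤ f
  · -- far from the contact set
    have hqe : q ≤ e := by
      rw [hq, div_le_iff₀ (by positivity)]
      have : e ^ 2 ≤ f ^ 2 := by gcongr
      calc (e ^ 2) ^ 2 = e ^ 2 * e ^ 2 := by ring
        _ ≤ e * f ^ 2 := by gcongr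
    have hbase : κ₀ - e * (κ₀ + C) ≤ (1 - θ) * Rv + θ * Rφ := by
      by_cases hsδ : -δ ≤ s
      · have := hRφ' hsδ
        have h1 : 0 ≤ (1 - θ) * (Rv - κ₀) := mul_nonneg (by linarith only [hθ1]) (by linarith only [hRv])
        have h2 : 0 ≤ θ * (Rφ - κ₀) := mul_nonneg hθ0 (by linarith only [this])
        have h3 : 0 ≤ e * (κ₀ + C) := by positivity
        linarith only [h1, h2, h3]
      · have hs0 : s ≤ 0 := by linarith
        have hθh : θ ≤ 1 / 2 := by
          have : s / f ≤ 0 := div_nonpos_of_nonpos_of_nonneg hs0 hfp.le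
          rw [hθ]; linarith
        have hθe : θ ≤ e := by
          have h1 : 0 ≤ θ * (1 / 2 - θ) := mul_nonneg hθ0 (by linarith only [hθh])
          have h2 : 2 * θ * (1 - θ) = θ + 2 * (θ * (1 / 2 - θ)) := by ring
          linarith only [h1, h2, hθq, hqe, he]
        have h1 : 0 ≤ (1 - θ) * (Rv - κ₀) :=
          mul_nonneg (by linarith only [hθ1]) (by linarith only [hRv])
        have h2 : 0 ≤ θ * (Rφ + C) := mul_nonneg hθ0 (by linarith only [hRφ])
        have h3 : 0 ≤ (e - θ) * (κ₀ + C) := mul_nonneg (by linarith only [hθe]) (by positivity)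
        linarith only [h1, h2, h3]
    have hneg : q / 2 * L * (|s| + ∑ i, |a i| + ∑ i, ∑ j, |b i j|) ≤ e * (L * C3) := by
      calc _ ≤ e * L * C3 := by gcongr; linarith only [hqe, hq0]
        _ = _ := by ring
    have hP : 0 ≤ c * ((e ^ 2) ^ 2 / f ^ 3 / 2 * ∑ i, a i ^ 2
            + κ * ∑ i, σ ^ 2 / softAbs σ (a i) ^ 3 * ∑ j, b i j ^ 2) :=
      mul_nonneg hc.le (add_nonneg hP1 hP2)
    linarith only [hbase, hneg, hP, herr, he', hκ₀, q1, q2, q3, q4, q5, q6]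
  push Not at hcase
  have hse : |s| ≤ e := (abs_le_softAbs _ _).trans hcase.le
  have hRφ'' := hRφ' (by linarith [neg_abs_le s])
  have hbase : κ₀ ≤ (1 - θ) * Rv + θ * Rφ := by
    have h1 : 0 ≤ (1 - θ) * (Rv - κ₀) :=
      mul_nonneg (by linarith only [hθ1]) (by linarith only [hRv])
    have h2 : 0 ≤ θ * (Rφ - κ₀) := mul_nonneg hθ0 (by linarith only [hRφ''])
    linarith only [h1, h2]
  by_cases hgrad : ∃ i, σ < |a i|
  · -- the gradients differ: the regularized maximum is strongly convex
    obtain ⟨i, hi⟩ := hgrad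
    have h1 : σ ^ 2 ≤ ∑ i, a i ^ 2 := by
      calc σ ^ 2 ≤ a i ^ 2 := by rw [← sq_abs (a i)]; gcongr
        _ ≤ _ := Finset.single_le_sum (f := fun i => a i ^ 2) (fun _ _ => sq_nonneg _)
          (Finset.mem_univ i)
    have h2 : (e ^ 2) ^ 2 / f ^ 3 / 2 = q / 2 / f := by rw [hq]; field_simp
    have h3 : q / 2 * L * (|s| + ∑ i, |a i| + ∑ i, ∑ j, |b i j|) ≤ q / 2 * (L * C3) := by
      calc _ ≤ q / 2 * L * C3 := by gcongr
        _ = _ := by ring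
    have h4 : L * C3 ≤ c * (σ ^ 2 / f) := by
      rw [mul_div_assoc', le_div_iff₀ hfp]
      calc L * C3 * f ≤ L * C3 * e := by gcongr
        _ ≤ _ := r6
    have h5 : q / 2 * (L * C3) ≤ c * ((e ^ 2) ^ 2 / f ^ 3 / 2 * ∑ i, a i ^ 2) := by
      rw [h2]
      calc q / 2 * (L * C3) ≤ q / 2 * (c * (σ ^ 2 / f)) := by gcongr
        _ = c * (q / 2 / f * σ ^ 2) := by ring
        _ ≤ _ := by gcongr
    have h6 : 0 ≤ c * (κ * ∑ i, σ ^ 2 / softAbs σ (a i) ^ 3 * ∑ j, b i j ^ 2) := mul_nonneg hc.le hP2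
    rw [mul_add c]
    linarith only [hbase, h3, h5, h6, herr, hκ₀]
  -- the gradients agree: the corrector controls the difference of the Hessians
  push Not at hgrad
  have hcoef : ∀ i, 1 / (3 * σ) ≤ σ ^ 2 / softAbs σ (a i) ^ 3 := by
    intro i
    have h1 := softAbs_sq σ (a i)
    have h2 := softAbs_pos hσ (a i)
    have h3 : a i ^ 2 ≤ σ ^ 2 := by rw [← sq_abs (a i)]; gcongr; exact hgrad i
    rw [div_le_div_iff₀ (by positivity) (by positivity)]
    have h4 : softAbs σ (a i) ≤ 3 / 2 * σ := by
      apply le_of_sq_le_sq _ (by positivity)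
      nlinarith only [h1, h3]
    have h5 : softAbs σ (a i) ^ 3 = softAbs σ (a i) * softAbs σ (a i) ^ 2 := by ring
    rw [h5]
    calc 1 * (softAbs σ (a i) * softAbs σ (a i) ^ 2) ≤ 1 * (3 / 2 * σ * (2 * σ ^ 2)) := by
          gcongr
          linarith only [h1, h3]
      _ = σ ^ 2 * (3 * σ) := by ring
  have hb2 : ∑ i, ∑ j, (L / 2 * |b i j| - 3 * L ^ 2 / (16 * c * κ) * σ) ≤
      c * (κ * ∑ i, σ ^ 2 / softAbs σ (a i) ^ 3 * ∑ j, b i j ^ 2) := by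
    rw [Finset.mul_sum, Finset.mul_sum]
    apply Finset.sum_le_sum
    intro i _
    rw [Finset.mul_sum, Finset.mul_sum, Finset.mul_sum]
    apply Finset.sum_le_sum
    intro j _
    have h1 : c * (κ * (1 / (3 * σ) * b i j ^ 2)) ≤
        c * (κ * (σ ^ 2 / softAbs σ (a i) ^ 3 * b i j ^ 2)) :=
      mul_le_mul_of_nonneg_left (mul_le_mul_of_nonneg_left
        (mul_le_mul_of_nonneg_right (hcoef i) (sq_nonneg _)) hκ.le) hc.le
    refine le_trans ?_ h1
    have h2 : c * (κ * (1 / (3 * σ) * b i j ^ 2)) - (L / 2 * |b i j|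
        - 3 * L ^ 2 / (16 * c * κ) * σ) = c * κ / (3 * σ) *
          (|b i j| - 3 * σ * L / (4 * c * κ)) ^ 2 := by
      rw [sub_sq, sq_abs]
      field_simp
      ring
    have h3 : 0 ≤ c * κ / (3 * σ) * (|b i j| - 3 * σ * L / (4 * c * κ)) ^ 2 := by positivity
    linarith only [h2, h3]
  simp only [Finset.sum_sub_distrib, Finset.sum_const, Finset.card_univ, Fintype.card_fin,
    nsmul_eq_mul, ← Finset.mul_sum] at hb2
  have hsa : ∑ i, |a i| ≤ d * σ := by
    simpa using Finset.sum_le_card_nsmul Finset.univ (fun i => |a i|) σ (fun i _ => hgrad i)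
  have hneg : q / 2 * L * (|s| + ∑ i, |a i| + ∑ i, ∑ j, |b i j|) ≤
      1 / 2 * L * (e + d * σ + ∑ i, ∑ j, |b i j|) := by
    gcongr
  rw [mul_add c]
  have : (d : ℝ) * (d * (3 * L ^ 2 / (16 * c * κ) * σ)) = d ^ 2 * (3 * L ^ 2 / (16 * c * κ)) * σ := by
    ring
  have hLe : 1 / 2 * L * e ≤ κ₀ / 8 := by
    linarith only [he', q1, q2, q3, q4, q5, q6]
  have hLσ : 1 / 2 * L * (d * σ) + d ^ 2 * (3 * L ^ 2 / (16 * c * κ)) * σ ≤ κ₀ / 8 := by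
    linarith only [hσ']
  have hP' : 0 ≤ c * ((e ^ 2) ^ 2 / f ^ 3 / 2 * ∑ i, a i ^ 2) := mul_nonneg hc.le hP1
  linarith only [hbase, hneg, hP', hb2, this, hLe, hLσ, herr, hκ₀]

section SoftAbsChain

variable {V : Type*} [NormedAddCommGroup V] [NormedSpace ℝ V]

lemma ContDiff.softAbs {a : V → ℝ} (ha : ContDiff ℝ ∞ a) {r : ℝ} (hr : 0 < r) :
    ContDiff ℝ ∞ (fun p => softAbs r (a p)) :=
  (contDiff_softAbs hr).comp ha

lemma dirDeriv_softAbs {a : V → ℝ} (ha : ContDiff ℝ ∞ a) {r : ℝ} (hr : 0 < r) (u : V) :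
    dirDeriv u (fun p => softAbs r (a p)) =
      fun p => a p / softAbs r (a p) * dirDeriv u a p :=
  dirDeriv_comp (hasDerivAt_softAbs hr) ha u

lemma dirDeriv_dirDeriv_softAbs {a : V → ℝ} (ha : ContDiff ℝ ∞ a) {r : ℝ} (hr : 0 < r) (u v : V) :
    dirDeriv u (dirDeriv v (fun p => softAbs r (a p))) =
      fun p => r ^ 2 / softAbs r (a p) ^ 3 * (dirDeriv u a p * dirDeriv v a p) +
        a p / softAbs r (a p) * dirDeriv u (dirDeriv v a) p := by
  have hs : ContDiff ℝ ∞ (fun p => a p / softAbs r (a p)) :=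
    ha.div (ha.softAbs hr) fun p => (softAbs_pos hr _).ne'
  rw [dirDeriv_softAbs ha hr, dirDeriv_mul hs (ha.dirDeriv v),
    dirDeriv_comp (hasDerivAt_div_softAbs hr) ha]
  ext p
  ring

end SoftAbsChain

/-- A smooth regularization of `max v φ`, corrected so as to be strongly convex where the
gradients of `v` and `φ` agree but the Hessians do not. -/
noncomputable def regMax (ε σ κ : ℝ) (v φ : Spacetime d → ℝ) (p : Spacetime d) : ℝ :=
  1 / 2 * (v p + φ p) + 1 / 2 * softAbs ε (φ p - v p) +
    κ * ∑ i, softAbs σ (dirDeriv (spaceDir i) (fun q => φ q - v q) p)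

section RegMax

variable {ε σ κ : ℝ} {v φ : Spacetime d → ℝ}

lemma contDiff_regMax (hε : 0 < ε) (hσ : 0 < σ) (κ : ℝ) (hv : ContDiff ℝ ∞ v)
    (hφ : ContDiff ℝ ∞ φ) : ContDiff ℝ ∞ (regMax ε σ κ v φ) := by
  refine ((contDiff_const.mul (hv.add hφ)).add (contDiff_const.mul ((hφ.sub hv).softAbs hε))).add
    (contDiff_const.mul (ContDiff.sum fun i _ => ?_))
  exact ((hφ.sub hv).dirDeriv _).softAbs hσ

lemma dirDeriv_regMax (hε : 0 < ε) (hσ : 0 < σ) (κ : ℝ) (hv : ContDiff ℝ ∞ v)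
    (hφ : ContDiff ℝ ∞ φ) (u : Spacetime d) :
    dirDeriv u (regMax ε σ κ v φ) = fun p =>
      1 / 2 * (dirDeriv u v p + dirDeriv u φ p) +
        1 / 2 * dirDeriv u (fun p => softAbs ε (φ p - v p)) p +
        κ * ∑ i, dirDeriv u
          (fun p => softAbs σ (dirDeriv (spaceDir i) (fun q => φ q - v q) p)) p := by
  have hs : ∀ i : Fin d,
      ContDiff ℝ ∞ fun p => softAbs σ (dirDeriv (spaceDir i) (fun q => φ q - v q) p) :=
    fun i => ((hφ.sub hv).dirDeriv _).softAbs hσ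
  have hf : ContDiff ℝ ∞ (fun p => softAbs ε (φ p - v p)) := (hφ.sub hv).softAbs hε
  unfold regMax
  rw [dirDeriv_add (by fun_prop) (contDiff_const.mul (ContDiff.sum fun i _ => hs i)),
    dirDeriv_add (by fun_prop) (by fun_prop), dirDeriv_const_mul (by fun_prop),
    dirDeriv_const_mul (by fun_prop), dirDeriv_const_mul (ContDiff.sum fun i _ => hs i),
    dirDeriv_sum hs, dirDeriv_add hv hφ]

lemma dirDeriv_dirDeriv_regMax (hε : 0 < ε) (hσ : 0 < σ) (κ : ℝ) (hv : ContDiff ℝ ∞ v)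
    (hφ : ContDiff ℝ ∞ φ) (u u' : Spacetime d) :
    dirDeriv u (dirDeriv u' (regMax ε σ κ v φ)) = fun p =>
      1 / 2 * (dirDeriv u (dirDeriv u' v) p + dirDeriv u (dirDeriv u' φ) p) +
        1 / 2 * dirDeriv u (dirDeriv u' (fun p => softAbs ε (φ p - v p))) p +
        κ * ∑ i, dirDeriv u (dirDeriv u'
          (fun p => softAbs σ (dirDeriv (spaceDir i) (fun q => φ q - v q) p))) p := by
  have hs : ∀ i : Fin d, ContDiff ℝ ∞
      (dirDeriv u' fun p => softAbs σ (dirDeriv (spaceDir i) (fun q => φ q - v q) p)) :=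
    fun i => (((hφ.sub hv).dirDeriv _).softAbs hσ).dirDeriv _
  have hf : ContDiff ℝ ∞ (dirDeriv u' (fun p => softAbs ε (φ p - v p))) :=
    ((hφ.sub hv).softAbs hε).dirDeriv _
  have hv' := hv.dirDeriv u'
  have hφ' := hφ.dirDeriv u'
  rw [dirDeriv_regMax hε hσ κ hv hφ]
  rw [dirDeriv_add (by fun_prop) (contDiff_const.mul (ContDiff.sum fun i _ => hs i)),
    dirDeriv_add (by fun_prop) (by fun_prop), dirDeriv_const_mul (by fun_prop),
    dirDeriv_const_mul (by fun_prop), dirDeriv_const_mul (ContDiff.sum fun i _ => hs i),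
    dirDeriv_sum hs, dirDeriv_add hv' hφ']

lemma max_le_regMax (ε : ℝ) (hσ : 0 < σ) (hκ : 0 ≤ κ) (p : Spacetime d) :
    max (v p) (φ p) ≤ regMax ε σ κ v φ p := by
  have h1 : 0 ≤ κ * ∑ i, softAbs σ (dirDeriv (spaceDir i) (fun q => φ q - v q) p) :=
    mul_nonneg hκ (Finset.sum_nonneg fun i _ => (softAbs_pos hσ _).le)
  have h2 := abs_le.1 (abs_le_softAbs ε (φ p - v p))
  unfold regMax
  apply max_le <;> linarith [h2.1, h2.2]

lemma regMax_le (hε : 0 < ε) (hκ : 0 ≤ κ) {C m : ℝ} (p : Spacetime d)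
    (hC : ∑ i, softAbs σ (dirDeriv (spaceDir i) (fun q => φ q - v q) p) ≤ C)
    (h1 : v p ≤ m) (h2 : φ p ≤ m) :
    regMax ε σ κ v φ p ≤ m + (ε + κ * C) := by
  have h3 := softAbs_le hε (φ p - v p)
  have h4 : v p + φ p + |φ p - v p| ≤ 2 * m := by
    cases abs_cases (φ p - v p) <;> linarith
  have h5 := mul_le_mul_of_nonneg_left hC hκ
  unfold regMax
  linarith

end RegMax

/-- Lower bound of `g` at a jet which is a perturbation of a convex combination of two jets. -/
lemma ParabolicData.le_blend {T : ℝ} {g : Nonlinearity d} {h : Spacetime d → ℝ} {L c : ℝ}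
    (H : ParabolicData d T g h L c) {p : Spacetime d} (hp : p ∈ cylQbar d T)
    {y₁ y₂ y : ℝ} {z₁ z₂ z : EuclideanSpace ℝ (Fin d)} {M₁ M₂ M P : Matrix (Fin d) (Fin d) ℝ}
    (h₁ : M₁.IsSymm) (h₂ : M₂.IsSymm) (hM : M.IsSymm) (hP : P.PosSemidef) {θ : ℝ} (hθ0 : 0 ≤ θ)
    (hθ1 : θ ≤ 1) :
    (1 - θ) * g p.1 p.2 y₁ z₁ M₁ + θ * g p.1 p.2 y₂ z₂ M₂
      - 2 * θ * (1 - θ) * L * (|y₂ - y₁| + ∑ i, |z₂ i - z₁ i| + ∑ i, ∑ j, |M₂ i j - M₁ i j|)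
      + c * P.trace
      - L * (|y - ((1 - θ) * y₁ + θ * y₂)| + ∑ i, |z i - ((1 - θ) * z₁ i + θ * z₂ i)|
        + ∑ i, ∑ j, |M i j - ((1 - θ) * M₁ i j + θ * M₂ i j + P i j)|)
      ≤ g p.1 p.2 y z M := by
  have hPs : P.IsSymm := by
    have := hP.isHermitian
    rwa [Matrix.IsHermitian, Matrix.conjTranspose_eq_transpose_of_trivial] at this
  set y' := (1 - θ) * y₁ + θ * y₂ with hy'
  set z' := (1 - θ) • z₁ + θ • z₂ with hz'
  set M' := (1 - θ) • M₁ + θ • M₂ with hM'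
  have hs' : M'.IsSymm := (h₁.smul _).add (h₂.smul _)
  set S := |y₂ - y₁| + ∑ i, |z₂ i - z₁ i| + ∑ i, ∑ j, |M₂ i j - M₁ i j| with hS
  have e1 : g p.1 p.2 y₁ z₁ M₁ - L * (θ * S) ≤ g p.1 p.2 y' z' M' := by
    have := (abs_le.1 (H.lip p hp y' y₁ z' z₁ M' M₁ hs' h₁)).1
    have h3 : |y' - y₁| + ∑ i, |z' i - z₁ i| + ∑ i, ∑ j, |M' i j - M₁ i j| = θ * S := by
      have hab : ∀ x y : ℝ, x = θ * y → |x| = θ * |y| := by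
        rintro _ y rfl
        rw [abs_mul, abs_of_nonneg hθ0]
      rw [hS, mul_add, mul_add, Finset.mul_sum, Finset.mul_sum]
      congr 1
      · congr 1
        · exact hab _ _ (by rw [hy']; ring)
        · refine Finset.sum_congr rfl fun i _ => hab _ _ ?_
          simp only [hz', PiLp.add_apply, PiLp.smul_apply, smul_eq_mul]
          ring
      · refine Finset.sum_congr rfl fun i _ => ?_
        rw [Finset.mul_sum]
        refine Finset.sum_congr rfl fun j _ => hab _ _ ?_
        simp only [hM', Matrix.add_apply, Matrix.smul_apply, smul_eq_mul]
        ring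
    rw [h3] at this
    linarith
  have e2 : g p.1 p.2 y₂ z₂ M₂ - L * ((1 - θ) * S) ≤ g p.1 p.2 y' z' M' := by
    have := (abs_le.1 (H.lip p hp y' y₂ z' z₂ M' M₂ hs' h₂)).1
    have hθ2 : 0 ≤ 1 - θ := by linarith
    have h3 : |y' - y₂| + ∑ i, |z' i - z₂ i| + ∑ i, ∑ j, |M' i j - M₂ i j| = (1 - θ) * S := by
      have hab : ∀ x y : ℝ, x = -((1 - θ) * y) → |x| = (1 - θ) * |y| := by
        rintro _ y rfl
        rw [abs_neg, abs_mul, abs_of_nonneg hθ2]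
      rw [hS, mul_add, mul_add, Finset.mul_sum, Finset.mul_sum]
      congr 1
      · congr 1
        · exact hab _ _ (by rw [hy']; ring)
        · refine Finset.sum_congr rfl fun i _ => hab _ _ ?_
          simp only [hz', PiLp.add_apply, PiLp.smul_apply, smul_eq_mul]
          ring
      · refine Finset.sum_congr rfl fun i _ => ?_
        rw [Finset.mul_sum]
        refine Finset.sum_congr rfl fun j _ => hab _ _ ?_
        simp only [hM', Matrix.add_apply, Matrix.smul_apply, smul_eq_mul]
        ring
    rw [h3] at this
    linarith
  have e3 := H.ell p hp y' z' (M' + P) M' (hs'.add hPs) hs' (by simpa using hP)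
  rw [add_sub_cancel_left] at e3
  have e4 := (abs_le.1 (H.lip p hp y y' z z' M (M' + P) hM (hs'.add hPs))).1
  have e5 : |y - y'| + ∑ i, |z i - z' i| + ∑ i, ∑ j, |M i j - (M' + P) i j| =
      |y - ((1 - θ) * y₁ + θ * y₂)| + ∑ i, |z i - ((1 - θ) * z₁ i + θ * z₂ i)|
        + ∑ i, ∑ j, |M i j - ((1 - θ) * M₁ i j + θ * M₂ i j + P i j)| := by
    simp [hy', hz', hM']
  rw [← e5]
  have e6 := mul_le_mul_of_nonneg_left e1 (by linarith : 0 ≤ 1 - θ)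
  have e7 := mul_le_mul_of_nonneg_left e2 hθ0
  linarith only [e3, e4, e6, e7]

/-- A bound for the contributions of the corrector of `regMax` to the equation. -/
noncomputable def correctorBound (ψ : Spacetime d → ℝ) (p : Spacetime d) : ℝ :=
  ∑ i, |dirDeriv (timeDir d) (dirDeriv (spaceDir i) ψ) p| +
    (∑ i, (1 + |dirDeriv (spaceDir i) ψ p|)) +
    (∑ j, ∑ i, |dirDeriv (spaceDir j) (dirDeriv (spaceDir i) ψ) p|) +
    ∑ j, ∑ k, ∑ i, |dirDeriv (spaceDir j) (dirDeriv (spaceDir k) (dirDeriv (spaceDir i) ψ)) p|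

lemma correctorBound_nonneg (ψ : Spacetime d → ℝ) (p : Spacetime d) :
    0 ≤ correctorBound ψ p := by
  unfold correctorBound
  positivity

lemma continuous_correctorBound {ψ : Spacetime d → ℝ} (hψ : ContDiff ℝ ∞ ψ) :
    Continuous (correctorBound ψ) := by
  have h1 : ∀ u, Continuous (dirDeriv u ψ) := fun u => (hψ.dirDeriv u).continuous
  have h2 : ∀ u u', Continuous (dirDeriv u (dirDeriv u' ψ)) :=
    fun u u' => ((hψ.dirDeriv u').dirDeriv u).continuous
  have h3 : ∀ u u' u'', Continuous (dirDeriv u (dirDeriv u' (dirDeriv u'' ψ))) :=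
    fun u u' u'' => (((hψ.dirDeriv u'').dirDeriv u').dirDeriv u).continuous
  unfold correctorBound
  fun_prop

lemma abs_const_mul_sum_le {ι : Type*} (S : Finset ι) {κ : ℝ} (hκ : 0 ≤ κ) {s t : ι → ℝ}
    (hs : ∀ i, |s i| ≤ 1) : |κ * ∑ i ∈ S, s i * t i| ≤ κ * ∑ i ∈ S, |t i| := by
  rw [abs_mul, abs_of_nonneg hκ]
  refine mul_le_mul_of_nonneg_left ((Finset.abs_sum_le_sum_abs _ _).trans
    (Finset.sum_le_sum fun i _ => ?_)) hκ
  rw [abs_mul]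
  exact mul_le_of_le_one_left (abs_nonneg _) (hs i)

lemma ParabolicData.le_parabOp_regMax {T : ℝ} {g : Nonlinearity d} {h : Spacetime d → ℝ} {L c : ℝ}
    (H : ParabolicData d T g h L c) {p : Spacetime d} (hp : p ∈ cylQbar d T)
    {ε σ κ : ℝ} (hε : 0 < ε) (hσ : 0 < σ) (hσ1 : σ ≤ 1) (hκ : 0 ≤ κ) {v φ : Spacetime d → ℝ}
    (hv : ContDiff ℝ ∞ v) (hφ : ContDiff ℝ ∞ φ) {ψ : Spacetime d → ℝ}
    (hψ : ψ = fun q => φ q - v q) {θ : ℝ} (hθ : θ = (1 + ψ p / softAbs ε (ψ p)) / 2) :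
    (1 - θ) * parabOp g v p + θ * parabOp g φ p
      - 2 * θ * (1 - θ) * L * (|ψ p| + ∑ i, |dirDeriv (spaceDir i) ψ p| +
        ∑ i, ∑ j, |dirDeriv (spaceDir j) (dirDeriv (spaceDir i) ψ) p|)
      + c * (ε ^ 2 / softAbs ε (ψ p) ^ 3 / 2 * ∑ i, dirDeriv (spaceDir i) ψ p ^ 2
        + κ * ∑ i, σ ^ 2 / softAbs σ (dirDeriv (spaceDir i) ψ p) ^ 3 *
          ∑ j, dirDeriv (spaceDir j) (dirDeriv (spaceDir i) ψ) p ^ 2)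
      - (1 + L) * (ε + κ * correctorBound ψ p) ≤ parabOp g (regMax ε σ κ v φ) p := by
  have hψs : ContDiff ℝ ∞ ψ := hψ ▸ hφ.sub hv
  have hψp : ψ p = φ p - v p := by rw [hψ]
  have hψ1 : ∀ u, dirDeriv u ψ p = dirDeriv u φ p - dirDeriv u v p := fun u => by
    rw [hψ, dirDeriv_sub hφ hv]
  have hψ2 : ∀ u u', dirDeriv u (dirDeriv u' ψ) p =
      dirDeriv u (dirDeriv u' φ) p - dirDeriv u (dirDeriv u' v) p := fun u u' => by
    rw [hψ, dirDeriv_sub hφ hv, dirDeriv_sub (hφ.dirDeriv _) (hv.dirDeriv _)]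
  set f := softAbs ε (ψ p) with hf
  have hfp : 0 < f := softAbs_pos hε _
  have hfsq : f ^ 2 = ε ^ 2 + ψ p ^ 2 := softAbs_sq _ _
  have hθabs := abs_le.1 (abs_div_softAbs_le hε (ψ p))
  rw [← hf] at hθabs
  have hθ0 : 0 ≤ θ := by linarith [hθabs.1]
  have hθ1 : θ ≤ 1 := by linarith [hθabs.2]
  set a : Fin d → ℝ := fun i => dirDeriv (spaceDir i) ψ p with ha
  set b : Fin d → Fin d → ℝ := fun i j => dirDeriv (spaceDir j) (dirDeriv (spaceDir i) ψ) p with hb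
  set s : Fin d → ℝ := fun i => a i / softAbs σ (a i) with hs
  have hs1 : ∀ i, |s i| ≤ 1 := fun i => abs_div_softAbs_le hσ _
  set P : Matrix (Fin d) (Fin d) ℝ := (ε ^ 2 / f ^ 3 / 2) • Matrix.vecMulVec a a +
    κ • ∑ i, (σ ^ 2 / softAbs σ (a i) ^ 3) • Matrix.vecMulVec (b i) (b i) with hPdef
  have hF : ∀ i, 0 < softAbs σ (a i) := fun i => softAbs_pos hσ _
  have hP : P.PosSemidef := by
    have h1 : ∀ x : Fin d → ℝ, (Matrix.vecMulVec x x).PosSemidef := fun x => by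
      simpa using Matrix.posSemidef_vecMulVec_self_star x
    refine ((h1 a).smul (by positivity)).add (Matrix.PosSemidef.smul ?_ hκ)
    refine Matrix.posSemidef_sum _ fun i _ => (h1 _).smul ?_
    have := hF i
    positivity
  have hPtr : P.trace = ε ^ 2 / f ^ 3 / 2 * ∑ i, a i ^ 2 +
      κ * ∑ i, σ ^ 2 / softAbs σ (a i) ^ 3 * ∑ j, b i j ^ 2 := by
    rw [hPdef, Matrix.trace_add, Matrix.trace_smul, Matrix.trace_smul, Matrix.trace_sum]
    simp only [Matrix.trace_smul, Matrix.trace_vecMulVec, dotProduct, smul_eq_mul, pow_two]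
  set w := regMax ε σ κ v φ with hw
  have hws : ContDiff ℝ ∞ w := contDiff_regMax hε hσ κ hv hφ
  have hf3 : ∀ i, ContDiff ℝ ∞ (dirDeriv (spaceDir (d := d) i) ψ) := fun i => hψs.dirDeriv _
  have hw0 : w p - ((1 - θ) * v p + θ * φ p) =
      1 / 2 * (ε ^ 2 / f) + κ * ∑ i, softAbs σ (a i) := by
    have h1 : ε ^ 2 / f = f - ψ p * (ψ p / f) := by
      field_simp
      linear_combination -hfsq
    rw [h1, hw, regMax, ← hψ, ← hψp, ← hf, hθ]
    linear_combination (1 / 2 * (ψ p / f)) * hψp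
  have hw1 : ∀ u, dirDeriv u w p = (1 - θ) * dirDeriv u v p + θ * dirDeriv u φ p +
      κ * ∑ i, s i * dirDeriv u (dirDeriv (spaceDir i) ψ) p := by
    intro u
    have e0 : (fun p => softAbs ε (φ p - v p)) = fun p => softAbs ε (ψ p) := by rw [hψ]
    rw [hw, dirDeriv_regMax hε hσ κ hv hφ, e0, ← hψ]
    simp only [dirDeriv_softAbs hψs hε, dirDeriv_softAbs (hf3 _) hσ]
    rw [← hf, hψ1 u, hθ]
    ring
  have hw2 : ∀ i j, spHess w p i j - ((1 - θ) * spHess v p i j + θ * spHess φ p i j + P i j) =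
      κ * ∑ k, s k *
        dirDeriv (spaceDir i) (dirDeriv (spaceDir j) (dirDeriv (spaceDir k) ψ)) p := by
    intro i j
    have e0 : (fun p => softAbs ε (φ p - v p)) = fun p => softAbs ε (ψ p) := by rw [hψ]
    simp only [spHess, Matrix.of_apply]
    rw [hw, dirDeriv_dirDeriv_regMax hε hσ κ hv hφ, e0, ← hψ]
    simp only [dirDeriv_dirDeriv_softAbs hψs hε, dirDeriv_dirDeriv_softAbs (hf3 _) hσ]
    rw [← hf, hψ2, hPdef, Finset.sum_add_distrib]
    simp only [Matrix.add_apply, Matrix.smul_apply, Matrix.sum_apply, Matrix.vecMulVec_apply,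
      smul_eq_mul]
    rw [hθ]
    ring
  have key := H.le_blend hp (y₁ := v p) (y₂ := φ p) (y := w p) (z₁ := spGrad v p)
    (z₂ := spGrad φ p) (z := spGrad w p) (spHess_isSymm hv p) (spHess_isSymm hφ p)
    (spHess_isSymm hws p) hP hθ0 hθ1
  have k0 : |φ p - v p| = |ψ p| := by rw [hψp]
  have k1 : ∀ i, spGrad φ p i - spGrad v p i = a i := fun i => (hψ1 _).symm
  have k2 : ∀ i j, spHess φ p i j - spHess v p i j = b i j := fun i j => by
    change _ = dirDeriv (spaceDir j) (dirDeriv (spaceDir i) ψ) p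
    rw [dirDeriv_comm hψs]
    exact (hψ2 _ _).symm
  have k3 : ∀ i, spGrad w p i - ((1 - θ) * spGrad v p i + θ * spGrad φ p i) =
      κ * ∑ k, s k * dirDeriv (spaceDir i) (dirDeriv (spaceDir k) ψ) p := fun i => by
    simp only [spGrad]
    rw [hw1]
    ring
  simp only [k0, k1, k2, k3, hw2, hPtr, hw0] at key
  have r0 : |1 / 2 * (ε ^ 2 / f) + κ * ∑ i, softAbs σ (a i)| ≤ ε + κ * ∑ i, (1 + |a i|) := by
    have h1 : ε ^ 2 / f ≤ ε := by
      rw [div_le_iff₀ hfp, pow_two]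
      refine mul_le_mul_of_nonneg_left ?_ hε.le
      apply le_of_sq_le_sq _ hfp.le
      nlinarith [sq_nonneg (ψ p)]
    have h2 : 0 ≤ ε ^ 2 / f := by positivity
    have h3 : ∑ i, softAbs σ (a i) ≤ ∑ i, (1 + |a i|) := Finset.sum_le_sum fun i _ =>
      (softAbs_le hσ _).trans (by linarith)
    have h4 : 0 ≤ κ * ∑ i, softAbs σ (a i) :=
      mul_nonneg hκ (Finset.sum_nonneg fun i _ => (hF i).le)
    rw [abs_of_nonneg (by positivity)]
    have := mul_le_mul_of_nonneg_left h3 hκ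
    linarith
  have r1 : ∑ i, |κ * ∑ k, s k * dirDeriv (spaceDir i) (dirDeriv (spaceDir k) ψ) p| ≤
      κ * ∑ i, ∑ k, |dirDeriv (spaceDir i) (dirDeriv (spaceDir k) ψ) p| := by
    rw [Finset.mul_sum]
    exact Finset.sum_le_sum fun i _ => abs_const_mul_sum_le _ hκ hs1
  have r2 : ∑ i, ∑ j, |κ * ∑ k, s k *
        dirDeriv (spaceDir i) (dirDeriv (spaceDir j) (dirDeriv (spaceDir k) ψ)) p| ≤
      κ * ∑ i, ∑ j, ∑ k,
        |dirDeriv (spaceDir i) (dirDeriv (spaceDir j) (dirDeriv (spaceDir k) ψ)) p| := by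
    rw [Finset.mul_sum]
    refine Finset.sum_le_sum fun i _ => ?_
    rw [Finset.mul_sum]
    exact Finset.sum_le_sum fun j _ => abs_const_mul_sum_le _ hκ hs1
  have r3 := (abs_le.1 (abs_const_mul_sum_le Finset.univ hκ hs1
    (t := fun i => dirDeriv (timeDir d) (dirDeriv (spaceDir i) ψ) p))).1
  have hE : κ * correctorBound ψ p =
      κ * ∑ i, |dirDeriv (timeDir d) (dirDeriv (spaceDir i) ψ) p| + κ * ∑ i, (1 + |a i|) +
      κ * (∑ j, ∑ i, |dirDeriv (spaceDir j) (dirDeriv (spaceDir i) ψ) p|) +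
      κ * ∑ j, ∑ k, ∑ i,
        |dirDeriv (spaceDir j) (dirDeriv (spaceDir k) (dirDeriv (spaceDir i) ψ)) p| := by
    rw [correctorBound]; ring
  have r4 : 0 ≤ κ * ∑ i, |dirDeriv (timeDir d) (dirDeriv (spaceDir i) ψ) p| := by positivity
  have r5 := mul_le_mul_of_nonneg_left (add_le_add (add_le_add r0 r1) r2) H.L_nonneg
  have r6 : κ * ∑ i, |dirDeriv (timeDir d) (dirDeriv (spaceDir i) ψ) p| ≤
      ε + κ * correctorBound ψ p := by
    have h1 : 0 ≤ κ * ∑ i, (1 + |a i|) := by positivity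
    have h2 : 0 ≤ κ * (∑ j, ∑ i, |dirDeriv (spaceDir j) (dirDeriv (spaceDir i) ψ) p|) := by
      positivity
    have h3 : 0 ≤ κ * ∑ j, ∑ k, ∑ i,
        |dirDeriv (spaceDir j) (dirDeriv (spaceDir k) (dirDeriv (spaceDir i) ψ)) p| := by
      positivity
    linarith only [h1, h2, h3, hE, hε]
  have r7 := mul_nonneg H.L_nonneg r4
  have hLE : L * (κ * correctorBound ψ p) = L * (κ * ∑ i,
      |dirDeriv (timeDir d) (dirDeriv (spaceDir i) ψ) p|) + L * (κ * ∑ i, (1 + |a i|)) +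
      L * (κ * (∑ j, ∑ i, |dirDeriv (spaceDir j) (dirDeriv (spaceDir i) ψ) p|)) +
      L * (κ * ∑ j, ∑ k, ∑ i,
        |dirDeriv (spaceDir j) (dirDeriv (spaceDir k) (dirDeriv (spaceDir i) ψ)) p|) := by
    rw [hE]; ring
  simp only [parabOp]
  rw [hw1]
  linarith only [key, r5, r6, r7, r3, hLE]

lemma IsCompact.exists_pos_le {X : Type*} [TopologicalSpace X] {K : Set X} (hK : IsCompact K)
    {f : X → ℝ} (hf : ContinuousOn f K) (hpos : ∀ x ∈ K, 0 < f x) :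
    ∃ κ > 0, ∀ x ∈ K, κ ≤ f x := by
  rcases K.eq_empty_or_nonempty with rfl | hne
  · exact ⟨1, one_pos, by simp⟩
  · obtain ⟨x, hx, hmin⟩ := hK.exists_isMinOn hne hf
    exact ⟨f x, hpos x hx, fun y hy => hmin hy⟩

set_option maxHeartbeats 800000 in
/-- A strict subsolution can be raised above a smooth function which satisfies the strict
subsolution inequality where it is not much smaller. -/
lemma IsStrictSubsol.exists_ge_max {T : ℝ} {g : Nonlinearity d} {h : Spacetime d → ℝ} {L c : ℝ}
    (H : ParabolicData d T g h L c) {v φ : Spacetime d → ℝ} (hv : IsStrictSubsol T g h v)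
    (hφ : ContDiff ℝ ∞ φ) {δ : ℝ} (hδ : 0 < δ)
    (hpos : ∀ p ∈ cylQbar d T, v p - δ ≤ φ p → 0 < parabOp g φ p)
    (hlt : ∀ p ∈ cylBdry d T, φ p < h p) :
    ∃ w, IsStrictSubsol T g h w ∧ ∀ p, max (v p) (φ p) ≤ w p := by
  have hvs := hv.smooth
  have hbd := isCompact_cylBdry (d := d) H.T_pos
  obtain ⟨κ₁, hκ₁, hv1⟩ := (isCompact_cylQbar d T).exists_pos_le
    (H.continuousOn_parabOp hvs) hv.pos
  have hsub : cylQbar d T ∩ {p | v p - δ ≤ φ p} ⊆ cylQbar d T := inter_subset_left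
  have hclosed : IsClosed {p | v p - δ ≤ φ p} :=
    isClosed_le (by have := hvs.continuous; fun_prop) hφ.continuous
  obtain ⟨κ₂, hκ₂, hφ1⟩ := ((isCompact_cylQbar d T).inter_right hclosed).exists_pos_le
    ((H.continuousOn_parabOp hφ).mono hsub) (fun p hp => hpos p hp.1 hp.2)
  obtain ⟨κ₃, hκ₃, hv2⟩ := hbd.exists_pos_le (H.cont_h.sub hvs.continuous.continuousOn)
    (fun p hp => sub_pos.2 (hv.lt p hp))
  obtain ⟨κ₄, hκ₄, hφ2⟩ := hbd.exists_pos_le (H.cont_h.sub hφ.continuous.continuousOn)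
    (fun p hp => sub_pos.2 (hlt p hp))
  obtain ⟨κ₀, hκ₀, h1, h2, h3, h4⟩ : ∃ κ₀ > 0, κ₀ ≤ κ₁ ∧ κ₀ ≤ κ₂ ∧ κ₀ ≤ κ₃ ∧ κ₀ ≤ κ₄ :=
    ⟨min (min κ₁ κ₂) (min κ₃ κ₄), by positivity, by simp, by simp, by simp, by simp⟩
  set ψ : Spacetime d → ℝ := fun q => φ q - v q with hψ
  have hψs : ContDiff ℝ ∞ ψ := hφ.sub hvs
  set Φ : Spacetime d → ℝ := fun p => |ψ p| + |parabOp g φ p| + correctorBound ψ p with hΦ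
  have hΦc : ContinuousOn Φ (cylQbar d T) :=
    ((continuous_abs.comp hψs.continuous).continuousOn.add
      (H.continuousOn_parabOp hφ).abs).add (continuous_correctorBound hψs).continuousOn
  obtain ⟨C, hC⟩ := (isCompact_cylQbar d T).exists_bound_of_continuousOn hΦc
  have hbound : ∀ p ∈ cylQbar d T, |ψ p| + |parabOp g φ p| + correctorBound ψ p ≤ C :=
    fun p hp => (le_abs_self _).trans (hC p hp)
  have hC0 : 0 ≤ C := by
    have : ((0, 0) : Spacetime d) ∈ cylQbar d T := ⟨⟨le_rfl, H.T_pos.le⟩, by simp⟩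
    exact (norm_nonneg _).trans (hC _ this)
  obtain ⟨κ, hκ, σ, hσ, ε, hε, hσ1, herr, hpar⟩ :=
    exists_smoothing_parameters d hκ₀ hδ hC0 H.L_nonneg H.c_pos
  have hsum : ∀ p, ∑ i, (1 + |dirDeriv (spaceDir i) ψ p|) ≤ correctorBound ψ p := by
    intro p
    have h1 : 0 ≤ ∑ i, |dirDeriv (timeDir d) (dirDeriv (spaceDir i) ψ) p| := by positivity
    have h2 : 0 ≤ ∑ j, ∑ i, |dirDeriv (spaceDir j) (dirDeriv (spaceDir i) ψ) p| := by positivity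
    have h3 : 0 ≤ ∑ j, ∑ k, ∑ i,
        |dirDeriv (spaceDir j) (dirDeriv (spaceDir k) (dirDeriv (spaceDir i) ψ)) p| := by
      positivity
    rw [correctorBound]
    linarith
  have hsum2 : ∀ p, ∑ j, ∑ i, |dirDeriv (spaceDir j) (dirDeriv (spaceDir i) ψ) p| ≤
      correctorBound ψ p := by
    intro p
    have h1 : 0 ≤ ∑ i, |dirDeriv (timeDir d) (dirDeriv (spaceDir i) ψ) p| := by positivity
    have h2 : 0 ≤ ∑ i, (1 + |dirDeriv (spaceDir i) ψ p|) := by positivity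
    have h3 : 0 ≤ ∑ j, ∑ k, ∑ i,
        |dirDeriv (spaceDir j) (dirDeriv (spaceDir k) (dirDeriv (spaceDir i) ψ)) p| := by
      positivity
    rw [correctorBound]
    linarith
  refine ⟨regMax ε σ κ v φ, ⟨contDiff_regMax hε hσ κ hvs hφ, fun p hp => ?_, fun p hp => ?_⟩,
    max_le_regMax ε hσ hκ.le⟩
  · have hb := hbound p hp
    have hcb := correctorBound_nonneg ψ p
    have hle := H.le_parabOp_regMax hp hε hσ hσ1 hκ.le hvs hφ hψ rfl
    refine lt_of_lt_of_le ?_ hle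
    have h5 : (1 + L) * (ε + κ * correctorBound ψ p) ≤ (1 + L) * (ε + κ * C) := by
      have : correctorBound ψ p ≤ C := by
        linarith [abs_nonneg (ψ p), abs_nonneg (parabOp g φ p)]
      have := H.L_nonneg
      gcongr
    have := hpar (ψ p) (parabOp g v p) (parabOp g φ p) (fun i => dirDeriv (spaceDir i) ψ p)
      (fun i j => dirDeriv (spaceDir j) (dirDeriv (spaceDir i) ψ) p)
      (by linarith [abs_nonneg (parabOp g φ p)]) (fun i => ?_) (fun i j => ?_)
      (h1.trans (hv1 p hp)) (by linarith [neg_abs_le (parabOp g φ p), abs_nonneg (ψ p)])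
      (fun hs => h2.trans (hφ1 p ⟨hp, by
        simp only [hψ] at hs
        simp only [mem_ofPred_eq]
        linarith⟩))
    · linarith
    · have h6 := Finset.single_le_sum (f := fun i => 1 + |dirDeriv (spaceDir i) ψ p|)
        (fun i _ => by positivity) (Finset.mem_univ i)
      have h7 := hsum p
      linarith [abs_nonneg (ψ p), abs_nonneg (parabOp g φ p)]
    · have h6 := Finset.single_le_sum
        (f := fun j => ∑ i, |dirDeriv (spaceDir j) (dirDeriv (spaceDir i) ψ) p|)
        (fun i _ => by positivity) (Finset.mem_univ j)
      have h8 := Finset.single_le_sum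
        (f := fun i => |dirDeriv (spaceDir j) (dirDeriv (spaceDir i) ψ) p|)
        (fun i _ => by positivity) (Finset.mem_univ i)
      have h7 := hsum2 p
      linarith [abs_nonneg (ψ p), abs_nonneg (parabOp g φ p)]
  · have hpQ := cylBdry_subset_cylQbar H.T_pos hp
    have hb := hbound p hpQ
    have e1 : ∑ i, softAbs σ (dirDeriv (spaceDir i) ψ p) ≤ C := by
      calc _ ≤ ∑ i, (1 + |dirDeriv (spaceDir i) ψ p|) :=
            Finset.sum_le_sum fun i _ => (softAbs_le hσ _).trans (by linarith)
        _ ≤ correctorBound ψ p := hsum p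
        _ ≤ C := by linarith [abs_nonneg (ψ p), abs_nonneg (parabOp g φ p)]
    have e2 : κ₃ ≤ h p - v p := hv2 p hp
    have e3 : κ₄ ≤ h p - φ p := hφ2 p hp
    have e4 := regMax_le (σ := σ) hε hκ.le (m := h p - κ₀) p e1
      (by linarith only [e2, h3]) (by linarith only [e3, h4])
    have e5 : ε + κ * C ≤ (1 + L) * (ε + κ * C) :=
      le_mul_of_one_le_left (by positivity) (by linarith only [H.L_nonneg])
    linarith only [e4, e5, herr]

lemma IsStrictSubsol.exists_ge_sup {T : ℝ} {g : Nonlinearity d} {h : Spacetime d → ℝ} {L c : ℝ}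
    (H : ParabolicData d T g h L c) {v w : Spacetime d → ℝ} (hv : IsStrictSubsol T g h v)
    (hw : IsStrictSubsol T g h w) : ∃ u, IsStrictSubsol T g h u ∧ ∀ p, max (v p) (w p) ≤ u p :=
  hv.exists_ge_max H hw.smooth one_pos (fun p hp _ => hw.pos p hp) hw.lt

variable {T : ℝ} {g : Nonlinearity d} {h : Spacetime d → ℝ} {L c : ℝ}

lemma Matrix.PosSemidef.isSymm {P : Matrix (Fin d) (Fin d) ℝ} (hP : P.PosSemidef) : P.IsSymm := by
  have := hP.isHermitian
  rwa [Matrix.IsHermitian, Matrix.conjTranspose_eq_transpose_of_trivial] at this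

lemma ParabolicData.le_of_posSemidef (H : ParabolicData d T g h L c) {p : Spacetime d}
    (hp : p ∈ cylQbar d T) {y : ℝ} {z : EuclideanSpace ℝ (Fin d)}
    {M P : Matrix (Fin d) (Fin d) ℝ} (hM : M.IsSymm) (hP : P.PosSemidef) :
    g p.1 p.2 0 0 0 - L * (|y| + ∑ i, |z i| + ∑ i, ∑ j, |M i j - P i j|) + c * P.trace ≤
      g p.1 p.2 y z M := by
  have h1 := (abs_le.1 (H.lip p hp y 0 z 0 M P hM hP.isSymm)).1
  have h2 := H.ell p hp 0 0 P 0 hP.isSymm Matrix.isSymm_zero (by simpa using hP)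
  simp only [sub_zero, PiLp.zero_apply] at h1 h2
  linarith

lemma ParabolicData.exists_bound_zero (H : ParabolicData d T g h L c) :
    ∃ C, ∀ p ∈ cylQbar d T, |g p.1 p.2 0 0 0| ≤ C := by
  have hc : ContinuousOn (fun p : Spacetime d => g p.1 p.2 0 0 0) (cylQbar d T) := by
    have hm : Continuous fun p : Spacetime d =>
        (p.1, p.2, (0 : ℝ), (0 : EuclideanSpace ℝ (Fin d)), (0 : Matrix (Fin d) (Fin d) ℝ)) := by
      fun_prop
    refine H.cont_g.comp hm.continuousOn ?_
    rintro p ⟨h1, h2⟩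
    exact ⟨h1, h2, mem_univ _, mem_univ _, Matrix.isSymm_zero⟩
  exact (isCompact_cylQbar d T).exists_bound_of_continuousOn hc

/-- A barrier function at a boundary point gives strict subsolutions attaining almost the boundary
value there. -/
lemma ParabolicData.exists_strictSubsol_of_barrier (H : ParabolicData d T g h L c)
    {p₀ : Spacetime d} {B : Spacetime d → ℝ} (hB : ContDiff ℝ ∞ B)
    (hB0 : B p₀ = 0) (hBpos : ∀ p ∈ cylBdry d T, p ≠ p₀ → 0 < B p)
    (hop : ∀ p ∈ cylQbar d T, ∃ P : Matrix (Fin d) (Fin d) ℝ, P.PosSemidef ∧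
      1 ≤ -dirDeriv (timeDir d) B p - L * (|B p| + ∑ i, |dirDeriv (spaceDir i) B p| +
        ∑ i, ∑ j, |dirDeriv (spaceDir i) (dirDeriv (spaceDir j) B) p + P i j|) + c * P.trace)
    {ε : ℝ} (hε : 0 < ε) : ∃ v, IsStrictSubsol T g h v ∧ h p₀ - ε ≤ v p₀ := by
  obtain ⟨C, hC⟩ := H.exists_bound_zero
  obtain ⟨M, hM⟩ := H.bdd
  set f : Spacetime d → ℝ := fun p => h p - (h p₀ - ε) with hf
  have hfc : ContinuousOn f (cylBdry d T) := H.cont_h.sub continuousOn_const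
  have hbd := isCompact_cylBdry (d := d) H.T_pos
  have hS : IsCompact (cylBdry d T ∩ f ⁻¹' Iic 0) :=
    hbd.of_isClosed_subset (hfc.preimage_isClosed_of_isClosed hbd.isClosed isClosed_Iic)
      inter_subset_left
  obtain ⟨β, hβ, hβB⟩ := hS.exists_pos_le hB.continuous.continuousOn (fun p hp => by
    refine hBpos p hp.1 ?_
    rintro rfl
    have := hp.2
    simp only [hf, mem_preimage, mem_Iic] at this
    linarith)
  set y₀ := h p₀ - ε with hy0
  set K := |C| + L * |y₀| + 1 + (|M| + |y₀| + 1) / β with hK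
  have hL := H.L_nonneg
  have hKpos : 0 < K := by positivity
  set w : Spacetime d → ℝ := fun p => y₀ + (-K) * B p with hw
  have hws : ContDiff ℝ ∞ w := by fun_prop
  have hw1 : ∀ u, dirDeriv u w = fun p => -K * dirDeriv u B p := fun u => by
    rw [hw, dirDeriv_add contDiff_const (by fun_prop), dirDeriv_const, dirDeriv_const_mul hB]
    simp
  have hw2 : ∀ u u', dirDeriv u (dirDeriv u' w) = fun p => -K * dirDeriv u (dirDeriv u' B) p :=
    fun u u' => by rw [hw1, dirDeriv_const_mul (hB.dirDeriv _)]
  refine ⟨w, ⟨hws, fun p hp => ?_, fun p hp => ?_⟩, by simp [hw, hB0]⟩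
  · obtain ⟨P, hP, hle⟩ := hop p hp
    have h1 := H.le_of_posSemidef hp (y := w p) (z := spGrad w p) (spHess_isSymm hws p)
      (hP.smul hKpos.le)
    have h2 : |w p| ≤ |y₀| + K * |B p| := by
      refine (abs_add_le _ _).trans ?_
      rw [abs_mul, abs_neg, abs_of_pos hKpos]
    have h3 : ∀ i, |spGrad w p i| = K * |dirDeriv (spaceDir i) B p| := fun i => by
      simp only [spGrad]
      rw [hw1, abs_mul, abs_neg, abs_of_pos hKpos]
    have h4 : ∀ i j, |spHess w p i j - (K • P) i j| =
        K * |dirDeriv (spaceDir i) (dirDeriv (spaceDir j) B) p + P i j| := fun i j => by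
      simp only [spHess, Matrix.of_apply, hw2, Matrix.smul_apply, smul_eq_mul]
      rw [← abs_of_pos hKpos, ← abs_mul, abs_of_pos hKpos, ← abs_neg]
      congr 1
      ring
    simp only [h3, h4, ← Finset.mul_sum, Matrix.trace_smul, smul_eq_mul] at h1
    have h5 := (abs_le.1 (hC p hp)).1
    have h6 := mul_le_mul_of_nonneg_left h2 hL
    have h7 := mul_le_mul_of_nonneg_left hle hKpos.le
    have h8 : 0 < (|M| + |y₀| + 1) / β := by positivity
    rw [parabOp, hw1]
    have h9 := le_abs_self C
    simp only [hK] at h7 ⊢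
    rw [← hK] at h7 ⊢
    linarith only [h1, h5, h6, h7, h8, h9, hK]
  · have hBnn : 0 ≤ B p := by
      by_cases hpp : p = p₀
      · rw [hpp, hB0]
      · exact (hBpos p hp hpp).le
    have hKB : 0 ≤ K * B p := by positivity
    by_cases hfp : f p ≤ 0
    · have h1 := hβB p ⟨hp, hfp⟩
      have h2 : (|M| + |y₀| + 1) ≤ K * B p := by
        calc |M| + |y₀| + 1 = (|M| + |y₀| + 1) / β * β := by field_simp
          _ ≤ K * B p := by
            gcongr
            have : 0 ≤ |C| + L * |y₀| + 1 := by positivity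
            linarith
      have h3 := (abs_le.1 (hM p hp)).1
      simp only [hw]
      linarith [le_abs_self M, le_abs_self y₀]
    · push Not at hfp
      simp only [hw, hf] at hfp ⊢
      linarith

section DirectionalDerivative

variable {V : Type*} [NormedAddCommGroup V] [NormedSpace ℝ V]

lemma dirDeriv_comp_clm {G G' : ℝ → ℝ} (hG : ∀ s, HasDerivAt G (G' s) s) (A : V →L[ℝ] ℝ) (v : V) :
    dirDeriv v (fun p => G (A p)) = fun p => A v * G' (A p) := by
  rw [dirDeriv_comp hG A.contDiff v]
  funext p
  rw [show dirDeriv v (fun p => A p) = _ from dirDeriv_clm A v, mul_comm]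

end DirectionalDerivative

/-- The time coordinate. -/
noncomputable def timeCoord (d : ℕ) : Spacetime d →L[ℝ] ℝ := ContinuousLinearMap.fst ℝ ℝ _

/-- The inner product of the position with a given vector. -/
noncomputable def spaceInner (a : EuclideanSpace ℝ (Fin d)) : Spacetime d →L[ℝ] ℝ :=
  (innerSL ℝ a).comp (ContinuousLinearMap.snd ℝ ℝ _)

lemma timeCoord_apply (p : Spacetime d) : timeCoord d p = p.1 := rfl

lemma spaceInner_apply (a : EuclideanSpace ℝ (Fin d)) (p : Spacetime d) :
    spaceInner a p = inner ℝ a p.2 := rfl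

@[simp] lemma timeCoord_timeDir : timeCoord d (timeDir d) = 1 := rfl

@[simp] lemma timeCoord_spaceDir (i : Fin d) : timeCoord d (spaceDir i) = 0 := rfl

@[simp] lemma spaceInner_timeDir (a : EuclideanSpace ℝ (Fin d)) : spaceInner a (timeDir d) = 0 := by
  simp [timeDir, spaceInner_apply]

@[simp] lemma spaceInner_spaceDir (a : EuclideanSpace ℝ (Fin d)) (i : Fin d) :
    spaceInner a (spaceDir i) = a i := by
  simp [spaceDir, spaceInner_apply, EuclideanSpace.inner_single_right]

lemma abs_apply_le_one {x : EuclideanSpace ℝ (Fin d)} (hx : x ∈ Metric.closedBall 0 1) (i : Fin d) :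
    |x i| ≤ 1 :=
  (PiLp.norm_apply_le x i).trans (by simpa using hx)

lemma ParabolicData.exists_strictSubsol_terminal (H : ParabolicData d T g h L c)
    {x₀ : EuclideanSpace ℝ (Fin d)} (hx₀ : x₀ ∈ Metric.closedBall 0 1) {ε : ℝ} (hε : 0 < ε) :
    ∃ v, IsStrictSubsol T g h v ∧ h (T, x₀) - ε ≤ v (T, x₀) := by
  have hL := H.L_nonneg
  set M := L + 10 * d * L + 1 with hM
  set G : ℝ → ℝ := fun s => Real.exp (M * (T - s)) - 1 with hG
  set G' : ℝ → ℝ := fun s => -M * Real.exp (M * (T - s)) with hG'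
  have hGd : ∀ s, HasDerivAt G (G' s) s := fun s => by
    have := (((hasDerivAt_id s).const_sub T).const_mul M).exp.sub_const 1
    refine this.congr_deriv ?_
    simp only [hG', id]
    ring
  set S : Fin d → ℝ → ℝ := fun i s => (s - x₀ i) ^ 2 with hS
  have hSd : ∀ i s, HasDerivAt (S i) (2 * (s - x₀ i)) s := fun i s => by
    refine (((hasDerivAt_id s).sub_const (x₀ i)).pow 2).congr_deriv ?_
    simp
  have hSdd : ∀ i s, HasDerivAt (fun s => 2 * (s - x₀ i)) 2 s := fun i s => by
    refine (((hasDerivAt_id s).sub_const (x₀ i)).const_mul 2).congr_deriv ?_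
    simp
  set e : Fin d → Spacetime d →L[ℝ] ℝ := fun i => spaceInner (EuclideanSpace.single i 1) with he
  have hGs : ContDiff ℝ ∞ fun p : Spacetime d => G (timeCoord d p) := by
    simp only [hG]; fun_prop
  have hSs : ∀ i, ContDiff ℝ ∞ fun p : Spacetime d => S i (e i p) := fun i => by
    simp only [hS]; fun_prop
  have hSs' : ContDiff ℝ ∞ fun p : Spacetime d => ∑ i, S i (e i p) :=
    ContDiff.sum fun i _ => hSs i
  set B : Spacetime d → ℝ := fun p => G (timeCoord d p) + ∑ i, S i (e i p) with hB
  have hB1 : ∀ u, dirDeriv u B = fun p => timeCoord d u * G' (timeCoord d p) +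
      ∑ i, e i u * (2 * (e i p - x₀ i)) := fun u => by
    rw [hB, dirDeriv_add hGs hSs', dirDeriv_sum hSs, dirDeriv_comp_clm hGd]
    simp only [dirDeriv_comp_clm (hSd _)]
  have het : ∀ i, e i (timeDir d) = 0 := fun i => by simp [he]
  have hes : ∀ i j, e i (spaceDir j) = if j = i then 1 else 0 := fun i j => by
    simp only [he, spaceInner_spaceDir, PiLp.single_apply]
  have hBt : ∀ p, dirDeriv (timeDir d) B p = G' p.1 := fun p => by
    simp only [hB1, het, timeCoord_timeDir]
    simp [timeCoord_apply]
  have hBi : ∀ i, dirDeriv (spaceDir i) B = fun p => 2 * (e i p - x₀ i) := fun i => by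
    simp [hB1, hes]
  have hBij : ∀ i j p, dirDeriv (spaceDir i) (dirDeriv (spaceDir j) B) p =
      if i = j then 2 else 0 := fun i j p => by
    rw [hBi, dirDeriv_comp_clm (hSdd j), hes]
    simp
  have heap : ∀ i (p : Spacetime d), e i p = p.2 i := fun i p => by
    simp [he, spaceInner_apply, EuclideanSpace.inner_single_left]
  have hMnn : 0 ≤ M := by positivity
  refine H.exists_strictSubsol_of_barrier (B := B) (hGs.add hSs') ?_ (fun p hp hne => ?_)
    (fun p hp => ⟨0, Matrix.PosSemidef.zero, ?_⟩) hε
  · simp [hB, hG, hS, heap, timeCoord_apply]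
  · have hpT : p.1 ≤ T := (cylBdry_subset_cylQbar H.T_pos hp).1.2
    have h0 : 0 ≤ ∑ i, S i (e i p) := Finset.sum_nonneg fun i _ => sq_nonneg _
    have h1 : 0 ≤ G (timeCoord d p) := by
      simp only [hG, sub_nonneg, timeCoord_apply]
      exact Real.one_le_exp (mul_nonneg hMnn (by linarith))
    rcases hpT.lt_or_eq with hlt | heq
    · have : 0 < G (timeCoord d p) := by
        simp only [hG, sub_pos, timeCoord_apply]
        exact Real.one_lt_exp_iff.2 (mul_pos (by positivity) (by linarith))
      simp only [hB]
      linarith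
    · have : ∃ i, p.2 i ≠ x₀ i := by
        by_contra! hcon
        exact hne (Prod.ext heq (by ext i; exact hcon i))
      obtain ⟨i, hi⟩ := this
      have : 0 < ∑ i, S i (e i p) :=
        Finset.sum_pos' (fun i _ => sq_nonneg _)
          ⟨i, Finset.mem_univ _, by
            simp only [hS, heap]
            exact sq_pos_of_ne_zero (sub_ne_zero.2 hi)⟩
      simp only [hB]
      linarith
  · have hE : 1 ≤ Real.exp (M * (T - p.1)) :=
      Real.one_le_exp (mul_nonneg hMnn (by linarith [hp.1.2]))
    have hd2 : ∀ i, |p.2 i - x₀ i| ≤ 2 := fun i => by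
      have h1 := abs_le.1 (abs_apply_le_one hp.2 i)
      have h2 := abs_le.1 (abs_apply_le_one hx₀ i)
      rw [abs_le]; constructor <;> linarith
    have hsum0 : ∑ i, S i (e i p) ≤ d * 4 := by
      calc ∑ i, S i (e i p) ≤ ∑ _i : Fin d, (4 : ℝ) := by
            refine Finset.sum_le_sum fun i _ => ?_
            simp only [hS, heap]
            have := abs_le.1 (hd2 i)
            nlinarith
        _ = _ := by simp
    have hnn0 : 0 ≤ ∑ i, S i (e i p) := Finset.sum_nonneg fun i _ => sq_nonneg _
    have hBabs : |B p| ≤ Real.exp (M * (T - p.1)) - 1 + d * 4 := by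
      rw [abs_of_nonneg]
      · simp only [hB, hG, timeCoord_apply]; linarith
      · simp only [hB, hG, timeCoord_apply]; linarith
    have hsum1 : ∑ i, |dirDeriv (spaceDir i) B p| ≤ d * 4 := by
      calc _ ≤ ∑ _i : Fin d, (4 : ℝ) := by
            refine Finset.sum_le_sum fun i _ => ?_
            simp only [hBi, heap]
            rw [abs_mul, abs_two]
            linarith [hd2 i]
        _ = _ := by simp
    have hsum2 : ∑ i : Fin d, ∑ j : Fin d, |dirDeriv (spaceDir i) (dirDeriv (spaceDir j) B) p +
        (0 : Matrix (Fin d) (Fin d) ℝ) i j| = d * 2 := by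
      simp [hBij, apply_ite abs]
    rw [hsum2, hBt]
    simp only [hG', Matrix.trace_zero]
    have h3 : L * (|B p| + ∑ i, |dirDeriv (spaceDir i) B p| + d * 2) ≤
        L * (Real.exp (M * (T - p.1)) - 1 + d * 10) :=
      mul_le_mul_of_nonneg_left (by linarith) hL
    have h4 : M ≤ M * Real.exp (M * (T - p.1)) := le_mul_of_one_le_right hMnn hE
    have h5 : 0 ≤ (10 * d * L + 1) * (Real.exp (M * (T - p.1)) - 1) :=
      mul_nonneg (by positivity) (by linarith)
    have h6 : M * Real.exp (M * (T - p.1)) = L * Real.exp (M * (T - p.1)) + (10 * d * L + 1) * (Real.exp (M * (T - p.1)) - 1) + (10 * d * L + 1) := by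
      rw [hM]; ring
    linarith

lemma ParabolicData.exists_strictSubsol_lateral (H : ParabolicData d T g h L c)
    {t₀ : ℝ} (ht₀ : t₀ ∈ Icc 0 T)
    {x₀ : EuclideanSpace ℝ (Fin d)} (hx₀ : ‖x₀‖ = 1) {ε : ℝ} (hε : 0 < ε) :
    ∃ v, IsStrictSubsol T g h v ∧ h (t₀, x₀) - ε ≤ v (t₀, x₀) := by
  have hL := H.L_nonneg
  have hc := H.c_pos
  have hT := H.T_pos
  set N := (L * d + 1) / c with hN
  have hNpos : 0 < N := by positivity
  set K := (2 * T + L * T ^ 2 + 1) / (N * Real.exp (-(2 * N))) with hK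
  have hKpos : 0 < K := by positivity
  set G : ℝ → ℝ := fun s => K * Real.exp (L * (T - s)) + (s - t₀) ^ 2 with hG
  set G' : ℝ → ℝ := fun s => -L * K * Real.exp (L * (T - s)) + 2 * (s - t₀) with hG'
  have hGd : ∀ s, HasDerivAt G (G' s) s := fun s => by
    have h1 := (((hasDerivAt_id s).const_sub T).const_mul L).exp.const_mul K
    have h2 := ((hasDerivAt_id s).sub_const t₀).pow 2
    refine (h1.add h2).congr_deriv ?_
    simp only [hG', id]
    push_cast
    ring
  set E : ℝ → ℝ := fun s => -K * Real.exp (s + (L * T - N)) with hE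
  have hEd : ∀ s, HasDerivAt E (E s) s := fun s => by
    refine (((hasDerivAt_id s).add_const (L * T - N)).exp.const_mul (-K)).congr_deriv ?_
    simp [hE]
  set A : Spacetime d →L[ℝ] ℝ := N • spaceInner x₀ - L • timeCoord d with hA
  have hGs : ContDiff ℝ ∞ fun p : Spacetime d => G (timeCoord d p) := by
    simp only [hG]; fun_prop
  have hEs : ContDiff ℝ ∞ fun p : Spacetime d => E (A p) := by
    simp only [hE]; fun_prop
  set B : Spacetime d → ℝ := fun p => G (timeCoord d p) + E (A p) with hB
  have hB1 : ∀ u, dirDeriv u B = fun p => timeCoord d u * G' (timeCoord d p) +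
      A u * E (A p) := fun u => by
    rw [hB, dirDeriv_add hGs hEs, dirDeriv_comp_clm hGd, dirDeriv_comp_clm hEd]
  have hAt : A (timeDir d) = -L := by simp [hA]
  have hAs : ∀ i, A (spaceDir i) = N * x₀ i := fun i => by
    simp [hA]
  have hBt : ∀ p, dirDeriv (timeDir d) B p = G' p.1 - L * E (A p) := fun p => by
    simp only [hB1, hAt, timeCoord_timeDir]
    simp only [timeCoord_apply]
    ring
  have hBi : ∀ i, dirDeriv (spaceDir i) B = fun p => N * x₀ i * E (A p) := fun i => by
    simp [hB1, hAs]
  have hBij : ∀ i j p, dirDeriv (spaceDir i) (dirDeriv (spaceDir j) B) p =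
      N ^ 2 * (x₀ i * x₀ j) * E (A p) := fun i j p => by
    rw [hBi, dirDeriv_const_mul hEs, dirDeriv_comp_clm hEd, hAs]
    ring
  have hEA : ∀ p : Spacetime d, E (A p) =
      -K * Real.exp (L * (T - p.1) + N * (inner ℝ x₀ p.2 - 1)) := fun p => by
    simp only [hE, hA]
    congr 2
    simp [timeCoord_apply, spaceInner_apply]
    ring
  have hin : ∀ p ∈ cylQbar d T, inner ℝ x₀ p.2 ≤ 1 ∧ -1 ≤ inner ℝ x₀ p.2 := fun p hp => by
    have h1 := abs_real_inner_le_norm x₀ p.2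
    have h2 : ‖p.2‖ ≤ 1 := by simpa using hp.2
    rw [hx₀, one_mul] at h1
    have := abs_le.1 (h1.trans h2)
    exact ⟨this.2, this.1⟩
  have hEE : ∀ p ∈ cylQbar d T, Real.exp (L * (T - p.1) + N * (inner ℝ x₀ p.2 - 1)) ≤
      Real.exp (L * (T - p.1)) := fun p hp => by
    refine Real.exp_le_exp.2 ?_
    have := mul_nonneg hNpos.le (sub_nonneg.2 (hin p hp).1)
    linarith
  refine H.exists_strictSubsol_of_barrier (B := B) (hGs.add hEs) ?_ (fun p hp hne => ?_)
    (fun p hp => ⟨(K * N ^ 2 * Real.exp (L * (T - p.1) + N * (inner ℝ x₀ p.2 - 1))) •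
      Matrix.vecMulVec x₀ x₀, ?_, ?_⟩) hε
  · simp [hB, hG, hEA, hx₀, timeCoord_apply]
  · have hp' := cylBdry_subset_cylQbar hT hp
    simp only [hB, hG, hEA, timeCoord_apply]
    by_cases ht : p.1 = t₀
    · have hlt : inner ℝ x₀ p.2 < 1 := by
        refine lt_of_le_of_ne (hin p hp').1 fun heq => hne (Prod.ext ht ?_)
        have h2 : ‖p.2‖ ≤ 1 := by simpa using hp'.2
        have h3 := norm_sub_sq_real x₀ p.2
        rw [heq, hx₀] at h3
        have h4 : ‖x₀ - p.2‖ ^ 2 ≤ 0 := by nlinarith [norm_nonneg p.2]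
        have h5 : ‖x₀ - p.2‖ = 0 := by nlinarith [norm_nonneg (x₀ - p.2)]
        exact (sub_eq_zero.1 (norm_eq_zero.1 h5)).symm
      have : Real.exp (L * (T - p.1) + N * (inner ℝ x₀ p.2 - 1)) <
          Real.exp (L * (T - p.1)) := by
        refine Real.exp_lt_exp.2 ?_
        have := mul_pos hNpos (sub_pos.2 hlt)
        linarith
      have := mul_lt_mul_of_pos_left this hKpos
      linarith [sq_nonneg (p.1 - t₀)]
    · have h1 : 0 < (p.1 - t₀) ^ 2 := by
        have := sub_ne_zero.2 ht
        positivity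
      have := mul_le_mul_of_nonneg_left (hEE p hp') hKpos.le
      linarith
  · refine Matrix.PosSemidef.smul ?_ (by positivity)
    have := Matrix.posSemidef_vecMulVec_self_star (R := ℝ) (x₀ : Fin d → ℝ)
    simpa using this
  · have htr : (Matrix.vecMulVec x₀ x₀ : Matrix (Fin d) (Fin d) ℝ).trace = 1 := by
      have h1 := EuclideanSpace.real_norm_sq_eq x₀
      rw [hx₀] at h1
      simp only [Matrix.trace, Matrix.diag, Matrix.vecMulVec_apply]
      rw [← one_pow 2, h1]
      exact Finset.sum_congr rfl fun i _ => by ring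
    have hE1 := hEE p hp
    have hinp := hin p hp
    have hbi : ∑ i, |dirDeriv (spaceDir i) B p| ≤
        d * (N * (K * Real.exp (L * (T - p.1) + N * (inner ℝ x₀ p.2 - 1)))) := by
      calc _ ≤ ∑ _i : Fin d, (N * (K * Real.exp (L * (T - p.1) + N * (inner ℝ x₀ p.2 - 1)))) := by
            refine Finset.sum_le_sum fun i _ => ?_
            rw [hBi]
            simp only [hEA]
            rw [abs_mul, abs_mul, abs_mul, abs_neg, abs_of_pos hNpos, abs_of_pos hKpos,
              abs_of_pos (Real.exp_pos _)]
            have : |x₀ i| ≤ 1 := abs_apply_le_one (by simp [hx₀]) i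
            have h0 : 0 ≤ N * (K * Real.exp (L * (T - p.1) + N * (inner ℝ x₀ p.2 - 1))) := by
              positivity
            nlinarith
        _ = _ := by simp
    have hB2 : ∀ i j, dirDeriv (spaceDir i) (dirDeriv (spaceDir j) B) p +
        ((K * N ^ 2 * Real.exp (L * (T - p.1) + N * (inner ℝ x₀ p.2 - 1))) •
          Matrix.vecMulVec x₀ x₀ : Matrix (Fin d) (Fin d) ℝ) i j = 0 := fun i j => by
      rw [hBij, hEA, Matrix.smul_apply, Matrix.vecMulVec_apply, smul_eq_mul]
      ring
    simp only [hB2, abs_zero, Finset.sum_const_zero, add_zero]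
    rw [Matrix.trace_smul, htr, hBt, hEA]
    set X := Real.exp (L * (T - p.1) + N * (inner ℝ x₀ p.2 - 1)) with hX
    set Y := Real.exp (L * (T - p.1)) with hY
    have hpt : (p.1 - t₀) ^ 2 ≤ T ^ 2 := by
      have := hp.1.1; have := hp.1.2; have := ht₀.1; have := ht₀.2
      nlinarith
    have hKX := mul_le_mul_of_nonneg_left hE1 hKpos.le
    have hBa : |B p| ≤ K * Y - K * X + T ^ 2 := by
      have hBp : B p = K * Y - K * X + (p.1 - t₀) ^ 2 := by
        simp only [hB, hG, hEA, timeCoord_apply]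
        rw [← hX]
        simp only [hY]
        ring
      rw [hBp, abs_of_nonneg (by linarith [sq_nonneg (p.1 - t₀)])]
      linarith
    have hXle : Real.exp (-(2 * N)) ≤ X := by
      refine Real.exp_le_exp.2 ?_
      have h1 := mul_nonneg hL (sub_nonneg.2 hp.1.2)
      have h2 := mul_le_mul_of_nonneg_left hinp.2 hNpos.le
      linarith
    have hkey : 2 * T + L * T ^ 2 + 1 ≤ K * N * X := by
      calc 2 * T + L * T ^ 2 + 1 = K * N * Real.exp (-(2 * N)) := by
            rw [hK]; field_simp
        _ ≤ _ := by gcongr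
    have hcN : c * N = L * d + 1 := by rw [hN]; field_simp
    have h1 := mul_le_mul_of_nonneg_left (add_le_add hBa hbi) hL
    have hpt1 : p.1 - t₀ ≤ T := by linarith [hp.1.2, ht₀.1]
    have h2 : c * ((K * N ^ 2 * X) • (1 : ℝ)) = (L * d + 1) * (K * N * X) := by
      rw [← hcN, smul_eq_mul]; ring
    rw [h2]
    simp only [hG', ← hY]
    linarith only [h1, hkey, hpt1]

/-- Strict subsolutions approximate the boundary data. -/
lemma ParabolicData.exists_strictSubsol_bdry (H : ParabolicData d T g h L c) {p : Spacetime d}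
    (hp : p ∈ cylBdry d T) {ε : ℝ} (hε : 0 < ε) :
    ∃ v, IsStrictSubsol T g h v ∧ h p - ε ≤ v p := by
  obtain ⟨t, x⟩ := p
  rcases hp with ⟨h1, h2⟩ | ⟨h1, h2⟩
  · exact H.exists_strictSubsol_lateral h1 (by simpa using h2) hε
  · obtain rfl : t = T := h1
    exact H.exists_strictSubsol_terminal (Metric.ball_subset_closedBall h2) hε

lemma HasDerivAt.nonpos_of_le_right {f : ℝ → ℝ} {a t : ℝ} (hf : HasDerivAt f a t)
    (hle : ∀ᶠ s in 𝓝[>] t, f s ≤ f t) : a ≤ 0 := by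
  have h1 := (hasDerivWithinAt_iff_tendsto_slope' (by simp)).1 (hf.hasDerivWithinAt (s := Ioi t))
  refine le_of_tendsto h1 ?_
  filter_upwards [hle, self_mem_nhdsWithin] with s hs hst
  rw [slope_def_field]
  exact div_nonpos_of_nonpos_of_nonneg (by linarith) (sub_nonneg.2 (le_of_lt hst))

lemma IsLocalMax.second_deriv_nonpos {φ φ' : ℝ → ℝ} {a x : ℝ} (hmax : IsLocalMax φ x)
    (hφ : ∀ᶠ s in 𝓝 x, HasDerivAt φ (φ' s) s) (hφ' : HasDerivAt φ' a x) : a ≤ 0 := by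
  by_contra! ha
  have h1 : deriv φ =ᶠ[𝓝 x] φ' := hφ.mono fun s hs => hs.deriv
  have h2 : deriv (deriv φ) x = a := h1.deriv_eq.trans hφ'.deriv
  have hmin := isLocalMin_of_deriv_deriv_pos (by rwa [h2]) hmax.deriv_eq_zero
    hφ.self_of_nhds.continuousAt
  have h3 : φ =ᶠ[𝓝 x] fun _ => φ x := by
    filter_upwards [hmin, hmax] with s h4 h5 using le_antisymm h5 h4
  have h4 : deriv φ =ᶠ[𝓝 x] fun _ => 0 := h3.deriv.trans (by simp)
  rw [h4.deriv_eq, deriv_const] at h2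
  exact ha.ne h2

lemma inner_matCLM (M : Matrix (Fin d) (Fin d) ℝ) (v : EuclideanSpace ℝ (Fin d)) :
    inner ℝ (matCLM d M v) v = (v : Fin d → ℝ) ⬝ᵥ M.mulVec v := by
  simp [matCLM, PiLp.inner_apply, dotProduct, Matrix.ofLp_toEuclideanCLM]

lemma Matrix.PosSemidef.of_inner_nonneg {M : Matrix (Fin d) (Fin d) ℝ} (hM : M.IsSymm)
    (h : ∀ v, 0 ≤ inner ℝ (matCLM d M v) v) : M.PosSemidef := by
  refine .of_dotProduct_mulVec_nonneg ?_ fun x => ?_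
  · rwa [Matrix.IsHermitian, Matrix.conjTranspose_eq_transpose_of_trivial]
  · have := h (WithLp.toLp 2 x)
    rw [inner_matCLM] at this
    simpa using this

lemma Matrix.PosSemidef.trace_nonneg_real {M : Matrix (Fin d) (Fin d) ℝ} (hM : M.PosSemidef) :
    0 ≤ M.trace := hM.trace_nonneg

/-- Comparison of classical sub- and supersolutions. -/
theorem ParabolicData.classical_le (H : ParabolicData d T g h L c) {w₁ w₂ : Spacetime d → ℝ}
    (hw₁ : IsClassicalSubsol d T g h w₁) (hw₂ : IsClassicalSupersol d T g h w₂) :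
    ∀ p ∈ cylQbar d T, w₁ p ≤ w₂ p := by
  obtain ⟨wt₁, D₁, M₁, hc₁, -, -, -, hQ₁, hb₁⟩ := hw₁
  obtain ⟨wt₂, D₂, M₂, hc₂, -, -, -, hQ₂, hb₂⟩ := hw₂
  by_contra! hcon
  obtain ⟨q, hq, hlt⟩ := hcon
  have hfc : ContinuousOn (fun p : Spacetime d => Real.exp ((L + 1) * p.1) * (w₁ p - w₂ p))
      (cylQbar d T) :=
    (Continuous.continuousOn (by fun_prop)).mul (hc₁.sub hc₂)
  obtain ⟨p, hp, hmax⟩ := (isCompact_cylQbar d T).exists_isMaxOn ⟨q, hq⟩ hfc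
  have hDp : 0 < w₁ p - w₂ p := by
    have h1 : Real.exp ((L + 1) * q.1) * (w₁ q - w₂ q) ≤
      Real.exp ((L + 1) * p.1) * (w₁ p - w₂ p) := hmax hq
    have h2 : 0 < Real.exp ((L + 1) * q.1) * (w₁ q - w₂ q) :=
      mul_pos (Real.exp_pos _) (by linarith)
    exact pos_of_mul_pos_right (h2.trans_le h1) (Real.exp_pos _).le
  have hpQ : p ∈ cylQ d T := by
    refine (mem_cylQ_or_cylBdry hp).resolve_right fun hpb => ?_
    linarith [hb₁ p hpb, hb₂ p hpb]
  obtain ⟨ht₁, hg₁, hh₁, hs₁, he₁⟩ := hQ₁ p hpQ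
  obtain ⟨ht₂, hg₂, hh₂, hs₂, he₂⟩ := hQ₂ p hpQ
  have htime : wt₁ p - wt₂ p + (L + 1) * (w₁ p - w₂ p) ≤ 0 := by
    have hd := ((((hasDerivAt_id p.1).const_mul (L + 1)).exp).mul (ht₁.sub ht₂)).nonpos_of_le_right
      (by
        have : Ioo p.1 T ∈ 𝓝[>] p.1 := Ioo_mem_nhdsGT hpQ.1.2
        filter_upwards [this] with s hs
        exact hmax (show (s, p.2) ∈ cylQbar d T from ⟨⟨hp.1.1.trans hs.1.le, hs.2.le⟩, hp.2⟩))
    have hfac : Real.exp ((L + 1) * p.1) *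
        (wt₁ p - wt₂ p + (L + 1) * (w₁ p - w₂ p)) ≤ 0 := by
      refine le_trans (le_of_eq ?_) hd
      simp only [id, Pi.sub_apply]
      ring
    exact nonpos_of_mul_nonpos_right hfac (Real.exp_pos _)
  have hsp : ∀ x ∈ Metric.closedBall (0 : EuclideanSpace ℝ (Fin d)) 1,
      w₁ (p.1, x) - w₂ (p.1, x) ≤ w₁ p - w₂ p := fun x hx => by
    have h1 : Real.exp ((L + 1) * p.1) * (w₁ (p.1, x) - w₂ (p.1, x)) ≤
      Real.exp ((L + 1) * p.1) * (w₁ p - w₂ p) :=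
      hmax (show (p.1, x) ∈ cylQbar d T from ⟨hp.1, hx⟩)
    exact le_of_mul_le_mul_left h1 (Real.exp_pos _)
  have hball : ∀ᶠ x in 𝓝 p.2, x ∈ Metric.ball (0 : EuclideanSpace ℝ (Fin d)) 1 :=
    Metric.isOpen_ball.mem_nhds hpQ.2
  have hlm : IsLocalMax (fun x => w₁ (p.1, x) - w₂ (p.1, x)) p.2 := by
    filter_upwards [hball] with x hx using hsp x (Metric.ball_subset_closedBall hx)
  have hgrad : D₁ p = D₂ p := by
    have h1 := hlm.hasFDerivAt_eq_zero
      ((hasGradientAt_iff_hasFDerivAt.1 hg₁).sub (hasGradientAt_iff_hasFDerivAt.1 hg₂))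
    rw [← map_sub, map_eq_zero_iff _ (LinearIsometryEquiv.injective _), sub_eq_zero] at h1
    exact h1
  have hPSD : (M₂ p - M₁ p).PosSemidef := by
    refine .of_inner_nonneg (hs₂.sub hs₁) fun v => ?_
    have hline : ∀ s : ℝ, HasDerivAt (fun s : ℝ => p.2 + s • v) v s := fun s => by
      simpa using ((hasDerivAt_id s).smul_const v).const_add p.2
    have hcont : Tendsto (fun s : ℝ => p.2 + s • v) (𝓝 0) (𝓝 p.2) := by
      have : Continuous fun s : ℝ => p.2 + s • v := by fun_prop
      simpa using this.tendsto 0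
    have h0 : p.2 + (0 : ℝ) • v = p.2 := by simp
    have hlm' : IsLocalMax (fun s : ℝ => w₁ (p.1, p.2 + s • v) - w₂ (p.1, p.2 + s • v)) 0 := by
      have := hcont.eventually hlm
      simpa [IsLocalMax, IsMaxFilter] using this
    have hder : ∀ᶠ s in 𝓝 (0 : ℝ), HasDerivAt
        (fun s : ℝ => w₁ (p.1, p.2 + s • v) - w₂ (p.1, p.2 + s • v))
        (inner ℝ (D₁ (p.1, p.2 + s • v) - D₂ (p.1, p.2 + s • v)) v) s := by
      filter_upwards [hcont.eventually hball] with s hs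
      have hm : (p.1, p.2 + s • v) ∈ cylQ d T := ⟨hpQ.1, hs⟩
      have k1 := (hasGradientAt_iff_hasFDerivAt.1 (hQ₁ _ hm).2.1)
      have k2 := (hasGradientAt_iff_hasFDerivAt.1 (hQ₂ _ hm).2.1)
      refine ((k1.sub k2).comp_hasDerivAt s (hline s)).congr_deriv ?_
      simp [inner_sub_left]
    have hder2 : HasDerivAt
        (fun s : ℝ => inner ℝ (D₁ (p.1, p.2 + s • v) - D₂ (p.1, p.2 + s • v)) v)
        (inner ℝ (matCLM d (M₁ p) v - matCLM d (M₂ p) v) v) 0 := by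
      have k := (hh₁.sub hh₂)
      rw [← h0] at k
      have k' := (k.comp_hasDerivAt (0 : ℝ) (hline 0)).inner ℝ (hasDerivAt_const 0 v)
      refine k'.congr_deriv ?_
      simp
    have := hlm'.second_deriv_nonpos hder hder2
    have e : matCLM d (M₂ p - M₁ p) v = matCLM d (M₂ p) v - matCLM d (M₁ p) v := by
      simp [matCLM]
    rw [e]
    rw [inner_sub_left] at this ⊢
    linarith
  have hell := H.ell p hp (w₁ p) (D₁ p) (M₂ p) (M₁ p) hs₂ hs₁ hPSD
  have htr := mul_nonneg H.c_pos.le hPSD.trace_nonneg_real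
  have hlip := (abs_le.1 (H.lip p hp (w₁ p) (w₂ p) (D₁ p) (D₁ p) (M₂ p) (M₂ p) hs₂ hs₂)).2
  simp only [sub_self, abs_zero, Finset.sum_const_zero, add_zero, abs_of_pos hDp] at hlip
  rw [← hgrad] at he₂
  linarith

/-- The supremum of the strict smooth subsolutions. -/
noncomputable def lowerSol (T : ℝ) (g : Nonlinearity d) (h : Spacetime d → ℝ) (p : Spacetime d) :
    ℝ :=
  sSup {r | ∃ v, IsStrictSubsol T g h v ∧ r = v p}

lemma ParabolicData.exists_strictSubsol (H : ParabolicData d T g h L c) :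
    ∃ v, IsStrictSubsol T g h v := by
  obtain ⟨v, hv, -⟩ := H.exists_strictSubsol_bdry (p := (T, 0)) (Or.inr ⟨rfl, by simp⟩) one_pos
  exact ⟨v, hv⟩

lemma ParabolicData.exists_supersol (H : ParabolicData d T g h L c) :
    ∃ w, IsClassicalSupersol d T g h w := by
  obtain ⟨v, hv⟩ := H.reflect.exists_strictSubsol
  exact ⟨_, hv.isClassicalSubsol.neg_of_reflected⟩

lemma IsStrictSubsol.le_lowerSol (H : ParabolicData d T g h L c) {v : Spacetime d → ℝ}
    (hv : IsStrictSubsol T g h v) {p : Spacetime d} (hp : p ∈ cylQbar d T) :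
    v p ≤ lowerSol T g h p := by
  obtain ⟨w, hw⟩ := H.exists_supersol
  refine le_csSup ⟨w p, ?_⟩ ⟨v, hv, rfl⟩
  rintro r ⟨u, hu, rfl⟩
  exact H.classical_le hu.isClassicalSubsol hw p hp

lemma ParabolicData.exists_lt_of_lt_lowerSol (H : ParabolicData d T g h L c) {p : Spacetime d}
    {y : ℝ} (hy : y < lowerSol T g h p) : ∃ v, IsStrictSubsol T g h v ∧ y < v p := by
  obtain ⟨v, hv⟩ := H.exists_strictSubsol
  have hne : {r | ∃ v, IsStrictSubsol T g h v ∧ r = v p}.Nonempty := ⟨v p, v, hv, rfl⟩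
  obtain ⟨r, ⟨w, hw, rfl⟩, hr⟩ := exists_lt_of_lt_csSup hne hy
  exact ⟨w, hw, hr⟩

lemma ParabolicData.lowerSemicontinuousOn_lowerSol (H : ParabolicData d T g h L c) :
    LowerSemicontinuousOn (lowerSol T g h) (cylQbar d T) := by
  intro p _ y hy
  obtain ⟨v, hv, hlt⟩ := H.exists_lt_of_lt_lowerSol hy
  filter_upwards [self_mem_nhdsWithin,
    mem_nhdsWithin_of_mem_nhds (hv.smooth.continuous.continuousAt.eventually (lt_mem_nhds hlt))]
    with q hq hvq using hvq.trans_le (hv.le_lowerSol H hq)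

lemma ParabolicData.le_lowerSol_bdry (H : ParabolicData d T g h L c) {p : Spacetime d}
    (hp : p ∈ cylBdry d T) : h p ≤ lowerSol T g h p := by
  refine le_of_forall_pos_le_add fun ε hε => ?_
  obtain ⟨v, hv, hle⟩ := H.exists_strictSubsol_bdry hp hε
  linarith [hv.le_lowerSol H (cylBdry_subset_cylQbar H.T_pos hp)]

lemma ParabolicData.exists_strictSubsol_gt (H : ParabolicData d T g h L c) {K : Set (Spacetime d)}
    (hK : IsCompact K) {φ : Spacetime d → ℝ} (hφ : Continuous φ)
    (hlt : ∀ p ∈ K, φ p < lowerSol T g h p) :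
    ∃ v, IsStrictSubsol T g h v ∧ ∃ δ > 0, ∀ p ∈ K, φ p + δ < v p := by
  obtain ⟨v₀, hv₀⟩ := H.exists_strictSubsol
  let ι := {x : (Spacetime d → ℝ) × ℝ // IsStrictSubsol T g h x.1 ∧ 0 < x.2}
  have : Nonempty ι := ⟨⟨(v₀, 1), hv₀, one_pos⟩⟩
  obtain ⟨⟨⟨v, δ⟩, hv, hδ⟩, hsub⟩ := hK.elim_directed_cover
    (fun x : ι => {p | φ p + x.1.2 < x.1.1 p})
    (fun x => isOpen_lt (hφ.add continuous_const) x.2.1.smooth.continuous)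
    (fun p hp => by
      obtain ⟨v, hv, hvp⟩ := H.exists_lt_of_lt_lowerSol (hlt p hp)
      refine mem_iUnion.2 ⟨⟨(v, (v p - φ p) / 2), hv, by simpa using by linarith⟩, ?_⟩
      change φ p + (v p - φ p) / 2 < v p
      linarith)
    (by
      rintro ⟨⟨v, δ⟩, hv, hδ⟩ ⟨⟨w, η⟩, hw, hη⟩
      obtain ⟨u, hu, hle⟩ := hv.exists_ge_sup H hw
      refine ⟨⟨(u, min δ η), hu, lt_min hδ hη⟩, fun p hp => ?_, fun p hp => ?_⟩
      · change φ p + min δ η < u p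
        have hp' : φ p + δ < v p := hp
        linarith [min_le_left δ η, (le_max_left _ _).trans (hle p)]
      · change φ p + min δ η < u p
        have hp' : φ p + η < w p := hp
        linarith [min_le_right δ η, (le_max_right _ _).trans (hle p)])
  exact ⟨v, hv, δ, hδ, fun p hp => hsub hp⟩

lemma dirDeriv_add_const {φ : Spacetime d → ℝ} (hφ : ContDiff ℝ ∞ φ) (a : ℝ) (u : Spacetime d) :
    dirDeriv u (fun p => φ p + a) = dirDeriv u φ := by
  rw [dirDeriv_add hφ contDiff_const, dirDeriv_const]
  simp

lemma ParabolicData.parabOp_add_const (H : ParabolicData d T g h L c) {φ : Spacetime d → ℝ}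
    (hφ : ContDiff ℝ ∞ φ) {a : ℝ} (ha : 0 ≤ a) {p : Spacetime d} (hp : p ∈ cylQbar d T) :
    parabOp g φ p - L * a ≤ parabOp g (fun p => φ p + a) p := by
  have h1 : spGrad (fun p => φ p + a) p = spGrad φ p := by
    simp only [spGrad, dirDeriv_add_const hφ]
  have h2 : spHess (fun p => φ p + a) p = spHess φ p := by
    simp only [spHess, dirDeriv_add_const hφ]
  have h3 := (abs_le.1 (H.lip p hp (φ p + a) (φ p) (spGrad φ p) (spGrad φ p) (spHess φ p)
    (spHess φ p) (spHess_isSymm hφ p) (spHess_isSymm hφ p))).1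
  simp only [sub_self, abs_zero, Finset.sum_const_zero, add_zero, add_sub_cancel_left,
    abs_of_nonneg ha] at h3
  simp only [parabOp, h1, h2, dirDeriv_add_const hφ]
  linarith

/-- The supremum of the subsolutions is a viscosity supersolution. -/
lemma ParabolicData.parabOp_nonpos_of_touching (H : ParabolicData d T g h L c)
    {p₀ : Spacetime d} (hp₀ : p₀ ∈ cylQ d T) {φ : Spacetime d → ℝ} (hφ : ContDiff ℝ ∞ φ)
    (heq : φ p₀ = lowerSol T g h p₀)
    (hlt : ∀ p ∈ cylQbar d T, p ≠ p₀ → φ p < lowerSol T g h p) : parabOp g φ p₀ ≤ 0 := by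
  by_contra! hpos
  have hp₀' := cylQ_subset_cylQbar d T hp₀
  have hnb : p₀ ∉ cylBdry d T := by
    rintro (h1 | h1)
    · have h2 := hp₀.2
      have h3 := h1.2
      simp only [mem_ball_zero_iff, mem_sphere_iff_norm, sub_zero] at h2 h3
      linarith
    · exact hp₀.1.2.ne h1.1
  set e := parabOp g φ p₀ / 2 with he
  have hcont := H.continuousOn_parabOp hφ p₀ hp₀'
  have h1 : ∀ᶠ p in 𝓝 p₀, p ∈ cylQbar d T → e < parabOp g φ p :=
    eventually_nhdsWithin_iff.1 (hcont.eventually (lt_mem_nhds (by linarith)))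
  have h2 : ∀ᶠ p in 𝓝 p₀, p ∉ cylBdry d T :=
    (isCompact_cylBdry H.T_pos).isClosed.isOpen_compl.mem_nhds hnb
  obtain ⟨U, hU, hUo, hpU⟩ := eventually_nhds_iff.1 (h1.and h2)
  have hK : IsCompact (cylQbar d T \ U) := (isCompact_cylQbar d T).diff hUo
  obtain ⟨v, hv, δ, hδ, hvK⟩ := H.exists_strictSubsol_gt hK hφ.continuous fun p hp =>
    hlt p hp.1 fun hpp => hp.2 (hpp ▸ hpU)
  have hL := H.L_nonneg
  set μ := min (δ / 2) (e / (L + 1)) with hμ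
  have hμpos : 0 < μ := lt_min (by positivity) (by positivity)
  have hμ1 : 2 * μ ≤ δ := by linarith [min_le_left (δ / 2) (e / (L + 1))]
  have hμ2 : L * μ < e := by
    have : μ * (L + 1) ≤ e := (le_div_iff₀ (by positivity)).1 (min_le_right _ _)
    linarith
  obtain ⟨w, hw, hle⟩ := hv.exists_ge_max H (φ := fun p => φ p + μ) (by fun_prop) hμpos
    (fun p hp hvp => by
      have hpU' : p ∈ U := by
        by_contra hpn
        linarith [hvK p ⟨hp, hpn⟩]
      linarith [H.parabOp_add_const hφ hμpos.le hp, (hU p hpU').1 hp])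
    (fun p hp => by
      have hpn : p ∉ U := fun hpU' => (hU p hpU').2 hp
      linarith [hvK p ⟨cylBdry_subset_cylQbar H.T_pos hp, hpn⟩, hv.lt p hp])
  linarith [hw.le_lowerSol H hp₀', (le_max_right _ _).trans (hle p₀)]

/-- The squared Euclidean distance in spacetime. -/
noncomputable def sqDist (p₀ p : Spacetime d) : ℝ :=
  (p.1 - p₀.1) ^ 2 + ∑ i, (p.2 i - p₀.2 i) ^ 2

/-- The space coordinates. -/
noncomputable def spaceCoord (i : Fin d) : Spacetime d →L[ℝ] ℝ :=
  (EuclideanSpace.proj i).comp (ContinuousLinearMap.snd ℝ ℝ _)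

lemma spaceCoord_apply (i : Fin d) (p : Spacetime d) : spaceCoord i p = p.2 i := rfl

lemma contDiff_sqDist (p₀ : Spacetime d) : ContDiff ℝ ∞ (sqDist p₀) := by
  have : sqDist p₀ = fun p => (timeCoord d p - p₀.1) ^ 2 + ∑ i, (spaceCoord i p - p₀.2 i) ^ 2 := rfl
  rw [this]
  fun_prop

@[simp] lemma sqDist_self (p₀ : Spacetime d) : sqDist p₀ p₀ = 0 := by simp [sqDist]

lemma sqDist_nonneg (p₀ p : Spacetime d) : 0 ≤ sqDist p₀ p :=
  add_nonneg (sq_nonneg _) (Finset.sum_nonneg fun _ _ => sq_nonneg _)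

lemma sqDist_pos {p₀ p : Spacetime d} (hne : p ≠ p₀) : 0 < sqDist p₀ p := by
  refine lt_of_le_of_ne (sqDist_nonneg p₀ p) fun h0 => hne ?_
  have h1 := (add_eq_zero_iff_of_nonneg (sq_nonneg _)
    (Finset.sum_nonneg fun _ _ => sq_nonneg _)).1 h0.symm
  refine Prod.ext (sub_eq_zero.1 (pow_eq_zero_iff two_ne_zero |>.1 h1.1)) ?_
  ext i
  have := (Finset.sum_eq_zero_iff_of_nonneg fun _ _ => sq_nonneg _).1 h1.2 i (Finset.mem_univ i)
  exact sub_eq_zero.1 (pow_eq_zero_iff two_ne_zero |>.1 this)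

lemma hasDerivAt_sq_sub (a s : ℝ) : HasDerivAt (fun s => (s - a) ^ 2) (2 * (s - a)) s := by
  refine (((hasDerivAt_id s).sub_const a).pow 2).congr_deriv ?_
  simp

lemma hasDerivAt_two_mul_sub (a s : ℝ) : HasDerivAt (fun s => 2 * (s - a)) 2 s := by
  refine (((hasDerivAt_id s).sub_const a).const_mul 2).congr_deriv ?_
  simp

lemma dirDeriv_sqDist (p₀ u : Spacetime d) : dirDeriv u (sqDist p₀) = fun p =>
    u.1 * (2 * (p.1 - p₀.1)) + ∑ i, u.2 i * (2 * (p.2 i - p₀.2 i)) := by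
  have : sqDist p₀ = fun p => (timeCoord d p - p₀.1) ^ 2 + ∑ i, (spaceCoord i p - p₀.2 i) ^ 2 := rfl
  rw [this, dirDeriv_add (by fun_prop) (by fun_prop), dirDeriv_sum (fun i => by fun_prop),
    dirDeriv_comp_clm (hasDerivAt_sq_sub _)]
  simp only [dirDeriv_comp_clm (hasDerivAt_sq_sub _)]
  rfl

lemma dirDeriv_dirDeriv_sqDist (p₀ u v : Spacetime d) : dirDeriv v (dirDeriv u (sqDist p₀)) =
    fun _ => 2 * (v.1 * u.1) + ∑ i, 2 * (v.2 i * u.2 i) := by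
  have : dirDeriv u (sqDist p₀) = fun p => u.1 * (2 * (timeCoord d p - p₀.1)) +
      ∑ i, u.2 i * (2 * (spaceCoord i p - p₀.2 i)) := dirDeriv_sqDist p₀ u
  rw [this, dirDeriv_add (by fun_prop) (by fun_prop), dirDeriv_sum (fun i => by fun_prop),
    dirDeriv_const_mul (by fun_prop), dirDeriv_comp_clm (hasDerivAt_two_mul_sub _)]
  have hi : ∀ i, dirDeriv v (fun p => u.2 i * (2 * (spaceCoord i p - p₀.2 i))) = fun p =>
      u.2 i * (spaceCoord i v * 2) := fun i => by
    rw [dirDeriv_const_mul (by fun_prop), dirDeriv_comp_clm (hasDerivAt_two_mul_sub _)]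
  simp only [hi]
  funext p
  simp only [timeCoord_apply, spaceCoord_apply]
  refine congrArg₂ _ (by ring) (Finset.sum_congr rfl fun i _ => by ring)

lemma dirDeriv_sqDist_sq (p₀ u : Spacetime d) : dirDeriv u (fun p => sqDist p₀ p * sqDist p₀ p) =
    fun p => 2 * (sqDist p₀ p * dirDeriv u (sqDist p₀) p) := by
  rw [dirDeriv_mul (contDiff_sqDist p₀) (contDiff_sqDist p₀)]
  funext p
  ring

/-- The viscosity supersolution inequality for functions touching from below up to second order. -/
lemma ParabolicData.le_zero_of_subjet (H : ParabolicData d T g h L c)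
    {p₀ : Spacetime d} (hp₀ : p₀ ∈ cylQ d T) {ψ : Spacetime d → ℝ} (hψ : ContDiff ℝ ∞ ψ)
    (hjet : ∀ η > 0, ∀ᶠ p in 𝓝 p₀, p ∈ cylQbar d T →
      lowerSol T g h p₀ + (ψ p - ψ p₀) - η * sqDist p₀ p ≤ lowerSol T g h p) :
    dirDeriv (timeDir d) ψ p₀ + g p₀.1 p₀.2 (lowerSol T g h p₀) (spGrad ψ p₀) (spHess ψ p₀) ≤ 0 := by
  have hL := H.L_nonneg
  refine le_of_forall_pos_le_add fun ε hε => ?_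
  set η := ε / (2 * d * L + 1) with hη
  have hηpos : 0 < η := by positivity
  obtain ⟨U, hU, hUo, hpU⟩ := eventually_nhds_iff.1 (hjet (η / 2) (by positivity))
  have hK : IsCompact (cylQbar d T \ U) := (isCompact_cylQbar d T).diff hUo
  obtain ⟨r, hr, hrK⟩ := hK.exists_pos_le (contDiff_sqDist p₀).continuous.continuousOn
    fun p hp => sqDist_pos fun hpp => hp.2 (hpp ▸ hpU)
  obtain ⟨v, hv⟩ := H.exists_strictSubsol
  obtain ⟨X, hX⟩ := hK.exists_bound_of_continuousOn
    (f := fun p => lowerSol T g h p₀ + (ψ p - ψ p₀) - v p)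
    (by have := hψ.continuous; have := hv.smooth.continuous; fun_prop)
  set C := (|X| + 1) / r ^ 2 with hC
  have hCpos : 0 < C := by positivity
  have hs := contDiff_sqDist p₀
  set φ : Spacetime d → ℝ := fun p => (lowerSol T g h p₀ - ψ p₀) + (ψ p + ((-η) * sqDist p₀ p +
    (-C) * (sqDist p₀ p * sqDist p₀ p))) with hφ
  have hφs : ContDiff ℝ ∞ φ := by fun_prop
  have hd1 : ∀ u, dirDeriv u φ = fun p => dirDeriv u ψ p + ((-η) * dirDeriv u (sqDist p₀) p +
      (-C) * (2 * (sqDist p₀ p * dirDeriv u (sqDist p₀) p))) := fun u => by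
    rw [hφ, dirDeriv_add contDiff_const (by fun_prop), dirDeriv_const,
      dirDeriv_add hψ (by fun_prop), dirDeriv_add (by fun_prop) (by fun_prop),
      dirDeriv_const_mul hs, dirDeriv_const_mul (by fun_prop), dirDeriv_sqDist_sq]
    simp
  have hs0 : ∀ u, dirDeriv u (sqDist p₀) p₀ = 0 := fun u => by simp [dirDeriv_sqDist]
  have hd1' : ∀ u, dirDeriv u φ p₀ = dirDeriv u ψ p₀ := fun u => by simp [hd1, hs0]
  have hd2 : ∀ i j, dirDeriv (spaceDir i) (dirDeriv (spaceDir j) φ) p₀ =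
      dirDeriv (spaceDir i) (dirDeriv (spaceDir j) ψ) p₀ - 2 * η * (if i = j then 1 else 0) :=
    fun i j => by
    have k1 := hψ.dirDeriv (spaceDir j)
    have k2 := hs.dirDeriv (spaceDir j)
    rw [hd1, dirDeriv_add k1 (by fun_prop), dirDeriv_add (by fun_prop) (by fun_prop),
      dirDeriv_const_mul k2, dirDeriv_const_mul (by fun_prop), dirDeriv_const_mul (by fun_prop),
      dirDeriv_mul hs k2]
    simp only [hs0, sqDist_self, dirDeriv_dirDeriv_sqDist]
    have k3 : 2 * ((spaceDir i : Spacetime d).1 * (spaceDir j : Spacetime d).1) +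
        ∑ k, 2 * ((spaceDir i : Spacetime d).2 k * (spaceDir j : Spacetime d).2 k) =
        2 * (if i = j then 1 else 0) := by
      simp [spaceDir, eq_comm]
    rw [k3]
    ring
  have htest := H.parabOp_nonpos_of_touching hp₀ hφs (by simp [hφ]) fun p hp hne => by
    have hpos := sqDist_pos hne
    by_cases hpn : p ∈ U
    · have k1 := hU p hpn hp
      have k2 : 0 < C * (sqDist p₀ p * sqDist p₀ p) := by positivity
      have k3 : 0 < η / 2 * sqDist p₀ p := by positivity
      simp only [hφ]
      linarith
    · have k1 := (abs_le.1 (hX p ⟨hp, hpn⟩)).2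
      have k2 := hrK p ⟨hp, hpn⟩
      have k3 : |X| + 1 ≤ C * (sqDist p₀ p * sqDist p₀ p) := by
        calc |X| + 1 = C * (r * r) := by rw [hC]; field_simp
          _ ≤ _ := by gcongr
      have k4 := hv.le_lowerSol H hp
      have k5 := le_abs_self X
      have k6 : 0 < η * sqDist p₀ p := by positivity
      simp only [hφ]
      linarith
  have hgr : spGrad φ p₀ = spGrad ψ p₀ := by simp only [spGrad, hd1']
  have hval : φ p₀ = lowerSol T g h p₀ := by simp [hφ]
  have hlip := (abs_le.1 (H.lip p₀ (cylQ_subset_cylQbar d T hp₀) (φ p₀) (φ p₀) (spGrad φ p₀)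
    (spGrad φ p₀) (spHess φ p₀) (spHess ψ p₀) (spHess_isSymm hφs p₀) (spHess_isSymm hψ p₀))).1
  have hsum : ∑ i, ∑ j, |spHess φ p₀ i j - spHess ψ p₀ i j| = d * (2 * η) := by
    simp only [spHess, Matrix.of_apply, hd2]
    simp [apply_ite abs, abs_of_pos hηpos]
  rw [hsum] at hlip
  simp only [sub_self, abs_zero, Finset.sum_const_zero, zero_add] at hlip
  rw [parabOp, hd1'] at htest
  rw [hgr, hval] at htest hlip
  have hε : L * (d * (2 * η)) ≤ ε := by
    have : η * (2 * d * L + 1) = ε := by rw [hη]; field_simp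
    linarith
  linarith

/-- Spacetime with the Euclidean norm. -/
abbrev EuclideanSpacetime (d : ℕ) := WithLp 2 (ℝ × EuclideanSpace ℝ (Fin d))

/-- The identification of spacetime with its Euclidean version. -/
noncomputable def toEuclid (d : ℕ) : Spacetime d ≃L[ℝ] EuclideanSpacetime d :=
  (WithLp.prodContinuousLinearEquiv 2 ℝ ℝ (EuclideanSpace ℝ (Fin d))).symm

lemma norm_toEuclid_sub_sq (p₀ p : Spacetime d) :
    ‖toEuclid d p - toEuclid d p₀‖ ^ 2 = sqDist p₀ p := by
  rw [← map_sub, WithLp.prod_norm_sq_eq_of_L2, EuclideanSpace.norm_sq_eq]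
  simp [toEuclid, sqDist]

lemma norm_fst_add_norm_snd_le (p : Spacetime d) : |p.1| + ‖p.2‖ ≤ 2 * ‖toEuclid d p‖ := by
  have h1 : ‖p.1‖ ≤ ‖toEuclid d p‖ := WithLp.norm_fst_le _ (toEuclid d p)
  have h2 : ‖p.2‖ ≤ ‖toEuclid d p‖ := WithLp.norm_snd_le _ (toEuclid d p)
  rw [Real.norm_eq_abs] at h1
  linarith

lemma norm_toEuclid_timeDir : ‖toEuclid d (timeDir d)‖ = 1 := by
  have h1 := norm_toEuclid_sub_sq (0 : Spacetime d) (timeDir d)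
  rw [map_zero, sub_zero] at h1
  refine (pow_eq_one_iff_of_nonneg (norm_nonneg _) two_ne_zero).1 (h1.trans ?_)
  simp [sqDist, timeDir]

lemma norm_toEuclid_spaceDir (i : Fin d) : ‖toEuclid d (spaceDir i)‖ = 1 := by
  have h1 := norm_toEuclid_sub_sq (0 : Spacetime d) (spaceDir i)
  rw [map_zero, sub_zero] at h1
  refine (pow_eq_one_iff_of_nonneg (norm_nonneg _) two_ne_zero).1 (h1.trans ?_)
  simp [sqDist, spaceDir]

/-- The second order polynomial at `p₀` with given Euclidean gradient and second order part. -/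
noncomputable def quadPoly (b : EuclideanSpacetime d)
    (H : EuclideanSpacetime d →L[ℝ] EuclideanSpacetime d) (p₀ p : Spacetime d) : ℝ :=
  inner ℝ b (toEuclid d p - toEuclid d p₀) +
    inner ℝ (H (toEuclid d p - toEuclid d p₀)) (toEuclid d p - toEuclid d p₀) / 2

/-- The space part of a Euclidean spacetime gradient. -/
noncomputable def spacePart (b : EuclideanSpacetime d) : EuclideanSpace ℝ (Fin d) :=
  WithLp.toLp 2 fun i => inner ℝ b (toEuclid d (spaceDir i))

/-- The space part of the quadratic form of an operator on spacetime. -/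
noncomputable def spaceBlock (H : EuclideanSpacetime d →L[ℝ] EuclideanSpacetime d) :
    Matrix (Fin d) (Fin d) ℝ :=
  Matrix.of fun i j => (inner ℝ (H (toEuclid d (spaceDir j))) (toEuclid d (spaceDir i)) +
    inner ℝ (H (toEuclid d (spaceDir i))) (toEuclid d (spaceDir j))) / 2

lemma contDiff_quadPoly (b : EuclideanSpacetime d)
    (H : EuclideanSpacetime d →L[ℝ] EuclideanSpacetime d) (p₀ : Spacetime d) :
    ContDiff ℝ ∞ (quadPoly b H p₀) := by
  unfold quadPoly
  have h1 : ContDiff ℝ ∞ fun p => toEuclid d p - toEuclid d p₀ :=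
    (toEuclid d).contDiff.sub contDiff_const
  exact (contDiff_const.inner ℝ h1).add (((H.contDiff.comp h1).inner ℝ h1).div_const 2)

lemma dirDeriv_quadPoly (b : EuclideanSpacetime d)
    (H : EuclideanSpacetime d →L[ℝ] EuclideanSpacetime d) (p₀ u : Spacetime d) :
    dirDeriv u (quadPoly b H p₀) = fun p => inner ℝ b (toEuclid d u) +
      (inner ℝ (H (toEuclid d p - toEuclid d p₀)) (toEuclid d u) +
        inner ℝ (H (toEuclid d u)) (toEuclid d p - toEuclid d p₀)) / 2 := by
  funext p
  have h1 : HasFDerivAt (fun p => toEuclid d p - toEuclid d p₀)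
      (toEuclid d : Spacetime d →L[ℝ] EuclideanSpacetime d) p :=
    (toEuclid d).hasFDerivAt.sub_const _
  have h2 := (((hasFDerivAt_const b p).inner ℝ h1).add
    (((H.hasFDerivAt.comp p h1).inner ℝ h1).mul_const (2⁻¹ : ℝ)))
  have h3 : HasFDerivAt (quadPoly b H p₀) _ p := h2
  rw [dirDeriv, h3.fderiv]
  simp
  ring

lemma dirDeriv_dirDeriv_quadPoly (b : EuclideanSpacetime d)
    (H : EuclideanSpacetime d →L[ℝ] EuclideanSpacetime d) (p₀ u v p : Spacetime d) :
    dirDeriv v (dirDeriv u (quadPoly b H p₀)) p =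
      (inner ℝ (H (toEuclid d v)) (toEuclid d u) + inner ℝ (H (toEuclid d u)) (toEuclid d v)) / 2 := by
  have h1 : HasFDerivAt (fun p => toEuclid d p - toEuclid d p₀)
      (toEuclid d : Spacetime d →L[ℝ] EuclideanSpacetime d) p :=
    (toEuclid d).hasFDerivAt.sub_const _
  have k1 := (H.hasFDerivAt.comp p h1).inner ℝ
    (hasFDerivAt_const (𝕜 := ℝ) (toEuclid d u) p)
  have k0 : HasFDerivAt (𝕜 := ℝ) (fun _ : Spacetime d => H (toEuclid d u)) 0 p := hasFDerivAt_const _ p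
  have k2 := k0.inner ℝ h1
  have h2 := ((k1.add k2).mul_const (2⁻¹ : ℝ)).const_add (inner ℝ b (toEuclid d u))
  rw [dirDeriv_quadPoly, dirDeriv]
  refine (congrArg (· v) h2.fderiv).trans ?_
  simp
  ring

lemma dirDeriv_quadPoly_self (b : EuclideanSpacetime d)
    (H : EuclideanSpacetime d →L[ℝ] EuclideanSpacetime d) (p₀ u : Spacetime d) :
    dirDeriv u (quadPoly b H p₀) p₀ = inner ℝ b (toEuclid d u) := by
  simp [dirDeriv_quadPoly]

@[simp] lemma quadPoly_self (b : EuclideanSpacetime d)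
    (H : EuclideanSpacetime d →L[ℝ] EuclideanSpacetime d) (p₀ : Spacetime d) :
    quadPoly b H p₀ p₀ = 0 := by
  simp [quadPoly]

lemma spGrad_quadPoly (b : EuclideanSpacetime d)
    (H : EuclideanSpacetime d →L[ℝ] EuclideanSpacetime d) (p₀ : Spacetime d) :
    spGrad (quadPoly b H p₀) p₀ = spacePart b := by
  simp only [spGrad, spacePart, dirDeriv_quadPoly_self]

lemma spHess_quadPoly (b : EuclideanSpacetime d)
    (H : EuclideanSpacetime d →L[ℝ] EuclideanSpacetime d) (p₀ p : Spacetime d) :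
    spHess (quadPoly b H p₀) p = spaceBlock H := by
  ext i j
  simp only [spHess, spaceBlock, dirDeriv_dirDeriv_quadPoly, Matrix.of_apply]
  ring

lemma spaceBlock_isSymm (H : EuclideanSpacetime d →L[ℝ] EuclideanSpacetime d) :
    (spaceBlock H).IsSymm := by
  ext i j
  simp only [spaceBlock, Matrix.transpose_apply, Matrix.of_apply]
  ring

lemma spaceBlock_neg (H : EuclideanSpacetime d →L[ℝ] EuclideanSpacetime d) :
    spaceBlock (-H) = -spaceBlock H := by
  ext i j
  simp [spaceBlock]
  ring

lemma spacePart_neg (b : EuclideanSpacetime d) : spacePart (-b) = -spacePart b := by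
  ext i
  simp [spacePart]

lemma abs_spacePart_sub_le (b p : EuclideanSpacetime d) :
    ∑ i, |spacePart (b - p) i - spacePart b i| ≤ d * ‖p‖ := by
  have : ∀ i ∈ Finset.univ, |spacePart (b - p) i - spacePart b i| ≤ ‖p‖ := fun i _ => by
    have h1 := abs_real_inner_le_norm p (toEuclid d (spaceDir i))
    rw [norm_toEuclid_spaceDir, mul_one] at h1
    rw [← abs_neg] at h1
    simpa only [spacePart, inner_sub_left, sub_sub_cancel_left] using h1
  refine (Finset.sum_le_sum this).trans_eq ?_
  simp

/-- Second order expansions in Euclidean coordinates, read in spacetime coordinates. -/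
lemma eventually_quadPoly_le {f : Spacetime d → ℝ} {s : Set (Spacetime d)} {p₀ : Spacetime d}
    {b : EuclideanSpacetime d} {H : EuclideanSpacetime d →L[ℝ] EuclideanSpacetime d} {η : ℝ}
    (hf : ∀ᶠ v in 𝓝 (0 : EuclideanSpacetime d), (toEuclid d).symm (toEuclid d p₀ + v) ∈ s →
      f p₀ + inner ℝ b v + inner ℝ (H v) v / 2 - η * ‖v‖ ^ 2 ≤
        f ((toEuclid d).symm (toEuclid d p₀ + v))) :
    ∀ᶠ p in 𝓝 p₀, p ∈ s → f p₀ + quadPoly b H p₀ p - η * sqDist p₀ p ≤ f p := by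
  have ht : Tendsto (fun p => toEuclid d p - toEuclid d p₀) (𝓝 p₀) (𝓝 0) := by
    have : Continuous fun p => toEuclid d p - toEuclid d p₀ := by fun_prop
    simpa using this.tendsto p₀
  filter_upwards [ht.eventually hf] with p hp hps
  have h1 := hp (by simpa using hps)
  rw [norm_toEuclid_sub_sq] at h1
  simp only [add_sub_cancel, ContinuousLinearEquiv.symm_apply_apply] at h1
  rw [quadPoly]
  linarith

/-- The exponential weight in the comparison argument. -/
noncomputable def expWeight (e lam T : ℝ) (p : Spacetime d) : ℝ := e * Real.exp (lam * (T - p.1))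

lemma contDiff_expWeight (e lam T : ℝ) : ContDiff ℝ ∞ (expWeight (d := d) e lam T) := by
  unfold expWeight
  fun_prop

lemma dirDeriv_expWeight (e lam T : ℝ) (u : Spacetime d) :
    dirDeriv u (expWeight e lam T) = fun p => u.1 * (-lam * expWeight e lam T p) := by
  have hG : ∀ s, HasDerivAt (fun s => e * Real.exp (lam * (T - s)))
      (-lam * (e * Real.exp (lam * (T - s)))) s := fun s => by
    refine ((((hasDerivAt_id s).const_sub T).const_mul lam).exp.const_mul e).congr_deriv ?_
    simp
    ring
  exact dirDeriv_comp_clm hG (timeCoord d) u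

/-- The viscosity supersolution inequality for `lowerSol` in terms of Euclidean jets. -/
lemma ParabolicData.le_of_lower_jet (H : ParabolicData d T g h L c) {z : Spacetime d}
    (hz : z ∈ cylQ d T) {b : EuclideanSpacetime d}
    {S : EuclideanSpacetime d →L[ℝ] EuclideanSpacetime d}
    (hjet : ∀ η > 0, ∀ᶠ v in 𝓝 (0 : EuclideanSpacetime d),
      (toEuclid d).symm (toEuclid d z + v) ∈ cylQbar d T →
      lowerSol T g h z + inner ℝ b v + inner ℝ (S v) v / 2 - η * ‖v‖ ^ 2 ≤
        lowerSol T g h ((toEuclid d).symm (toEuclid d z + v))) :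
    inner ℝ b (toEuclid d (timeDir d)) +
      g z.1 z.2 (lowerSol T g h z) (spacePart b) (spaceBlock S) ≤ 0 := by
  have := H.le_zero_of_subjet hz (contDiff_quadPoly b S z) fun η hη => by
    filter_upwards [eventually_quadPoly_le (hjet η hη)] with p hp hpQ
    rw [quadPoly_self, sub_zero]
    exact hp hpQ
  rwa [dirDeriv_quadPoly_self, spGrad_quadPoly, spHess_quadPoly] at this

/-- The viscosity subsolution inequality for the weighted upper solution in terms of Euclidean
jets. -/
lemma ParabolicData.le_of_upper_jet (H : ParabolicData d T g h L c) {e lam : ℝ} {y : Spacetime d}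
    (hy : y ∈ cylQ d T) {b : EuclideanSpacetime d}
    {S : EuclideanSpacetime d →L[ℝ] EuclideanSpacetime d} {u : Spacetime d → ℝ}
    (hu : u = lowerSol T (reflected g) fun p => -h p)
    (hjet : ∀ η > 0, ∀ᶠ v in 𝓝 (0 : EuclideanSpacetime d),
      (toEuclid d).symm (toEuclid d y + v) ∈ cylQbar d T →
      -u ((toEuclid d).symm (toEuclid d y + v)) -
          expWeight e lam T ((toEuclid d).symm (toEuclid d y + v)) ≤
        -u y - expWeight e lam T y + inner ℝ b v + inner ℝ (S v) v / 2 + η * ‖v‖ ^ 2) :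
    lam * expWeight e lam T y - inner ℝ b (toEuclid d (timeDir d)) ≤
      g y.1 y.2 (-u y) (spacePart b) (spaceBlock S) := by
  have hq := contDiff_quadPoly (-b) (-S) y
  have hκ := contDiff_expWeight (d := d) e lam T
  have key := H.reflect.le_zero_of_subjet hy (hq.sub hκ) fun η hη => by
    have h1 : ∀ᶠ v in 𝓝 (0 : EuclideanSpacetime d),
        (toEuclid d).symm (toEuclid d y + v) ∈ cylQbar d T →
        (u y + expWeight e lam T y) + inner ℝ (-b) v + inner ℝ ((-S) v) v / 2 - η * ‖v‖ ^ 2 ≤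
          u ((toEuclid d).symm (toEuclid d y + v)) +
            expWeight e lam T ((toEuclid d).symm (toEuclid d y + v)) := by
      filter_upwards [hjet η hη] with v hv hvQ
      have := hv hvQ
      rw [inner_neg_left, neg_apply, inner_neg_left]
      linarith
    filter_upwards [eventually_quadPoly_le (f := fun p => u p + expWeight e lam T p) h1]
      with p hp hpQ
    have := hp hpQ
    rw [← hu, quadPoly_self]
    linarith
  have h1 : ∀ v, dirDeriv v (fun p => quadPoly (-b) (-S) y p - expWeight e lam T p) =
      fun p => dirDeriv v (quadPoly (-b) (-S) y) p - v.1 * (-lam * expWeight e lam T p) :=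
    fun v => by rw [dirDeriv_sub hq hκ, dirDeriv_expWeight]
  have h2 : spGrad (fun p => quadPoly (-b) (-S) y p - expWeight e lam T p) y = -spacePart b := by
    rw [← spacePart_neg, ← spGrad_quadPoly (-b) (-S) y]
    simp [spGrad, h1, spaceDir]
  have h3 : spHess (fun p => quadPoly (-b) (-S) y p - expWeight e lam T p) y = -spaceBlock S := by
    rw [← spaceBlock_neg, ← spHess_quadPoly (-b) (-S) y y]
    simp [spHess, h1, spaceDir]
  rw [h1, h2, h3] at key
  beta_reduce at key
  rw [dirDeriv_quadPoly_self, ← hu, inner_neg_left] at key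
  simp only [reflected, neg_neg, timeDir] at key
  simp only [timeDir]
  linarith

/-- The error estimate for the difference of the two jet inequalities. -/
lemma ParabolicData.abs_sub_le_of_jets (H : ParabolicData d T g h L c) {y z : Spacetime d}
    (hz : z ∈ cylQbar d T) {r s η : ℝ} {b p : EuclideanSpacetime d}
    {S : EuclideanSpacetime d →L[ℝ] EuclideanSpacetime d}
    (hyz : ∀ (y' : ℝ) (z' : EuclideanSpace ℝ (Fin d)) (γ : Matrix (Fin d) (Fin d) ℝ), γ.IsSymm →
      |g y.1 y.2 y' z' γ - g z.1 z.2 y' z' γ| ≤ η) :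
    g y.1 y.2 r (spacePart b) (spaceBlock S) - g z.1 z.2 s (spacePart (b - p)) (spaceBlock S) ≤
      η + L * (|r - s| + d * ‖p‖) := by
  have h1 := (abs_le.1 (hyz r (spacePart b) (spaceBlock S) (spaceBlock_isSymm S))).2
  have h2 := (abs_le.1 (H.lip z hz s r (spacePart (b - p)) (spacePart b) (spaceBlock S)
    (spaceBlock S) (spaceBlock_isSymm S) (spaceBlock_isSymm S))).1
  simp only [sub_self, abs_zero, Finset.sum_const_zero, add_zero] at h2
  have h3 := mul_le_mul_of_nonneg_left (abs_spacePart_sub_le b p) H.L_nonneg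
  rw [abs_sub_comm s r] at h2
  linarith

lemma exists_expWeight_scale {D : Spacetime d → ℝ} {s : Set (Spacetime d)} {lam : ℝ}
    (hlam : 0 ≤ lam) (hs : ∀ p ∈ s, p.1 ≤ T) (hD : BddAbove (D '' s)) {q : Spacetime d}
    (hq : q ∈ s) (hDq : 0 < D q) :
    ∃ e > 0, (∃ p ∈ s, expWeight e lam T p < D p) ∧ ∀ p ∈ s, D p ≤ 2 * expWeight e lam T p := by
  set f : Spacetime d → ℝ := fun p => D p * Real.exp (-(lam * (T - p.1))) with hf
  have hDf : ∀ p, D p = f p * Real.exp (lam * (T - p.1)) := fun p => by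
    rw [hf, mul_assoc, ← Real.exp_add]
    simp
  have hbdd : BddAbove (f '' s) := by
    obtain ⟨M, hM⟩ := hD
    refine ⟨max M 0, ?_⟩
    rintro _ ⟨p, hp, rfl⟩
    have h1 : D p ≤ max M 0 := (hM (mem_image_of_mem _ hp)).trans (le_max_left _ _)
    have h2 : Real.exp (-(lam * (T - p.1))) ≤ 1 :=
      Real.exp_le_one_iff.2 (neg_nonpos.2 (mul_nonneg hlam (sub_nonneg.2 (hs p hp))))
    exact (mul_le_mul_of_nonneg_right h1 (Real.exp_nonneg _)).trans
      (mul_le_of_le_one_right (le_max_right _ _) h2)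
  have hle : ∀ p ∈ s, f p ≤ sSup (f '' s) := fun p hp => le_csSup hbdd (mem_image_of_mem _ hp)
  have hpos : 0 < sSup (f '' s) := (mul_pos hDq (Real.exp_pos _)).trans_le (hle q hq)
  have hne : (f '' s).Nonempty := ⟨_, mem_image_of_mem _ hq⟩
  obtain ⟨_, ⟨p, hp, rfl⟩, hlt⟩ := exists_lt_of_lt_csSup hne (half_lt_self hpos)
  refine ⟨sSup (f '' s) / 2, half_pos hpos, ⟨p, hp, ?_⟩, fun p hp => ?_⟩
  · rw [hDf p, expWeight]
    exact mul_lt_mul_of_pos_right hlt (Real.exp_pos _)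
  · rw [hDf p, expWeight, ← mul_assoc, mul_div_cancel₀ _ two_ne_zero]
    exact mul_le_mul_of_nonneg_right (hle p hp) (Real.exp_nonneg _)

lemma upperSemicontinuousOn_neg {X : Type*} [TopologicalSpace X] {f : X → ℝ} {s : Set X}
    (hf : LowerSemicontinuousOn f s) : UpperSemicontinuousOn (fun x => -f x) s := by
  intro x hx r hr
  filter_upwards [hf x hx (-r) (by linarith)] with z hz
  linarith

lemma ParabolicData.upperSemicontinuousOn_neg_lowerSol (H : ParabolicData d T g h L c) :
    UpperSemicontinuousOn (fun x => -lowerSol T g h ((toEuclid d).symm x))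
      ((toEuclid d).symm ⁻¹' cylQbar d T) :=
  upperSemicontinuousOn_neg (H.lowerSemicontinuousOn_lowerSol.comp
    (toEuclid d).symm.continuous.continuousOn fun _ hx => hx)

/-- The comparison between the upper and the lower solution. -/
theorem ParabolicData.neg_lowerSol_reflected_le (H : ParabolicData d T g h L c)
    {q : Spacetime d} (hq : q ∈ cylQbar d T) :
    -lowerSol T (reflected g) (fun p => -h p) q ≤ lowerSol T g h q := by
  set w := lowerSol T g h with hw
  set u := lowerSol T (reflected g) (fun p => -h p) with hu
  by_contra! hlt
  have hL := H.L_nonneg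
  have hK : IsCompact ((toEuclid d).symm ⁻¹' cylQbar d T) :=
    (toEuclid d).symm.toHomeomorph.isCompact_preimage.2 (isCompact_cylQbar d T)
  have husc : UpperSemicontinuousOn (fun p => -u p) (cylQbar d T) :=
    upperSemicontinuousOn_neg H.reflect.lowerSemicontinuousOn_lowerSol
  have hwsc : UpperSemicontinuousOn (fun p => -w p) (cylQbar d T) :=
    upperSemicontinuousOn_neg H.lowerSemicontinuousOn_lowerSol
  have hD : BddAbove ((fun p => -u p + -w p) '' cylQbar d T) :=
    UpperSemicontinuousOn.bddAbove_of_isCompact (isCompact_cylQbar d T) (husc.add hwsc)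
  set lam := 2 * L + 1 with hlam
  obtain ⟨e, he, ⟨p₁, hp₁, hDp₁⟩, hDle⟩ := exists_expWeight_scale (lam := lam) (by positivity)
    (fun p hp => hp.1.2) hD hq (by linarith)
  set κ := expWeight (d := d) e lam T with hκ
  have hκpos : ∀ p, 0 < κ p := fun p => mul_pos he (Real.exp_pos _)
  have hκc : Continuous κ := (contDiff_expWeight e lam T).continuous
  have hκE : Continuous fun x => κ ((toEuclid d).symm x) :=
    hκc.comp (toEuclid d).symm.continuous
  have hA : UpperSemicontinuousOn (fun x => -u ((toEuclid d).symm x) + -κ ((toEuclid d).symm x))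
      ((toEuclid d).symm ⁻¹' cylQbar d T) :=
    H.reflect.upperSemicontinuousOn_neg_lowerSol.add hκE.neg.continuousOn.upperSemicontinuousOn
  obtain ⟨s, hs, hsle, hlim⟩ := exists_limit_doubledMax hK hA H.upperSemicontinuousOn_neg_lowerSol
    (q := toEuclid d p₁) (by simpa using hp₁)
  simp only [ContinuousLinearEquiv.symm_apply_apply, ← hw] at hsle hlim
  set s₀ := (toEuclid d).symm s with hs₀
  have hs₀Q : s₀ ∉ cylBdry d T := fun hmem => by
    have h1 := H.le_lowerSol_bdry hmem
    have h2 := H.reflect.le_lowerSol_bdry hmem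
    simp only [← hu, ← hw] at h1 h2
    linarith only [h1, h2, hκpos s₀, hsle, hDp₁]
  set X := lam + 2 + 3 * L + L * d with hX
  have hXpos : 0 < X := by positivity
  set η := κ s₀ / (2 * X) with hη
  have hηpos : 0 < η := div_pos (hκpos _) (by positivity)
  have hηX : η * X = κ s₀ / 2 := by rw [hη]; field_simp
  obtain ⟨ρ, hρ, hnear⟩ : ∃ ρ > 0, ∀ x, ‖x - s‖ < ρ → (toEuclid d).symm x ∉ cylBdry d T ∧
      |κ ((toEuclid d).symm x) - κ s₀| < η := by
    have h1 : ∀ᶠ x in 𝓝 s, (toEuclid d).symm x ∉ cylBdry d T :=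
      (toEuclid d).symm.continuous.continuousAt.eventually
        ((isCompact_cylBdry H.T_pos).isClosed.isOpen_compl.mem_nhds hs₀Q)
    obtain ⟨ρ, hρ, hb⟩ := Metric.eventually_nhds_iff.1
      (h1.and (Metric.continuousAt_iff'.1 hκE.continuousAt η hηpos))
    exact ⟨ρ, hρ, fun x hx => hb (by rwa [dist_eq_norm])⟩
  obtain ⟨δ, hδ, hunif⟩ := H.unif η hηpos
  obtain ⟨p, y, z, b, S, hpε, hy, hz, hys, hzs, hyz, hAy, hBz, hjets⟩ :=
    hlim (min η (min ρ (δ / 4))) (by positivity)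
  set ε := min η (min ρ (δ / 4)) with hε
  have hε1 : ε ≤ η := min_le_left _ _
  have hε2 : ε ≤ ρ := (min_le_right _ _).trans (min_le_left _ _)
  have hε3 : ε ≤ δ / 4 := (min_le_right _ _).trans (min_le_right _ _)
  obtain ⟨y₀, rfl⟩ := (toEuclid d).surjective y
  obtain ⟨z₀, rfl⟩ := (toEuclid d).surjective z
  have hyn := hnear _ (hys.trans_le hε2)
  have hzn := hnear _ (hzs.trans_le hε2)
  simp only [mem_preimage, ContinuousLinearEquiv.symm_apply_apply] at hy hz hyz hAy hBz hjets hyn hzn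
  have hyQ : y₀ ∈ cylQ d T := (mem_cylQ_or_cylBdry hy).resolve_right hyn.1
  have hzQ : z₀ ∈ cylQ d T := (mem_cylQ_or_cylBdry hz).resolve_right hzn.1
  have hdist : |y₀.1 - z₀.1| + ‖y₀.2 - z₀.2‖ ≤ δ := by
    have h1 := norm_fst_add_norm_snd_le (y₀ - z₀)
    rw [map_sub] at h1
    have h2 := norm_sub_le_norm_sub_add_norm_sub (toEuclid d y₀) s (toEuclid d z₀)
    rw [norm_sub_rev s] at h2
    refine h1.trans ?_
    linarith only [h2, hys, hzs, hε3]
  have hup := H.le_of_upper_jet (e := e) (lam := lam) (b := b) (S := S) hyQ hu fun η hη => by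
    filter_upwards [hjets η hη] with v hv hvQ
    linarith only [hv.1 hvQ]
  have hlow := H.le_of_lower_jet (b := b - p) (S := S) hzQ fun η hη => by
    filter_upwards [hjets η hη] with v hv hvQ
    linarith only [hv.2 hvQ]
  have herr := H.abs_sub_le_of_jets hz (r := -u y₀) (s := w z₀) (b := b) (p := p) (S := S)
    (hunif y₀ hy z₀ hz hdist)
  have hpt : inner ℝ p (toEuclid d (timeDir d)) ≤ ‖p‖ := by
    have := real_inner_le_norm p (toEuclid d (timeDir d))
    rwa [norm_toEuclid_timeDir, mul_one] at this
  have hs2 := hDle s₀ hs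
  beta_reduce at hs2
  have hκy := abs_lt.1 hyn.2
  have hr : |-u y₀ - w z₀| ≤ 2 * κ s₀ + 3 * η := by
    rw [abs_le]
    constructor <;>
      linarith only [hyz, hAy, hBz, hs2, hκy.1, hκy.2, hε1, hκpos s₀, hsle, hDp₁, hηpos]
  have h1 : L * (|-u y₀ - w z₀| + d * ‖p‖) ≤ L * (2 * κ s₀ + 3 * η + d * η) := by
    have : ‖p‖ ≤ η := hpε.le.trans hε1
    gcongr
  have h2 : lam * (κ s₀ - η) ≤ lam * κ y₀ := by
    gcongr
    linarith only [hκy.1]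
  rw [inner_sub_left] at hlow
  change lam * κ y₀ - _ ≤ _ at hup
  change _ + g z₀.1 z₀.2 (w z₀) _ _ ≤ _ at hlow
  rw [hX, hlam] at hηX
  rw [hlam] at h2 hup
  linarith only [h1, h2, hup, hlow, herr, hpt, hpε, hε1, hηX, hκpos s₀]

lemma norm_le_sum_abs (z : EuclideanSpace ℝ (Fin d)) : ‖z‖ ≤ ∑ i, |z i| := by
  conv_lhs => rw [← (EuclideanSpace.basisFun (Fin d) ℝ).sum_repr z]
  refine (norm_sum_le _ _).trans (Finset.sum_le_sum fun i _ => ?_)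
  rw [norm_smul, (EuclideanSpace.basisFun (Fin d) ℝ).norm_eq_one, mul_one]
  simp

lemma matNorm_le_sum_abs (γ : Matrix (Fin d) (Fin d) ℝ) : matNorm d γ ≤ ∑ i, ∑ j, |γ i j| := by
  refine ContinuousLinearMap.opNorm_le_bound _ (by positivity) fun v => ?_
  refine (norm_le_sum_abs _).trans ?_
  rw [Finset.sum_mul]
  refine Finset.sum_le_sum fun i _ => ?_
  simp only [matCLM, Matrix.ofLp_toEuclideanCLM, Matrix.mulVec, dotProduct]
  refine (Finset.abs_sum_le_sum_abs _ _).trans ?_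
  rw [Finset.sum_mul]
  refine Finset.sum_le_sum fun j _ => ?_
  rw [abs_mul]
  exact mul_le_mul_of_nonneg_left (PiLp.norm_apply_le v j) (abs_nonneg _)

/-- Perron's envelopes of classical super- and subsolutions coincide. -/
theorem ParabolicData.sInf_supersol_eq_sSup_subsol (H : ParabolicData d T g h L c)
    {p : Spacetime d} (hp : p ∈ cylQbar d T) :
    sInf {r : ℝ | ∃ w, IsClassicalSupersol d T g h w ∧ r = w p} =
      sSup {r : ℝ | ∃ w, IsClassicalSubsol d T g h w ∧ r = w p} := by
  obtain ⟨w₀, hw₀⟩ := H.exists_supersol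
  obtain ⟨v₀, hv₀⟩ := H.exists_strictSubsol
  obtain ⟨u₀, hu₀⟩ := H.reflect.exists_strictSubsol
  have hle : ∀ r ∈ {r : ℝ | ∃ w, IsClassicalSubsol d T g h w ∧ r = w p},
      ∀ r' ∈ {r : ℝ | ∃ w, IsClassicalSupersol d T g h w ∧ r = w p}, r ≤ r' := by
    rintro _ ⟨v, hv, rfl⟩ _ ⟨w, hw, rfl⟩
    exact H.classical_le hv hw p hp
  have hsup : (w₀ p) ∈ {r : ℝ | ∃ w, IsClassicalSupersol d T g h w ∧ r = w p} := ⟨w₀, hw₀, rfl⟩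
  have hsub : (v₀ p) ∈ {r : ℝ | ∃ w, IsClassicalSubsol d T g h w ∧ r = w p} :=
    ⟨v₀, hv₀.isClassicalSubsol, rfl⟩
  refine le_antisymm ?_ (csSup_le ⟨_, hsub⟩ fun r hr => le_csInf ⟨_, hsup⟩ (hle r hr))
  have h1 : lowerSol T g h p ≤ sSup {r : ℝ | ∃ w, IsClassicalSubsol d T g h w ∧ r = w p} := by
    refine csSup_le ⟨v₀ p, v₀, hv₀, rfl⟩ ?_
    rintro _ ⟨v, hv, rfl⟩
    exact le_csSup ⟨w₀ p, fun r hr => hle r hr _ hsup⟩ ⟨v, hv.isClassicalSubsol, rfl⟩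
  have h2 : lowerSol T (reflected g) (fun p => -h p) p ≤
      -sInf {r : ℝ | ∃ w, IsClassicalSupersol d T g h w ∧ r = w p} := by
    refine csSup_le ⟨u₀ p, u₀, hu₀, rfl⟩ ?_
    rintro _ ⟨u, hu, rfl⟩
    have : sInf {r : ℝ | ∃ w, IsClassicalSupersol d T g h w ∧ r = w p} ≤ -u p :=
      csInf_le ⟨v₀ p, fun r hr => hle _ hsub r hr⟩
        ⟨fun p => -u p, hu.isClassicalSubsol.neg_of_reflected, rfl⟩
    linarith
  linarith [H.neg_lowerSol_reflected_le hp]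

end Parabolic

/-- under continuity, uniform continuity in `(t,x)`, uniform Lipschitz continuity
in `(y,z,γ)` and uniform ellipticity of `g`, boundedness and continuity of the boundary data
`h`, and assuming either that `g` is convex in `γ` or that `d ≤ 2`, the infimum `v̄` of
classical supersolutions lying above `h` on `∂Q` coincides on `Q̄` with the supremum `v̲` of
classical subsolutions lying below `h` on `∂Q`. -/
theorem stmt_0 (d : ℕ) (hd : 1 ≤ d) (T : ℝ) (hT : 0 < T)
    (g : ℝ → EuclideanSpace ℝ (Fin d) → ℝ → EuclideanSpace ℝ (Fin d) →
      Matrix (Fin d) (Fin d) ℝ → ℝ)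
    (h : ℝ × EuclideanSpace ℝ (Fin d) → ℝ)
    -- (i) h bounded and continuous; g continuous; g uniformly continuous in (t,x),
    -- uniformly in (y,z,γ)
    (hhbdd : ∃ Mh, ∀ p ∈ cylBdry d T, |h p| ≤ Mh)
    (hhcont : ContinuousOn h (cylBdry d T))
    (hgcont : ContinuousOn
      (fun q : ℝ × EuclideanSpace ℝ (Fin d) × ℝ × EuclideanSpace ℝ (Fin d) ×
        Matrix (Fin d) (Fin d) ℝ => g q.1 q.2.1 q.2.2.1 q.2.2.2.1 q.2.2.2.2)
      (Set.Icc 0 T ×ˢ Metric.closedBall 0 1 ×ˢ Set.univ ×ˢ Set.univ ×ˢ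
        {γ : Matrix (Fin d) (Fin d) ℝ | γ.IsSymm}))
    (hgUC : ∀ η > (0 : ℝ), ∃ δ > (0 : ℝ), ∀ t t' : ℝ,
      ∀ x x' : EuclideanSpace ℝ (Fin d),
      t ∈ Set.Icc (0 : ℝ) T → t' ∈ Set.Icc (0 : ℝ) T →
      x ∈ Metric.closedBall 0 1 → x' ∈ Metric.closedBall 0 1 →
      |t - t'| + ‖x - x'‖ ≤ δ →
      ∀ (y : ℝ) (z : EuclideanSpace ℝ (Fin d)) (γ : Matrix (Fin d) (Fin d) ℝ), γ.IsSymm →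
        |g t x y z γ - g t' x' y z γ| ≤ η)
    -- (ii) uniform Lipschitz continuity in (y,z,γ) and uniform ellipticity
    (L₀ : ℝ) (hL₀ : 0 ≤ L₀)
    (hgLip : ∀ (t : ℝ) (x : EuclideanSpace ℝ (Fin d)), t ∈ Set.Icc (0 : ℝ) T →
      x ∈ Metric.closedBall 0 1 →
      ∀ (y y' : ℝ) (z z' : EuclideanSpace ℝ (Fin d)) (γ γ' : Matrix (Fin d) (Fin d) ℝ),
        γ.IsSymm → γ'.IsSymm →
        |g t x y z γ - g t x y' z' γ'| ≤ L₀ * (|y - y'| + ‖z - z'‖ + matNorm d (γ - γ')))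
    (c₀ : ℝ) (hc₀ : 0 < c₀)
    (hgell : ∀ (t : ℝ) (x : EuclideanSpace ℝ (Fin d)), t ∈ Set.Icc (0 : ℝ) T →
      x ∈ Metric.closedBall 0 1 →
      ∀ (y : ℝ) (z : EuclideanSpace ℝ (Fin d)) (γ₁ γ₂ : Matrix (Fin d) (Fin d) ℝ),
        γ₁.IsSymm → γ₂.IsSymm → (γ₁ - γ₂).PosSemidef →
        c₀ * (γ₁ - γ₂).trace ≤ g t x y z γ₁ - g t x y z γ₂)
    -- convexity in γ, or d ≤ 2
    (hconv : (∀ (t : ℝ) (x : EuclideanSpace ℝ (Fin d)) (y : ℝ) (z : EuclideanSpace ℝ (Fin d)),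
        ConvexOn ℝ {γ : Matrix (Fin d) (Fin d) ℝ | γ.IsSymm} (fun γ => g t x y z γ)) ∨
      d ≤ 2) :
    ∀ p ∈ cylQbar d T,
      sInf {r : ℝ | ∃ w, IsClassicalSupersol d T g h w ∧ r = w p} =
      sSup {r : ℝ | ∃ w, IsClassicalSubsol d T g h w ∧ r = w p} := by
  intro p hp
  have H : ParabolicData d T g h L₀ c₀ :=
    { T_pos := hT
      bdd := hhbdd
      cont_h := hhcont
      cont_g := hgcont
      unif := fun η hη => by
        obtain ⟨δ, hδ, hunif⟩ := hgUC η hη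
        exact ⟨δ, hδ, fun p hp q hq hpq => hunif p.1 q.1 p.2 q.2 hp.1 hq.1 hp.2 hq.2 hpq⟩
      L_nonneg := hL₀
      lip := fun p hp y y' z z' γ γ' hγ hγ' => by
        refine (hgLip p.1 p.2 hp.1 hp.2 y y' z z' γ γ' hγ hγ').trans ?_
        have h1 := norm_le_sum_abs (z - z')
        have h2 := matNorm_le_sum_abs (γ - γ')
        simp only [PiLp.sub_apply, Matrix.sub_apply] at h1 h2
        gcongr
      c_pos := hc₀
      ell := fun p hp => hgell p.1 p.2 hp.1 hp.2 }
  exact H.sInf_supersol_eq_sSup_subsol hp
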